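/- arXiv:2110.05918 — 3 statements merged into one kernel-verified Lean document; each statement's English description precedes it below -/
import Mathlib

section
/- Let n ≥ 1 and let L2 = ∬_{[-1,1]²} K_n(x,y)² log(1/|x-y|) w(x) w(y) dx dy, where K_n is the Chebyshev kernel and w(x) = 1/(π√(1-x²)). Then L2 = (n+1)·log 2 + H_n + n·H_{2n-1} + H_{2n}/2 - n + 1/2. -/
open Real MeasureTheory Finset

/-- Normalized Chebyshev polynomials of the first kind:
`Ĉ_0 = 1`, `Ĉ_j = √2 · T_j` for `j ≥ 1`. -/
noncomputable def Chat (j : ℕ) (x : ℝ) : ℝ :=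
  if j = 0 then 1 else Real.sqrt 2 * (Polynomial.Chebyshev.T ℝ (j : ℤ)).eval x

/-- The Chebyshev weight `w(x) = 1/(π√(1-x²))`. -/
noncomputable def w0 (x : ℝ) : ℝ := 1 / (Real.pi * Real.sqrt (1 - x ^ 2))

/-- The Chebyshev (projection) kernel `K_n(x,y) = ∑_{j=0}^n Ĉ_j(x)Ĉ_j(y)`. -/
noncomputable def K (n : ℕ) (x y : ℝ) : ℝ :=
  ∑ j ∈ Finset.range (n + 1), Chat j x * Chat j y

/-- The `n`-th harmonic number. -/
noncomputable def H (n : ℕ) : ℝ := ∑ k ∈ Finset.Icc 1 n, 1 / (k : ℝ)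

section helpers

open intervalIntegral

/-- coefficient of the log kernel -/
noncomputable def lamC (l : ℤ) : ℝ := if l = 0 then Real.log 2 else 1 / |(l : ℝ)|

noncomputable def qC (l : ℕ) (t : ℝ) : ℝ := ∑ j ∈ Finset.range l, 2 * cos ((2 * j + 1) * t)

lemma qC_cont (l : ℕ) : Continuous (qC l) := by
  unfold qC; fun_prop

lemma qC_mul_sin (l : ℕ) (t : ℝ) : qC l t * sin t = sin (2 * l * t) := by
  induction l with
  | zero => simp [qC]
  | succ l ih =>
    rw [qC, Finset.sum_range_succ, add_mul, ← qC, ih]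
    have h1 : (2 * ((l + 1 : ℕ) : ℝ) * t) = (2 * l + 1) * t + t := by push_cast; ring
    have h2 : (2 * (l : ℝ) * t) = (2 * l + 1) * t - t := by ring
    rw [h1, h2, sin_add, sin_sub]; ring

lemma int_cos (m : ℤ) : ∫ t in (0 : ℝ)..π, cos (m * t) = if m = 0 then π else 0 := by
  split_ifs with h
  · simp [h]
  · have h' : (m : ℝ) ≠ 0 := by exact_mod_cast h
    rw [intervalIntegral.integral_comp_mul_left (fun t => cos t) h']
    simp [sin_int_mul_pi]

lemma qC_mul_cos (l : ℕ) (hl : l ≠ 0) : ∫ t in (0 : ℝ)..π, qC l t * cos t = π := by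
  have h (t : ℝ) : qC l t * cos t =
      ∑ j ∈ Finset.range l, (cos (((2 * j + 2 : ℤ) : ℝ) * t) + cos (((2 * j : ℤ) : ℝ) * t)) := by
    rw [qC, Finset.sum_mul]
    refine Finset.sum_congr rfl fun j _ => ?_
    have h1 : (((2 * j + 2 : ℤ) : ℝ) * t) = (2 * j + 1) * t + t := by push_cast; ring
    have h2 : (((2 * j : ℤ) : ℝ) * t) = (2 * j + 1) * t - t := by push_cast; ring
    rw [h1, h2, cos_add, cos_sub]; ring
  simp_rw [h]
  rw [intervalIntegral.integral_finsetSum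
    (fun j _ => (by fun_prop : Continuous _).intervalIntegrable _ _)]
  obtain ⟨k, rfl⟩ := Nat.exists_eq_succ_of_ne_zero hl
  have h3 (j : ℕ) : ∫ t in (0 : ℝ)..π,
      (cos (((2 * j + 2 : ℤ) : ℝ) * t) + cos (((2 * j : ℤ) : ℝ) * t)) =
      if j = 0 then π else 0 := by
    rw [intervalIntegral.integral_add ((by fun_prop : Continuous _).intervalIntegrable _ _)
      ((by fun_prop : Continuous _).intervalIntegrable _ _), int_cos, int_cos]
    have : (2 * j + 2 : ℤ) ≠ 0 := by omega
    simp [this]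
  simp_rw [h3]
  simp

lemma ii_log_sin (a b : ℝ) : IntervalIntegrable (fun t => Real.log (sin t)) volume a b :=
  intervalIntegrable_log_sin

lemma int_cos_log_sin (l : ℕ) (hl : l ≠ 0) :
    ∫ t in (0 : ℝ)..π, cos (2 * l * t) * Real.log (sin t) = - π / (2 * l) := by
  have hl' : (l : ℝ) ≠ 0 := by exact_mod_cast hl
  have hi1 : IntervalIntegrable (fun t => cos (2 * l * t) * Real.log (sin t)) volume 0 π :=
    (ii_log_sin 0 π).continuousOn_mul (by fun_prop)
  have hi2 : IntervalIntegrable (fun t => qC l t * cos t / (2 * l)) volume 0 π := by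
    have := qC_cont l
    exact (by fun_prop : Continuous _).intervalIntegrable _ _
  have key := integral_eq_sub_of_hasDerivAt_of_le (a := 0) (b := π)
    (f := fun t => qC l t * (sin t * Real.log (sin t)) / (2 * l))
    (f' := fun t => cos (2 * l * t) * Real.log (sin t) + qC l t * cos t / (2 * l)) pi_pos.le
    (by
      have h1 := Real.continuous_mul_log.comp continuous_sin
      have h2 := qC_cont l
      have : Continuous (fun t => qC l t * (sin t * Real.log (sin t)) / (2 * l)) :=
        (h2.mul h1).div_const _
      exact this.continuousOn)
    (by
      intro t ht
      have hs : sin t ≠ 0 := (sin_pos_of_pos_of_lt_pi ht.1 ht.2).ne'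
      have e : (fun t => qC l t * (sin t * Real.log (sin t)) / (2 * l)) =
          fun t => sin (2 * l * t) * Real.log (sin t) / (2 * l) := by
        ext t; rw [← mul_assoc, qC_mul_sin]
      rw [e]
      have h1 : HasDerivAt (fun t : ℝ => sin (2 * l * t)) (cos (2 * l * t) * (2 * l)) t := by
        have := ((hasDerivAt_id t).const_mul (2 * (l : ℝ))).sin
        simpa using this
      have h2 := ((h1.mul ((hasDerivAt_sin t).log hs)).div_const (2 * (l : ℝ)))
      refine h2.congr_deriv ?_
      rw [← qC_mul_sin]
      field_simp)
    (hi1.add hi2)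
  rw [intervalIntegral.integral_add hi1 hi2, intervalIntegral.integral_div, qC_mul_cos l hl] at key
  simp only [sin_pi, sin_zero, zero_mul, mul_zero, zero_div, sub_zero] at key
  linarith [neg_div (2 * (l : ℝ)) π]

lemma int_sin_log_sin (l : ℕ) :
    ∫ t in (0 : ℝ)..π, sin (2 * l * t) * Real.log (sin t) = 0 := by
  have h := intervalIntegral.integral_comp_sub_left (a := 0) (b := π)
    (fun t => sin (2 * l * t) * Real.log (sin t)) π
  have e (t : ℝ) : sin (2 * l * (π - t)) * Real.log (sin (π - t)) =
      - (sin (2 * l * t) * Real.log (sin t)) := by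
    have : 2 * l * (π - t) = -(2 * l * t) + l * (2 * π) := by ring
    rw [sin_pi_sub, this, sin_add_nat_mul_two_pi, sin_neg]; ring
  simp_rw [e] at h
  rw [intervalIntegral.integral_neg] at h
  simp only [sub_self, sub_zero] at h
  linarith

lemma int_shift (l : ℕ) (θ : ℝ) :
    ∫ t in ((θ - π) / 2)..((θ + π) / 2), cos (2 * l * t - l * θ) * Real.log (sin t) =
      cos (l * θ) * ∫ t in (0 : ℝ)..π, cos (2 * l * t) * Real.log (sin t) := by
  have hp : Function.Periodic (fun t => cos (2 * l * t - l * θ) * Real.log (sin t)) π := by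
    intro t
    have : 2 * l * (t + π) - l * θ = (2 * l * t - l * θ) + l * (2 * π) := by ring
    simp only [this, cos_add_nat_mul_two_pi, sin_add_pi, Real.log_neg_eq_log]
  have h := hp.intervalIntegral_add_eq ((θ - π) / 2) 0
  rw [show (θ - π) / 2 + π = (θ + π) / 2 by ring, zero_add] at h
  rw [h]
  have e (t : ℝ) : cos (2 * l * t - l * θ) * Real.log (sin t) =
      cos (l * θ) * (cos (2 * l * t) * Real.log (sin t)) +
      sin (l * θ) * (sin (2 * l * t) * Real.log (sin t)) := by
    rw [cos_sub]; ring
  simp_rw [e]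
  rw [intervalIntegral.integral_add, intervalIntegral.integral_const_mul,
    intervalIntegral.integral_const_mul, int_sin_log_sin]
  · ring
  · exact ((ii_log_sin 0 π).continuousOn_mul (by fun_prop)).const_mul _
  · exact ((ii_log_sin 0 π).continuousOn_mul (by fun_prop)).const_mul _

lemma ii_plus (θ : ℝ) (a b : ℝ) :
    IntervalIntegrable (fun φ => Real.log (sin ((φ + θ) / 2))) volume a b := by
  have h := (ii_log_sin ((a + θ) / 2) ((b + θ) / 2)).comp_mul_left (c := 1/2)
  have h := h.comp_add_right θ
  have e : (fun φ => Real.log (sin ((φ + θ) / 2))) = fun x => Real.log (sin (1 / 2 * (x + θ))) := by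
    ext x; congr 2; ring
  rw [e]
  convert h using 1 <;> ring

lemma log_split (θ φ : ℝ) (hθ : θ ∈ Set.Icc 0 π) (hφ : φ ∈ Set.Ioo 0 π) (hne : φ ≠ θ) :
    Real.log (1 / |cos θ - cos φ|) =
      -(Real.log 2 + Real.log (sin ((φ + θ) / 2)) + Real.log (sin ((φ + -θ) / 2))) := by
  obtain ⟨h0, h1⟩ := hθ
  obtain ⟨h2, h3⟩ := hφ
  have hs1 : sin ((φ + θ) / 2) ≠ 0 :=
    (sin_pos_of_pos_of_lt_pi (by linarith) (by linarith)).ne'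
  have hs2 : sin ((φ + -θ) / 2) ≠ 0 := by
    intro h
    rw [sin_eq_zero_iff_of_lt_of_lt (by linarith) (by linarith)] at h
    exact hne (by linarith)
  rw [one_div, Real.log_inv, Real.log_abs, cos_sub_cos]
  have : sin ((θ - φ) / 2) = - sin ((φ + -θ) / 2) := by
    rw [← sin_neg]; congr 1; ring
  rw [this, add_comm θ φ, neg_mul, mul_neg, neg_mul, neg_neg, Real.log_mul (by positivity) hs2,
    Real.log_mul two_ne_zero hs1]

lemma ae_split (θ : ℝ) (hθ : θ ∈ Set.Icc 0 π) (f : ℝ → ℝ) :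
    ∀ᵐ φ ∂volume, φ ∈ Set.uIoc 0 π → f φ * Real.log (1 / |cos θ - cos φ|) =
      f φ * -(Real.log 2 + Real.log (sin ((φ + θ) / 2)) + Real.log (sin ((φ + -θ) / 2))) := by
  have h1 : ∀ᵐ φ : ℝ ∂volume, φ ≠ θ := by simp [ae_iff]
  have h2 : ∀ᵐ φ : ℝ ∂volume, φ ≠ π := by simp [ae_iff]
  filter_upwards [h1, h2] with φ h1 h2 hφ
  rw [Set.uIoc_of_le pi_pos.le] at hφ
  rw [log_split θ φ hθ ⟨hφ.1, lt_of_le_of_ne hφ.2 h2⟩ h1]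

lemma ii_log (θ : ℝ) (hθ : θ ∈ Set.Icc 0 π) (f : ℝ → ℝ) (hf : Continuous f) :
    IntervalIntegrable (fun φ => f φ * Real.log (1 / |cos θ - cos φ|)) volume 0 π := by
  have h : IntervalIntegrable (fun φ => f φ * -(Real.log 2 + Real.log (sin ((φ + θ) / 2))
      + Real.log (sin ((φ + -θ) / 2)))) volume 0 π :=
    (((intervalIntegrable_const.add (ii_plus θ 0 π)).add (ii_plus (-θ) 0 π)).neg).continuousOn_mul
      hf.continuousOn
  refine h.congr_ae ?_
  have := ae_split θ hθ f
  rw [Filter.EventuallyEq, ae_restrict_iff' measurableSet_uIoc]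
  filter_upwards [this] with φ h1 h2 using (h1 h2).symm

lemma int_half (l : ℕ) (θ : ℝ) :
    (∫ φ in (0 : ℝ)..π, cos (l * φ) * Real.log (sin ((φ + θ) / 2))) =
      2 * ∫ t in (θ / 2)..((θ + π) / 2), cos (2 * l * t - l * θ) * Real.log (sin t) := by
  have h := intervalIntegral.integral_comp_mul_add (a := 0) (b := π)
    (fun t => cos (2 * l * t - l * θ) * Real.log (sin t)) (c := 1/2) (by norm_num) (θ / 2)
  rw [show (1 / 2 * 0 + θ / 2) = θ / 2 by ring,
    show (1 / 2 * π + θ / 2) = (θ + π) / 2 by ring] at h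
  simp only [one_div, inv_inv, smul_eq_mul] at h
  rw [← h]
  refine intervalIntegral.integral_congr fun φ _ => ?_
  congr 2
  · ring
  · congr 1; ring

lemma inner_nat (l : ℕ) (θ : ℝ) (hθ : θ ∈ Set.Icc 0 π) :
    ∫ φ in (0 : ℝ)..π, cos (l * φ) * Real.log (1 / |cos θ - cos φ|) =
      π * lamC l * cos (l * θ) := by
  rw [intervalIntegral.integral_congr_ae (ae_split θ hθ _)]
  have i1 : IntervalIntegrable (fun φ => cos (l * φ) * Real.log (sin ((φ + θ) / 2))) volume 0 π :=
    (ii_plus θ 0 π).continuousOn_mul (by fun_prop)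
  have i2 : IntervalIntegrable (fun φ => cos (l * φ) * Real.log (sin ((φ + -θ) / 2))) volume 0 π :=
    (ii_plus (-θ) 0 π).continuousOn_mul (by fun_prop)
  have i0 : IntervalIntegrable (fun φ : ℝ => cos (((l : ℤ) : ℝ) * φ) * Real.log 2) volume 0 π :=
    (by fun_prop : Continuous _).intervalIntegrable _ _
  have e (φ : ℝ) : cos (l * φ) * -(Real.log 2 + Real.log (sin ((φ + θ) / 2)) +
      Real.log (sin ((φ + -θ) / 2))) = -(cos (((l : ℤ) : ℝ) * φ) * Real.log 2 +
      cos (l * φ) * Real.log (sin ((φ + θ) / 2)) +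
      cos (l * φ) * Real.log (sin ((φ + -θ) / 2))) := by
    push_cast; ring
  simp_rw [e]
  rw [intervalIntegral.integral_neg, intervalIntegral.integral_add (i0.add i1) i2,
    intervalIntegral.integral_add i0 i1, intervalIntegral.integral_mul_const, int_cos,
    int_half, int_half]
  have r : ∫ t in (-θ / 2)..((-θ + π) / 2), cos (2 * l * t - l * -θ) * Real.log (sin t) =
      ∫ t in ((θ - π) / 2)..(θ / 2), cos (2 * l * t - l * θ) * Real.log (sin t) := by
    have h := intervalIntegral.integral_comp_neg (a := (θ - π) / 2) (b := θ / 2)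
      (fun t => cos (2 * l * t - l * -θ) * Real.log (sin t))
    rw [show -((θ - π) / 2) = (-θ + π) / 2 by ring, show -(θ / 2) = -θ / 2 by ring] at h
    rw [← h]
    refine intervalIntegral.integral_congr fun t _ => ?_
    rw [sin_neg, Real.log_neg_eq_log, ← cos_neg]
    congr 2; ring
  rw [r]
  have iL (a b : ℝ) : IntervalIntegrable
      (fun t => cos (2 * l * t - l * θ) * Real.log (sin t)) volume a b :=
    (ii_log_sin a b).continuousOn_mul (by fun_prop)
  have hadd := intervalIntegral.integral_add_adjacent_intervals
    (iL ((θ - π) / 2) (θ / 2)) (iL (θ / 2) ((θ + π) / 2))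
  rw [int_shift] at hadd
  by_cases hl : l = 0
  · subst hl
    simp [lamC, integral_log_sin_zero_pi] at hadd ⊢
    linarith
  · rw [int_cos_log_sin l hl] at hadd
    have hl' : (l : ℝ) ≠ 0 := by exact_mod_cast hl
    have hl2 : lamC l = 1 / l := by simp [lamC, hl]
    rw [hl2]
    simp only [Int.natCast_eq_zero, hl, if_false]
    have : -(2 * (cos (l * θ) * (-π / (2 * l)))) = π * (1 / l) * cos (l * θ) := by
      field_simp
    rw [← this, ← hadd]; ring

lemma inner_int (l : ℤ) (θ : ℝ) (hθ : θ ∈ Set.Icc 0 π) :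
    ∫ φ in (0 : ℝ)..π, cos (l * φ) * Real.log (1 / |cos θ - cos φ|) =
      π * lamC l * cos (l * θ) := by
  obtain ⟨k, rfl | rfl⟩ := l.eq_nat_or_neg
  · simpa using inner_nat k θ hθ
  · have : lamC (-(k : ℤ)) = lamC k := by simp [lamC]
    rw [this]
    simpa using inner_nat k θ hθ


noncomputable def cC (i : ℕ) : ℝ := if i = 0 then 1 else 2

noncomputable def dC (m : ℤ) : ℝ := if m = 0 then 1 else 0

noncomputable def GC (i j : ℕ) : ℝ := cC i * cC j / 8 *
  (lamC (i + j) * (1 + dC (i + j)) + lamC (i - j) * (1 + dC (i - j))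
    + (lamC (i + j) + lamC (i - j)) * (dC i + dC j))

lemma int_cos' (m : ℤ) : ∫ t in (0 : ℝ)..π, cos (2 * m * t) = π * dC m := by
  have := int_cos (2 * m)
  push_cast at this
  rw [this, dC]
  simp

lemma w0_subst (f : ℝ → ℝ) :
    ∫ x in Set.Icc (-1 : ℝ) 1, f x * w0 x = (1 / π) * ∫ θ in (0 : ℝ)..π, f (cos θ) := by
  rw [← Polynomial.Chebyshev.integral_measureT_eq_integral_cos,
    Polynomial.Chebyshev.integral_measureT, integral_Icc_eq_integral_Ioc,
    ← intervalIntegral.integral_of_le (by norm_num), ← intervalIntegral.integral_const_mul]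
  refine intervalIntegral.integral_congr fun x _ => ?_
  simp only [w0, one_div, mul_inv, Real.sqrt_inv]
  ring

lemma K_cos (n : ℕ) (θ φ : ℝ) : K n (cos θ) (cos φ) =
    ∑ i ∈ Finset.range (n + 1), cC i * (cos (i * θ) * cos (i * φ)) := by
  unfold K
  refine Finset.sum_congr rfl fun i _ => ?_
  unfold Chat cC
  split_ifs with h
  · simp [h]
  · rw [Polynomial.Chebyshev.T_real_cos, Polynomial.Chebyshev.T_real_cos]
    have := Real.mul_self_sqrt (show (0 : ℝ) ≤ 2 by norm_num)
    push_cast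
    linear_combination (cos (i * θ) * cos (i * φ)) * this

lemma cos_prod (i j : ℕ) (t : ℝ) : cos (i * t) * cos (j * t) =
    (cos (((i + j : ℤ) : ℝ) * t) + cos (((i - j : ℤ) : ℝ) * t)) / 2 := by
  push_cast
  rw [add_mul, sub_mul, cos_add, cos_sub]; ring

lemma inner_prod (i j : ℕ) (θ : ℝ) (hθ : θ ∈ Set.Icc 0 π) :
    ∫ φ in (0 : ℝ)..π, (cos (i * φ) * cos (j * φ)) * Real.log (1 / |cos θ - cos φ|) =
      π / 2 * (lamC (i + j) * cos (((i + j : ℤ) : ℝ) * θ)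
        + lamC (i - j) * cos (((i - j : ℤ) : ℝ) * θ)) := by
  have e (φ : ℝ) : (cos (i * φ) * cos (j * φ)) * Real.log (1 / |cos θ - cos φ|) =
      (1 / 2) * (cos (((i + j : ℤ) : ℝ) * φ) * Real.log (1 / |cos θ - cos φ|) +
        cos (((i - j : ℤ) : ℝ) * φ) * Real.log (1 / |cos θ - cos φ|)) := by
    rw [cos_prod]; ring
  simp_rw [e]
  rw [intervalIntegral.integral_const_mul, intervalIntegral.integral_add
    (ii_log θ hθ _ (by fun_prop)) (ii_log θ hθ _ (by fun_prop)), inner_int _ _ hθ, inner_int _ _ hθ]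
  ring

lemma outer_prod (i j : ℕ) :
    ∫ θ in (0 : ℝ)..π, (cos (i * θ) * cos (j * θ)) * (lamC (i + j) * cos (((i + j : ℤ) : ℝ) * θ)
        + lamC (i - j) * cos (((i - j : ℤ) : ℝ) * θ)) =
      π / 4 * (lamC (i + j) * (1 + dC (i + j)) + lamC (i - j) * (1 + dC (i - j))
    + (lamC (i + j) + lamC (i - j)) * (dC i + dC j)) := by
  set a := lamC (i + j)
  set b := lamC (i - j)
  have e (θ : ℝ) : (cos (i * θ) * cos (j * θ)) * (a * cos (((i + j : ℤ) : ℝ) * θ)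
        + b * cos (((i - j : ℤ) : ℝ) * θ)) =
      (a + b) / 4 + (a / 4 * cos (2 * ((i + j : ℤ) : ℝ) * θ) +
        (b / 4 * cos (2 * ((i - j : ℤ) : ℝ) * θ) +
        ((a + b) / 4 * cos (2 * ((i : ℤ) : ℝ) * θ) +
        (a + b) / 4 * cos (2 * ((j : ℤ) : ℝ) * θ)))) := by
    rw [cos_prod]
    have h1 : 2 * ((i : ℤ) : ℝ) * θ = ((i + j : ℤ) : ℝ) * θ + ((i - j : ℤ) : ℝ) * θ := by
      push_cast; ring
    have h2 : 2 * ((j : ℤ) : ℝ) * θ = ((i + j : ℤ) : ℝ) * θ - ((i - j : ℤ) : ℝ) * θ := by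
      push_cast; ring
    rw [h1, h2, mul_assoc 2, mul_assoc 2, cos_two_mul, cos_two_mul, cos_add, cos_sub]
    ring
  simp_rw [e]
  have ii (f : ℝ → ℝ) (hf : Continuous f) : IntervalIntegrable f volume 0 π :=
    hf.intervalIntegrable _ _
  rw [intervalIntegral.integral_add (ii _ (by fun_prop)) (ii _ (by fun_prop)),
    intervalIntegral.integral_add (ii _ (by fun_prop)) (ii _ (by fun_prop)),
    intervalIntegral.integral_add (ii _ (by fun_prop)) (ii _ (by fun_prop)),
    intervalIntegral.integral_add (ii _ (by fun_prop)) (ii _ (by fun_prop))]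
  simp only [intervalIntegral.integral_const_mul, int_cos', intervalIntegral.integral_const,
    smul_eq_mul]
  ring

lemma double_sum (n : ℕ) :
    (∫ x in Set.Icc (-1 : ℝ) 1, ∫ y in Set.Icc (-1 : ℝ) 1,
        K n x y ^ 2 * Real.log (1 / |x - y|) * w0 x * w0 y) =
      ∑ i ∈ Finset.range (n + 1), ∑ j ∈ Finset.range (n + 1), GC i j := by
  have e1 (x : ℝ) : ∫ y in Set.Icc (-1 : ℝ) 1,
      K n x y ^ 2 * Real.log (1 / |x - y|) * w0 x * w0 y =
      ((1 / π) * ∫ φ in (0 : ℝ)..π, K n x (cos φ) ^ 2 * Real.log (1 / |x - cos φ|)) * w0 x := by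
    rw [w0_subst (fun y => K n x y ^ 2 * Real.log (1 / |x - y|) * w0 x),
      intervalIntegral.integral_mul_const]
    ring
  simp_rw [e1]
  rw [w0_subst (fun x => (1 / π) * ∫ φ in (0 : ℝ)..π,
    K n x (cos φ) ^ 2 * Real.log (1 / |x - cos φ|))]
  have e2 : ∀ θ ∈ Set.uIcc 0 π, (1 / π) * (∫ φ in (0 : ℝ)..π,
      K n (cos θ) (cos φ) ^ 2 * Real.log (1 / |cos θ - cos φ|)) =
      ∑ i ∈ Finset.range (n + 1), ∑ j ∈ Finset.range (n + 1), cC i * cC j / 2 *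
      ((cos (i * θ) * cos (j * θ)) * (lamC (i + j) * cos (((i + j : ℤ) : ℝ) * θ)
        + lamC (i - j) * cos (((i - j : ℤ) : ℝ) * θ))) := by
    intro θ hθ
    rw [Set.uIcc_of_le pi_pos.le] at hθ
    have e3 (φ : ℝ) : K n (cos θ) (cos φ) ^ 2 * Real.log (1 / |cos θ - cos φ|) =
        ∑ i ∈ Finset.range (n + 1), ∑ j ∈ Finset.range (n + 1),
          (cC i * cC j * (cos (i * θ) * cos (j * θ))) *
          ((cos (i * φ) * cos (j * φ)) * Real.log (1 / |cos θ - cos φ|)) := by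
      rw [K_cos, sq, Finset.sum_mul_sum, Finset.sum_mul]
      refine Finset.sum_congr rfl fun i _ => ?_
      rw [Finset.sum_mul]
      refine Finset.sum_congr rfl fun j _ => ?_
      ring
    have i3 (i j : ℕ) : IntervalIntegrable (fun φ => (cC i * cC j * (cos (i * θ) * cos (j * θ))) *
          ((cos (i * φ) * cos (j * φ)) * Real.log (1 / |cos θ - cos φ|))) volume 0 π :=
      (ii_log θ hθ _ (by fun_prop)).const_mul _
    simp_rw [e3]
    rw [intervalIntegral.integral_finsetSum
      (fun i _ => by
        have := IntervalIntegrable.sum (Finset.range (n + 1)) (fun j _ => i3 i j)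
        simpa only [Finset.sum_fn] using this), Finset.mul_sum]
    refine Finset.sum_congr rfl fun i _ => ?_
    rw [intervalIntegral.integral_finsetSum (fun j _ => i3 i j), Finset.mul_sum]
    refine Finset.sum_congr rfl fun j _ => ?_
    rw [intervalIntegral.integral_const_mul, inner_prod i j θ hθ]
    field_simp
  rw [intervalIntegral.integral_congr e2, intervalIntegral.integral_finsetSum
    (fun i _ => (by fun_prop : Continuous _).intervalIntegrable _ _), Finset.mul_sum]
  refine Finset.sum_congr rfl fun i _ => ?_
  rw [intervalIntegral.integral_finsetSum
    (fun i _ => (by fun_prop : Continuous _).intervalIntegrable _ _), Finset.mul_sum]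
  refine Finset.sum_congr rfl fun j _ => ?_
  rw [intervalIntegral.integral_const_mul, outer_prod, GC]
  field_simp
  ring

lemma lamC_neg (m : ℤ) : lamC (-m) = lamC m := by simp [lamC]
lemma dC_neg (m : ℤ) : dC (-m) = dC m := by simp [dC]

lemma GC_symm (i j : ℕ) : GC i j = GC j i := by
  unfold GC
  rw [← lamC_neg (i - j), ← dC_neg (i - j), neg_sub, add_comm (i : ℤ) j]
  ring

lemma GC_zero (m : ℕ) : GC 0 (m + 1) = 1 / (m + 1) := by
  have h1 : ((m : ℤ) + 1) ≠ 0 := by omega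
  have h2 : (-1 + -(m : ℤ)) ≠ 0 := by omega
  have h3 : |(m : ℝ) + 1| = m + 1 := abs_of_pos (by positivity)
  have h4 : |-1 + -(m : ℝ)| = m + 1 := by rw [← neg_add, abs_neg, add_comm, h3]
  simp [GC, cC, lamC, dC, h1, h2, h3, h4]
  ring

lemma GC_diag (m : ℕ) : GC (m + 1) (m + 1) = Real.log 2 + 1 / (4 * (m + 1)) := by
  have h1 : ((m : ℤ) + 1 + (m + 1)) ≠ 0 := by omega
  have h2 : ((m : ℤ) + 1) ≠ 0 := by omega
  have h3 : |(m : ℝ) + 1 + (m + 1)| = 2 * (m + 1) := by rw [abs_of_pos (by positivity)]; ring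
  simp [GC, cC, lamC, dC, h1, h2, h3]
  field_simp
  ring

lemma GC_off (i m : ℕ) (h : i < m) : GC (i + 1) (m + 1) =
    1 / 2 * (1 / ((i : ℝ) + 1 + (m + 1)) + 1 / ((m : ℝ) - i)) := by
  have h1 : ((i : ℤ) + 1 + (m + 1)) ≠ 0 := by omega
  have h2 : ((m : ℤ) + 1) ≠ 0 := by omega
  have h2' : ((i : ℤ) + 1) ≠ 0 := by omega
  have h3 : |(i : ℝ) + 1 + (m + 1)| = i + 1 + (m + 1) := abs_of_pos (by positivity)
  have h4 : (i : ℤ) - m ≠ 0 := by omega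
  have h' : (i : ℝ) < m := by exact_mod_cast h
  have h5 : |(i : ℝ) - m| = m - i := by rw [abs_of_neg (by linarith)]; ring
  simp [GC, cC, lamC, dC, h1, h2, h2', h3, h4, h5]
  norm_num

lemma H_succ (n : ℕ) : H (n + 1) = H n + 1 / ((n : ℝ) + 1) := by
  unfold H
  rw [Finset.sum_Icc_succ_top (by omega)]
  push_cast; rfl

lemma sum_A (m k : ℕ) : ∑ i ∈ Finset.range k, 1 / ((i : ℝ) + 1 + (m + 1)) =
    H (m + 1 + k) - H (m + 1) := by
  induction k with
  | zero => simp
  | succ k ih =>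
    rw [Finset.sum_range_succ, ih, show m + 1 + (k + 1) = m + 1 + k + 1 by ring, H_succ (m + 1 + k)]
    have : (k : ℝ) + 1 + (m + 1) = ((m + 1 + k : ℕ) : ℝ) + 1 := by push_cast; ring
    rw [this]; ring

lemma sum_B (m : ℕ) : ∑ i ∈ Finset.range m, 1 / ((m : ℝ) - i) = H m := by
  rw [← Finset.sum_range_reflect]
  have h (k : ℕ) : ∑ j ∈ Finset.range k, 1 / ((j : ℝ) + 1) = H k := by
    induction k with
    | zero => simp [H]
    | succ k ih => rw [Finset.sum_range_succ, ih, H_succ]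
  rw [← h]
  refine Finset.sum_congr rfl fun j hj => ?_
  have hj := Finset.mem_range.1 hj
  have : ((m - 1 - j : ℕ) : ℝ) = m - 1 - j := by
    rw [Nat.cast_sub (by omega), Nat.cast_sub (by omega)]; simp
  rw [this]; congr 1; ring

lemma sum_step (n : ℕ) :
    ∑ i ∈ Finset.range (n + 2), ∑ j ∈ Finset.range (n + 2), GC i j =
    (∑ i ∈ Finset.range (n + 1), ∑ j ∈ Finset.range (n + 1), GC i j) +
      (2 / ((n : ℝ) + 1) + (H (2 * n + 1) - H (n + 1)) + H n
        + (Real.log 2 + 1 / (4 * (n + 1)))) := by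
  rw [Finset.sum_range_succ _ (n + 1), Finset.sum_range_succ (fun j => GC (n + 1) j) (n + 1)]
  simp_rw [Finset.sum_range_succ (fun j => GC _ j) (n + 1)]
  rw [Finset.sum_add_distrib]
  have e : ∑ j ∈ Finset.range (n + 1), GC (n + 1) j = ∑ j ∈ Finset.range (n + 1), GC j (n + 1) :=
    Finset.sum_congr rfl fun j _ => GC_symm _ _
  have e2 : ∑ j ∈ Finset.range (n + 1), GC j (n + 1) =
      1 / 2 * ((H (2 * n + 1) - H (n + 1)) + H n) + 1 / ((n : ℝ) + 1) := by
    rw [Finset.sum_range_succ', GC_zero, Finset.sum_congr rfl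
      (fun i hi => GC_off i n (Finset.mem_range.1 hi)), ← Finset.mul_sum, Finset.sum_add_distrib,
      sum_A, sum_B, show n + 1 + n = 2 * n + 1 by ring]
  rw [e, e2, GC_diag]
  ring

lemma GC_00 : GC 0 0 = Real.log 2 := by
  simp [GC, cC, lamC, dC]; ring

lemma closed_form (n : ℕ) :
    ∑ i ∈ Finset.range (n + 2), ∑ j ∈ Finset.range (n + 2), GC i j =
      ((n : ℝ) + 2) * Real.log 2 + H (n + 1) + ((n : ℝ) + 1) * H (2 * n + 1)
        + H (2 * n + 2) / 2 - ((n : ℝ) + 1) + 1 / 2 := by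
  induction n with
  | zero =>
    rw [sum_step 0]
    simp [GC_00, H_succ]
    simp [H]
    ring
  | succ n ih =>
    rw [sum_step (n + 1), ih, show 2 * (n + 1) + 2 = 2 * n + 1 + 1 + 1 + 1 by ring,
      show 2 * (n + 1) + 1 = 2 * n + 1 + 1 + 1 by ring,
      show 2 * n + 2 = 2 * n + 1 + 1 by ring]
    simp only [H_succ]
    push_cast
    field_simp
    ring

end helpers

theorem chebyshev_L2 (n : ℕ) (hn : 1 ≤ n) :
    (∫ x in Set.Icc (-1 : ℝ) 1, ∫ y in Set.Icc (-1 : ℝ) 1,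
        K n x y ^ 2 * Real.log (1 / |x - y|) * w0 x * w0 y) =
      ((n : ℝ) + 1) * Real.log 2 + H n + (n : ℝ) * H (2 * n - 1)
        + H (2 * n) / 2 - (n : ℝ) + 1 / 2 := by
  rw [double_sum]
  obtain ⟨m, rfl⟩ : ∃ m, n = m + 1 := ⟨n - 1, by omega⟩
  rw [closed_form, show 2 * (m + 1) - 1 = 2 * m + 1 by omega,
    show 2 * (m + 1) = 2 * m + 2 by ring]
  push_cast
  ring
end

section
/- Fix λ ∈ (-1/2, ∞), λ ≠ 0, and for n ≥ 2 let L1(λ,n) = ∬_{[-1,1]²} K_n^λ(x,x) K_n^λ(y,y) log(1/|x-y|) w^λ(x) w^λ(y) dx dy. Then (n+1)²·log 2 ≤ L1(λ,n) for all n ≥ 2, and ( L1(λ,n) - (n+1)²·log 2 ) / n → 0 as n → ∞. -/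
open Real MeasureTheory Finset

/-- Gegenbauer polynomials `C_n^λ`, defined by `C_0^λ(x) = 1`, `C_1^λ(x) = 2λx` and the
recurrence `n·C_n^λ(x) = 2(n+λ-1)·x·C_{n-1}^λ(x) - (n+2λ-2)·C_{n-2}^λ(x)`. -/
noncomputable def Geg (lam : ℝ) : ℕ → ℝ → ℝ
  | 0, _ => 1
  | 1, x => 2 * lam * x
  | (n + 2), x =>
      (2 * ((n : ℝ) + 1 + lam) * x * Geg lam (n + 1) x
        - ((n : ℝ) + 2 * lam) * Geg lam n x) / ((n : ℝ) + 2)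

/-- The Gegenbauer weight `w^λ(x) = Γ(λ+1)/(√π·Γ(λ+1/2))·(1-x²)^{λ-1/2}`. -/
noncomputable def wG (lam : ℝ) (x : ℝ) : ℝ :=
  Real.Gamma (lam + 1) / (Real.sqrt Real.pi * Real.Gamma (lam + 1 / 2)) *
    (1 - x ^ 2) ^ (lam - 1 / 2)

/-- Normalization constant `γ_n^λ = √(n!·(n+λ)/(λ·(2λ)_n))`. -/
noncomputable def gamG (lam : ℝ) (n : ℕ) : ℝ :=
  Real.sqrt ((n.factorial : ℝ) * ((n : ℝ) + lam) /
    (lam * (ascPochhammer ℝ n).eval (2 * lam)))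

/-- Normalized Gegenbauer polynomials `Ĉ_n^λ = γ_n^λ·C_n^λ`. -/
noncomputable def GegHat (lam : ℝ) (n : ℕ) (x : ℝ) : ℝ := gamG lam n * Geg lam n x

/-- The Gegenbauer projection kernel `K_n^λ(x,y) = ∑_{j=0}^n Ĉ_j^λ(x)Ĉ_j^λ(y)`. -/
noncomputable def KG (lam : ℝ) (n : ℕ) (x y : ℝ) : ℝ :=
  ∑ j ∈ Finset.range (n + 1), GegHat lam j x * GegHat lam j y

noncomputable def L1 (lam : ℝ) (n : ℕ) : ℝ :=
  ∫ x in Set.Icc (-1 : ℝ) 1, ∫ y in Set.Icc (-1 : ℝ) 1,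
    KG lam n x x * KG lam n y y * Real.log (1 / |x - y|) * wG lam x * wG lam y

noncomputable def L2 (lam : ℝ) (n : ℕ) : ℝ :=
  ∫ x in Set.Icc (-1 : ℝ) 1, ∫ y in Set.Icc (-1 : ℝ) 1,
    KG lam n x y ^ 2 * Real.log (1 / |x - y|) * wG lam x * wG lam y

theorem Geg_zero (lam : ℝ) : Geg lam 0 = fun _ => 1 := by
  funext x; simp [Geg]

theorem Geg_one (lam : ℝ) : Geg lam 1 = fun x => 2 * lam * x := by
  funext x; simp [Geg]

theorem Geg_succ (lam : ℝ) (n : ℕ) : Geg lam (n + 2) = fun x =>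
      (2 * ((n : ℝ) + 1 + lam) * x * Geg lam (n + 1) x
        - ((n : ℝ) + 2 * lam) * Geg lam n x) / ((n : ℝ) + 2) := by
  funext x; simp [Geg]

theorem Geg_rec (lam : ℝ) (n : ℕ) (x : ℝ) :
    ((n : ℝ) + 2) * Geg lam (n + 2) x = 2 * ((n : ℝ) + 1 + lam) * x * Geg lam (n + 1) x
        - ((n : ℝ) + 2 * lam) * Geg lam n x := by
  have : (n : ℝ) + 2 ≠ 0 := by positivity
  rw [Geg_succ]; field_simp

theorem Geg_contDiff (lam : ℝ) : ∀ n, ContDiff ℝ 2 (Geg lam n)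
  | 0 => by rw [Geg_zero]; fun_prop
  | 1 => by rw [Geg_one]; fun_prop
  | (n + 2) => by
      have h1 := Geg_contDiff lam (n + 1)
      have h2 := Geg_contDiff lam n
      rw [Geg_succ]; fun_prop

/-- first and second derivative -/
noncomputable def GegD (lam : ℝ) (n : ℕ) (x : ℝ) : ℝ := deriv (Geg lam n) x
noncomputable def GegDD (lam : ℝ) (n : ℕ) (x : ℝ) : ℝ := deriv (GegD lam n) x

theorem Geg_hasDeriv (lam : ℝ) (n : ℕ) (x : ℝ) : HasDerivAt (Geg lam n) (GegD lam n x) x :=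
  ((Geg_contDiff lam n).differentiable (by norm_num) x).hasDerivAt

theorem GegD_contDiff (lam : ℝ) (n : ℕ) : ContDiff ℝ 1 (GegD lam n) := by
  have := Geg_contDiff lam n
  have h : (2 : WithTop ℕ∞) = 1 + 1 := by norm_num
  rw [h, contDiff_succ_iff_deriv] at this
  exact this.2.2

theorem GegD_hasDeriv (lam : ℝ) (n : ℕ) (x : ℝ) : HasDerivAt (GegD lam n) (GegDD lam n x) x :=
  ((GegD_contDiff lam n).differentiable (by norm_num) x).hasDerivAt

theorem Geg_cont (lam : ℝ) (n : ℕ) : Continuous (Geg lam n) := (Geg_contDiff lam n).continuous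
theorem GegD_cont (lam : ℝ) (n : ℕ) : Continuous (GegD lam n) := (GegD_contDiff lam n).continuous

theorem GegD_rec (lam : ℝ) (n : ℕ) (x : ℝ) :
    ((n : ℝ) + 2) * GegD lam (n + 2) x = 2 * ((n : ℝ) + 1 + lam) *
      (Geg lam (n + 1) x + x * GegD lam (n + 1) x) - ((n : ℝ) + 2 * lam) * GegD lam n x := by
  have h1 := (Geg_hasDeriv lam (n + 2) x).const_mul ((n : ℝ) + 2)
  have h2 := ((((hasDerivAt_id x).const_mul (2 * ((n : ℝ) + 1 + lam))).mul
    (Geg_hasDeriv lam (n + 1) x)).sub ((Geg_hasDeriv lam n x).const_mul ((n : ℝ) + 2 * lam)))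
  have h3 : (fun y => ((n : ℝ) + 2) * Geg lam (n + 2) y) = _ := funext (Geg_rec lam n)
  rw [h3] at h1
  have := h1.unique h2
  simp only [id] at this
  rw [this]; ring

theorem Geg_R2 (lam : ℝ) (x : ℝ) : ∀ n : ℕ, (1 - x ^ 2) * GegD lam n x =
    ((n : ℝ) + 2 * lam) * x * Geg lam n x - ((n : ℝ) + 1) * Geg lam (n + 1) x
  | 0 => by
      have : GegD lam 0 x = 0 := by simp [GegD, Geg_zero]
      rw [this, Geg_zero, Geg_one]; push_cast; ring
  | 1 => by
      have : GegD lam 1 x = 2 * lam := by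
        have h : HasDerivAt (Geg lam 1) (2 * lam * 1) x := by
          rw [Geg_one]; exact (hasDerivAt_id x).const_mul (2 * lam)
        rw [(Geg_hasDeriv lam 1 x).unique h]; ring
      have h2 := Geg_rec lam 0 x
      rw [this, Geg_one]
      rw [Geg_one, Geg_zero] at h2
      push_cast at *
      linear_combination h2
  | (n + 2) => by
      have h1 := Geg_R2 lam x n
      have h2 := Geg_R2 lam x (n + 1)
      have h3 := Geg_rec lam n x
      have h4 := Geg_rec lam (n + 1) x
      have h5 := GegD_rec lam n x
      have hn : (n : ℝ) + 2 ≠ 0 := by positivity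
      apply mul_left_cancel₀ hn
      push_cast at *
      rw [show n + 1 + 1 = n + 2 from rfl] at *
      rw [show n + 1 + 2 = n + 2 + 1 from rfl] at *
      linear_combination (1 - x ^ 2) * h5 + 2 * ((n : ℝ) + 1 + lam) * x * h2 - (n + 2 * lam) * h1 + ((n : ℝ) + 2) * h4 - ((n : ℝ) + 2 * lam) * x * h3

theorem Geg_R1 (lam : ℝ) (x : ℝ) (n : ℕ) : (1 - x ^ 2) * GegD lam (n + 1) x =
    -((n : ℝ) + 1) * x * Geg lam (n + 1) x + ((n : ℝ) + 2 * lam) * Geg lam n x := by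
  have h2 := Geg_R2 lam x (n + 1)
  have h3 := Geg_rec lam n x
  push_cast at *
  rw [show n + 1 + 1 = n + 2 from rfl] at *
  linear_combination h2 - h3

theorem Geg_ode (lam : ℝ) (n : ℕ) (x : ℝ) (hx : 1 - x ^ 2 ≠ 0) :
    (1 - x ^ 2) * GegDD lam n x - (2 * lam + 1) * x * GegD lam n x
      + (n : ℝ) * (n + 2 * lam) * Geg lam n x = 0 := by
  have h1 : HasDerivAt (fun y => (1 - y ^ 2) * GegD lam n y)
      ((-(2 * x)) * GegD lam n x + (1 - x ^ 2) * GegDD lam n x) x := by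
    have := (((hasDerivAt_id x).pow 2).const_sub 1).mul (GegD_hasDeriv lam n x)
    exact this.congr_deriv (by simp)
  have h2 : HasDerivAt (fun y => ((n : ℝ) + 2 * lam) * y * Geg lam n y
      - ((n : ℝ) + 1) * Geg lam (n + 1) y)
      (((n : ℝ) + 2 * lam) * Geg lam n x + ((n : ℝ) + 2 * lam) * x * GegD lam n x
        - ((n : ℝ) + 1) * GegD lam (n + 1) x) x := by
    have := (((hasDerivAt_id x).const_mul ((n : ℝ) + 2 * lam)).mul (Geg_hasDeriv lam n x)).sub
      ((Geg_hasDeriv lam (n + 1) x).const_mul ((n : ℝ) + 1))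
    exact this.congr_deriv (by simp)
  have h3 : (fun y => (1 - y ^ 2) * GegD lam n y) = _ := funext fun y => Geg_R2 lam y n
  rw [h3] at h1
  have h4 := h1.unique h2
  have h5 := Geg_R1 lam x n
  have h6 := Geg_R2 lam x n
  apply mul_left_cancel₀ hx
  linear_combination (1 - x ^ 2) * h4 - ((n : ℝ) + 1) * h5 + ((n : ℝ) + 1) * x * h6

theorem Geg_neg (lam : ℝ) (x : ℝ) : ∀ n : ℕ, Geg lam n (-x) = (-1) ^ n * Geg lam n x
  | 0 => by simp [Geg_zero]
  | 1 => by simp [Geg_one]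
  | (n + 2) => by
      have h1 := Geg_neg lam x n
      have h2 := Geg_neg lam x (n + 1)
      rw [Geg_succ]
      simp only [h1, h2]
      field_simp; ring

theorem Geg_odd_zero (lam : ℝ) (n : ℕ) (hn : Odd n) : Geg lam n 0 = 0 := by
  have := Geg_neg lam 0 n
  rw [hn.neg_one_pow] at this
  simp at this; linarith

theorem GegD_even_zero (lam : ℝ) (n : ℕ) (hn : Even n) : GegD lam n 0 = 0 := by
  have h := Geg_R2 lam 0 n
  rw [Geg_odd_zero lam (n + 1) hn.add_one] at h
  simpa using h

theorem sin_pos_Ioo {θ : ℝ} (h : θ ∈ Set.Ioo 0 π) : 0 < sin θ := sin_pos_of_pos_of_lt_pi h.1 h.2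

theorem sin_rpow_integrable (a : ℝ) (ha : -1 < a) :
    IntegrableOn (fun θ => sin θ ^ a) (Set.Ioo 0 π) := by
  have hmeas : AEStronglyMeasurable (fun θ => sin θ ^ a) (volume.restrict (Set.Ioo 0 π)) :=
    (measurable_sin.pow_const a).aestronglyMeasurable
  rcases le_or_gt 0 a with h0 | h0
  · refine Integrable.mono' (g := fun _ => (1 : ℝ)) (by simp) hmeas ?_
    filter_upwards [ae_restrict_mem measurableSet_Ioo] with θ hθ
    have hs := sin_pos_Ioo hθ
    rw [norm_of_nonneg (rpow_nonneg hs.le _)]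
    exact rpow_le_one hs.le (sin_le_one θ) h0
  · have i1 : IntegrableOn (fun θ : ℝ => θ ^ a) (Set.Ioo 0 π) := by
      have := intervalIntegral.intervalIntegrable_rpow' (a := 0) (b := π) ha
      rw [intervalIntegrable_iff_integrableOn_Ioo_of_le pi_pos.le] at this
      exact this
    have i2 : IntegrableOn (fun θ : ℝ => (π - θ) ^ a) (Set.Ioo 0 π) := by
      have := (intervalIntegral.intervalIntegrable_rpow' (a := 0) (b := π) ha).comp_sub_left π
      simp only [sub_zero, sub_self] at this
      have := this.symm
      rw [intervalIntegrable_iff_integrableOn_Ioo_of_le pi_pos.le] at this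
      exact this
    refine Integrable.mono' ((i1.add i2).const_mul ((2 / π) ^ a)) hmeas ?_
    filter_upwards [ae_restrict_mem measurableSet_Ioo] with θ hθ
    have hs := sin_pos_Ioo hθ
    rw [norm_of_nonneg (rpow_nonneg hs.le _)]
    have hp : 0 < 2 / π := by positivity
    have hθ1 := hθ.1
    have hθ2 : 0 < π - θ := by linarith [hθ.2]
    simp only [Pi.add_apply]
    rw [mul_add]
    rcases le_total θ (π / 2) with h | h
    · have h1 : 2 / π * θ ≤ sin θ := mul_le_sin hθ1.le h
      have h2 : sin θ ^ a ≤ (2 / π * θ) ^ a :=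
        rpow_le_rpow_of_nonpos (by positivity) h1 h0.le
      rw [mul_rpow hp.le hθ1.le] at h2
      have : 0 ≤ (2 / π) ^ a * (π - θ) ^ a := by positivity
      linarith
    · have h1 : 2 / π * (π - θ) ≤ sin (π - θ) := mul_le_sin hθ2.le (by linarith)
      rw [sin_pi_sub] at h1
      have h2 : sin θ ^ a ≤ (2 / π * (π - θ)) ^ a :=
        rpow_le_rpow_of_nonpos (by positivity) h1 h0.le
      rw [mul_rpow hp.le hθ2.le] at h2
      have : 0 ≤ (2 / π) ^ a * θ ^ a := by positivity
      linarith

theorem integral_cos_subst (f : ℝ → ℝ) :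
    ∫ x in Set.Icc (-1 : ℝ) 1, f x = ∫ θ in Set.Ioo 0 π, sin θ * f (cos θ) := by
  have him : cos '' (Set.Icc 0 π) = Set.Icc (-1) 1 := bijOn_cos.image_eq
  rw [← him, integral_image_eq_integral_abs_deriv_smul measurableSet_Icc
    (fun x _ => (hasDerivAt_cos x).hasDerivWithinAt) injOn_cos, integral_Icc_eq_integral_Ioo]
  apply setIntegral_congr_fun measurableSet_Ioo
  intro θ hθ
  have hs := sin_pos_Ioo hθ
  simp [abs_of_pos hs]

theorem one_sub_cos_sq (θ : ℝ) : 1 - cos θ ^ 2 = sin θ ^ 2 := by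
  rw [sin_sq]

theorem sin_weight {θ : ℝ} (h : 0 < sin θ) (lam : ℝ) :
    sin θ * (1 - cos θ ^ 2) ^ (lam - 1 / 2) = sin θ ^ (2 * lam) := by
  rw [one_sub_cos_sq, ← rpow_natCast (sin θ) 2, ← rpow_mul h.le]
  nth_rewrite 1 [← rpow_one (sin θ)]
  rw [← rpow_add h]; congr 1; push_cast; ring

theorem int_h0 (lam : ℝ) (hlam : -(1 / 2) < lam) :
    ∫ θ in Set.Ioo 0 π, sin θ ^ (2 * lam) =
      Real.sqrt π * Gamma (lam + 1 / 2) / Gamma (lam + 1) := by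
  have e1 : ∫ θ in Set.Ioo 0 π, sin θ ^ (2 * lam)
      = ∫ x in Set.Icc (-1 : ℝ) 1, (1 - x ^ 2) ^ (lam - 1 / 2) := by
    rw [integral_cos_subst]
    apply setIntegral_congr_fun measurableSet_Ioo
    intro θ hθ
    exact (sin_weight (sin_pos_Ioo hθ) lam).symm
  have hp : 0 < lam + 1 / 2 := by linarith
  have hb := ProbabilityTheory.beta_eq_betaIntegralReal (lam + 1 / 2) (lam + 1 / 2) hp hp
  have hb2 : (Complex.betaIntegral ((lam + 1 / 2 : ℝ) : ℂ) ((lam + 1 / 2 : ℝ) : ℂ)).re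
      = ∫ t in (0 : ℝ)..1, t ^ (lam - 1 / 2) * (1 - t) ^ (lam - 1 / 2) := by
    rw [Complex.betaIntegral]
    have : ∀ t ∈ Set.uIcc (0 : ℝ) 1, (t : ℂ) ^ (((lam + 1 / 2 : ℝ) : ℂ) - 1)
        * (1 - (t : ℂ)) ^ (((lam + 1 / 2 : ℝ) : ℂ) - 1)
        = ((t ^ (lam - 1 / 2) * (1 - t) ^ (lam - 1 / 2) : ℝ) : ℂ) := by
      intro t ht
      rw [Set.uIcc_of_le zero_le_one] at ht
      rw [Complex.ofReal_mul, Complex.ofReal_cpow ht.1, Complex.ofReal_cpow (by linarith [ht.2])]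
      push_cast
      have : (lam : ℂ) + 1 / 2 - 1 = lam - 1 / 2 := by ring
      rw [this]
    rw [intervalIntegral.integral_congr this, intervalIntegral.integral_ofReal, Complex.ofReal_re]
  have e2 : ∫ x in Set.Icc (-1 : ℝ) 1, (1 - x ^ 2) ^ (lam - 1 / 2)
      = 2 * (4 : ℝ) ^ (lam - 1 / 2) *
        ∫ t in (0 : ℝ)..1, t ^ (lam - 1 / 2) * (1 - t) ^ (lam - 1 / 2) := by
    rw [integral_Icc_eq_integral_Ioc, ← intervalIntegral.integral_of_le (by norm_num)]
    have h := intervalIntegral.mul_integral_comp_mul_add (a := 0) (b := 1)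
      (f := fun x : ℝ => (1 - x ^ 2) ^ (lam - 1 / 2)) (2 : ℝ) (-1 : ℝ)
    norm_num at h
    norm_num
    rw [← h, mul_assoc]
    congr 1
    rw [← intervalIntegral.integral_const_mul]
    apply intervalIntegral.integral_congr
    intro t ht
    rw [Set.uIcc_of_le zero_le_one] at ht
    simp only
    rw [← mul_rpow ht.1 (by linarith [ht.2]), ← mul_rpow (by norm_num)
      (mul_nonneg ht.1 (by linarith [ht.2]))]
    congr 1; ring
  rw [e1, e2, ← hb2, ← hb, ProbabilityTheory.beta]
  have hd := Gamma_mul_Gamma_add_half (lam + 1 / 2)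
  have g1 : Gamma (lam + 1 / 2) ≠ 0 := (Gamma_pos_of_pos hp).ne'
  have g2 : Gamma (lam + 1) ≠ 0 := (Gamma_pos_of_pos (by linarith)).ne'
  have g3 : Gamma (lam + 1 / 2 + (lam + 1 / 2)) ≠ 0 := (Gamma_pos_of_pos (by linarith)).ne'
  rw [show lam + 1 / 2 + 1 / 2 = lam + 1 by ring,
    show 2 * (lam + 1 / 2) = lam + 1 / 2 + (lam + 1 / 2) by ring] at hd
  have h4 : (2 : ℝ) * 4 ^ (lam - 1 / 2) = 2 ^ (2 * lam) := by
    rw [show (4 : ℝ) = 2 ^ (2 : ℝ) by norm_num, ← rpow_mul (by norm_num)]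
    nth_rewrite 1 [← rpow_one (2 : ℝ)]
    rw [← rpow_add (by norm_num)]; congr 1; ring
  have h5 : (2 : ℝ) ^ (2 * lam) * 2 ^ (1 - (lam + 1 / 2 + (lam + 1 / 2))) = 1 := by
    rw [← rpow_add (by norm_num)]
    rw [show 2 * lam + (1 - (lam + 1 / 2 + (lam + 1 / 2))) = 0 by ring, rpow_zero]
  rw [h4]
  generalize Gamma (lam + 1 / 2 + (lam + 1 / 2)) = G3 at *
  generalize Gamma (lam + 1 / 2) = G1 at *
  generalize Gamma (lam + 1) = G2 at *
  generalize (2 : ℝ) ^ (1 - (lam + 1 / 2 + (lam + 1 / 2))) = p1 at *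
  rw [mul_div_assoc', div_eq_div_iff g3 g2]
  linear_combination (2 : ℝ) ^ (2 * lam) * G1 * hd + (G1 * G3 * √π) * h5

theorem cont_mul_sin_int {f : ℝ → ℝ} (hf : Continuous f) (a : ℝ) (ha : -1 < a) :
    IntegrableOn (fun θ => f θ * sin θ ^ a) (Set.Ioo 0 π) := by
  obtain ⟨B, hB⟩ := isCompact_Icc.exists_bound_of_continuousOn (s := Set.Icc 0 π) hf.continuousOn
  refine Integrable.mono' ((sin_rpow_integrable a ha).const_mul B)
    (hf.measurable.mul (measurable_sin.pow_const a)).aestronglyMeasurable ?_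
  filter_upwards [ae_restrict_mem measurableSet_Ioo] with θ hθ
  rw [norm_mul, norm_of_nonneg (rpow_nonneg (sin_pos_Ioo hθ).le _)]
  exact mul_le_mul_of_nonneg_right (hB θ ⟨hθ.1.le, hθ.2.le⟩) (rpow_nonneg (sin_pos_Ioo hθ).le _)

/-- Gegenbauer inner products in the angular variable. -/
noncomputable def gI (lam : ℝ) (n m : ℕ) : ℝ :=
  ∫ θ in Set.Ioo 0 π, Geg lam n (cos θ) * Geg lam m (cos θ) * sin θ ^ (2 * lam)

theorem gegc_cont (lam : ℝ) (n : ℕ) : Continuous fun θ => Geg lam n (cos θ) :=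
  (Geg_cont lam n).comp continuous_cos

theorem gegDc_cont (lam : ℝ) (n : ℕ) : Continuous fun θ => GegD lam n (cos θ) :=
  (GegD_cont lam n).comp continuous_cos

theorem gegc_hasDeriv (lam : ℝ) (n : ℕ) (θ : ℝ) :
    HasDerivAt (fun θ => Geg lam n (cos θ)) (GegD lam n (cos θ) * -sin θ) θ :=
  (Geg_hasDeriv lam n (cos θ)).comp θ (hasDerivAt_cos θ)

theorem gegDc_hasDeriv (lam : ℝ) (n : ℕ) (θ : ℝ) :
    HasDerivAt (fun θ => GegD lam n (cos θ)) (GegDD lam n (cos θ) * -sin θ) θ :=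
  (GegD_hasDeriv lam n (cos θ)).comp θ (hasDerivAt_cos θ)

theorem sinpow_hasDeriv {θ : ℝ} (h : 0 < sin θ) (a : ℝ) :
    HasDerivAt (fun θ => sin θ ^ a) (cos θ * a * sin θ ^ (a - 1)) θ :=
  (hasDerivAt_sin θ).rpow_const (Or.inl h.ne')

theorem gI_orth (lam : ℝ) (hlam : -(1 / 2) < lam) (n m : ℕ) (hnm : n < m) : gI lam n m = 0 := by
  have hne : (n : ℝ) * (n + 2 * lam) - m * (m + 2 * lam) ≠ 0 := by
    have h1 : (n : ℝ) + 1 ≤ m := by exact_mod_cast hnm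
    have h0 : (0 : ℝ) ≤ n := n.cast_nonneg
    have : (n : ℝ) * (n + 2 * lam) - m * (m + 2 * lam) = (n - m) * (n + m + 2 * lam) := by ring
    rw [this]
    exact mul_ne_zero (by linarith) (by linarith)
  set W : ℝ → ℝ := fun θ => sin θ ^ (2 * lam + 1) * (GegD lam n (cos θ) * Geg lam m (cos θ)
    - Geg lam n (cos θ) * GegD lam m (cos θ)) with hW
  have hWc : ContinuousOn W (Set.Icc 0 π) := by
    apply Continuous.continuousOn
    refine (continuous_sin.rpow_const fun x => Or.inr (by linarith)).mul ?_
    exact ((gegDc_cont lam n).mul (gegc_cont lam m)).sub ((gegc_cont lam n).mul (gegDc_cont lam m))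
  have hWd : ∀ θ ∈ Set.Ioo 0 π, HasDerivAt W (((n : ℝ) * (n + 2 * lam) - m * (m + 2 * lam)) *
      (Geg lam n (cos θ) * Geg lam m (cos θ) * sin θ ^ (2 * lam))) θ := by
    intro θ hθ
    have hs := sin_pos_Ioo hθ
    have hd := (sinpow_hasDeriv hs (2 * lam + 1)).mul
      (((gegDc_hasDeriv lam n θ).mul (gegc_hasDeriv lam m θ)).sub
        ((gegc_hasDeriv lam n θ).mul (gegDc_hasDeriv lam m θ)))
    refine hd.congr_deriv ?_
    have hx : 1 - cos θ ^ 2 ≠ 0 := by rw [one_sub_cos_sq]; positivity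
    have o1 := Geg_ode lam n (cos θ) hx
    have o2 := Geg_ode lam m (cos θ) hx
    rw [one_sub_cos_sq] at o1 o2
    have e1 : sin θ ^ (2 * lam + 1) = sin θ * sin θ ^ (2 * lam) := by
      rw [rpow_add hs, rpow_one]; ring
    have e2 : sin θ ^ (2 * lam + 1 - 1) = sin θ ^ (2 * lam) := by congr 1; ring
    simp only [Pi.mul_apply, Pi.sub_apply]
    rw [e1, e2]
    linear_combination (-sin θ ^ (2 * lam) * Geg lam m (cos θ)) * o1 +
      (sin θ ^ (2 * lam) * Geg lam n (cos θ)) * o2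
  have hIntg : IntegrableOn (fun θ => ((n : ℝ) * (n + 2 * lam) - m * (m + 2 * lam)) *
      (Geg lam n (cos θ) * Geg lam m (cos θ) * sin θ ^ (2 * lam))) (Set.Ioo 0 π) :=
    (cont_mul_sin_int ((gegc_cont lam n).mul (gegc_cont lam m)) _ (by linarith)).const_mul _
  have := intervalIntegral.integral_eq_sub_of_hasDerivAt_of_le pi_pos.le hWc hWd
    ((intervalIntegrable_iff_integrableOn_Ioo_of_le pi_pos.le).2 hIntg)
  rw [intervalIntegral.integral_of_le pi_pos.le, integral_Ioc_eq_integral_Ioo,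
    integral_const_mul] at this
  have hz : W π - W 0 = 0 := by
    simp [hW, zero_rpow (show 2 * lam + 1 ≠ 0 by linarith)]
  rw [hz] at this
  exact (mul_eq_zero.1 this).resolve_left hne

theorem gI_comm (lam : ℝ) (n m : ℕ) : gI lam n m = gI lam m n := by
  unfold gI; congr 1; funext θ; ring

noncomputable def gX (lam : ℝ) (n m : ℕ) : ℝ :=
  ∫ θ in Set.Ioo 0 π, cos θ * Geg lam n (cos θ) * Geg lam m (cos θ) * sin θ ^ (2 * lam)

theorem gI_rec (lam : ℝ) (hlam : -(1 / 2) < lam) (n m : ℕ) :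
    ((n : ℝ) + 2) * gI lam (n + 2) m =
      2 * ((n : ℝ) + 1 + lam) * gX lam (n + 1) m - ((n : ℝ) + 2 * lam) * gI lam n m := by
  unfold gI gX
  rw [← integral_const_mul, ← integral_const_mul, ← integral_const_mul, ← integral_sub]
  · congr 1; funext θ
    linear_combination (Geg lam m (cos θ) * sin θ ^ (2 * lam)) * Geg_rec lam n (cos θ)
  · exact (cont_mul_sin_int ((continuous_cos.mul (gegc_cont lam _)).mul (gegc_cont lam m)) _
      (by linarith)).const_mul _
  · exact (cont_mul_sin_int ((gegc_cont lam _).mul (gegc_cont lam m)) _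
      (by linarith)).const_mul _

theorem gX_comm (lam : ℝ) (n m : ℕ) : gX lam n m = gX lam m n := by
  unfold gX; congr 1; funext θ; ring

theorem gI_step (lam : ℝ) (hlam : -(1 / 2) < lam) (n : ℕ) :
    gI lam (n + 1) (n + 1) * (((n : ℝ) + 1) * (n + 1 + lam)) =
      (n + lam) * (n + 2 * lam) * gI lam n n := by
  have hn : (0 : ℝ) ≤ n := n.cast_nonneg
  have h1 := gI_rec lam hlam n n
  rw [gI_comm, gI_orth lam hlam n (n + 2) (by omega)] at h1
  have h2 : ((n : ℝ) + 1) * gI lam (n + 1) (n + 1) = 2 * (n + lam) * gX lam n (n + 1) := by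
    cases n with
    | zero =>
      unfold gI gX
      rw [← integral_const_mul, ← integral_const_mul]
      congr 1; funext θ
      simp only [Geg_zero, zero_add, Geg_one]; push_cast; ring
    | succ k =>
      have h3 := gI_rec lam hlam k (k + 2)
      rw [gI_orth lam hlam k (k + 2) (by omega)] at h3
      push_cast
      rw [show k + 1 + 1 = k + 2 from rfl]
      linear_combination h3
  rw [gX_comm] at h2
  linear_combination ((n : ℝ) + 1 + lam) * h2 - (n + lam) * h1

theorem gI_val (lam : ℝ) (hlam : -(1 / 2) < lam) (n : ℕ) :
    gI lam n n * (n.factorial * (n + lam)) =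
      lam * (ascPochhammer ℝ n).eval (2 * lam) * gI lam 0 0 := by
  induction n with
  | zero => simp; ring
  | succ k ih =>
    have h := gI_step lam hlam k
    rw [ascPochhammer_succ_eval, Nat.factorial_succ]
    push_cast
    linear_combination (k.factorial : ℝ) * h + (k + 2 * lam) * ih

noncomputable def kap (lam : ℝ) : ℝ := Gamma (lam + 1) / (√π * Gamma (lam + 1 / 2))

theorem kap_pos (lam : ℝ) (hlam : -(1 / 2) < lam) : 0 < kap lam := by
  have g1 := (Gamma_pos_of_pos (show 0 < lam + 1 / 2 by linarith))
  have g2 := (Gamma_pos_of_pos (show 0 < lam + 1 by linarith))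
  unfold kap; positivity

theorem gI_zero (lam : ℝ) (hlam : -(1 / 2) < lam) : kap lam * gI lam 0 0 = 1 := by
  have : gI lam 0 0 = ∫ θ in Set.Ioo 0 π, sin θ ^ (2 * lam) := by
    simp [gI, Geg_zero]
  rw [this, int_h0 lam hlam, kap]
  have g1 := (Gamma_pos_of_pos (show 0 < lam + 1 / 2 by linarith)).ne'
  have g2 := (Gamma_pos_of_pos (show 0 < lam + 1 by linarith)).ne'
  have g3 : √π ≠ 0 := by positivity
  generalize Gamma (lam + 1 / 2) = G1 at *
  generalize Gamma (lam + 1) = G2 at *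
  field_simp

theorem poch_pos (lam : ℝ) (hlam : -(1 / 2) < lam) (h0 : lam ≠ 0) (n : ℕ) :
    0 < lam * (ascPochhammer ℝ (n + 1)).eval (2 * lam) := by
  induction n with
  | zero => simp; nlinarith [sq_pos_of_ne_zero h0]
  | succ k ih =>
    rw [ascPochhammer_succ_eval, ← mul_assoc]
    apply mul_pos ih
    have : (0 : ℝ) ≤ k := k.cast_nonneg
    push_cast; linarith

theorem gamG_sq (lam : ℝ) (hlam : -(1 / 2) < lam) (h0 : lam ≠ 0) (n : ℕ) :
    kap lam * gamG lam n ^ 2 * gI lam n n = 1 := by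
  have h := gI_val lam hlam n
  have hz := gI_zero lam hlam
  cases n with
  | zero =>
    have : gamG lam 0 = 1 := by simp [gamG, h0]
    rw [this]; linarith
  | succ k =>
    have hp := poch_pos lam hlam h0 k
    have hk : (0 : ℝ) ≤ k := k.cast_nonneg
    have hl : (0 : ℝ) < ((k + 1 : ℕ) : ℝ) + lam := by push_cast; linarith
    rw [gamG, sq_sqrt (by positivity)]
    generalize lam * (ascPochhammer ℝ (k + 1)).eval (2 * lam) = P at *
    field_simp
    linear_combination kap lam * h + P * hz

/-- The square of the angular normalized Gegenbauer function. -/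
noncomputable def U (lam : ℝ) (n : ℕ) (θ : ℝ) : ℝ :=
  kap lam * gamG lam n ^ 2 * Geg lam n (cos θ) ^ 2 * sin θ ^ (2 * lam)

theorem U_integrable (lam : ℝ) (hlam : -(1 / 2) < lam) (n : ℕ) :
    IntegrableOn (U lam n) (Set.Ioo 0 π) :=
  cont_mul_sin_int (((gegc_cont lam n).pow 2).const_mul _) _ (by linarith)

theorem U_integral (lam : ℝ) (hlam : -(1 / 2) < lam) (h0 : lam ≠ 0) (n : ℕ) :
    ∫ θ in Set.Ioo 0 π, U lam n θ = 1 := by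
  rw [← gamG_sq lam hlam h0 n, gI, ← integral_const_mul]
  congr 1; funext θ; unfold U; ring

theorem U_measurable (lam : ℝ) (n : ℕ) : Measurable (U lam n) :=
  (((gegc_cont lam n).pow 2).const_mul _).measurable.mul (measurable_sin.pow_const _)

theorem U_symm (lam : ℝ) (n : ℕ) (θ : ℝ) : U lam n (π - θ) = U lam n θ := by
  unfold U
  rw [cos_pi_sub, sin_pi_sub, Geg_neg, mul_pow, ← pow_mul, mul_comm n 2, pow_mul]
  simp

theorem mono_of_deriv {f f' : ℝ → ℝ} {a b : ℝ} (hab : a ≤ b)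
    (hf : ContinuousOn f (Set.Icc a b)) (hd : ∀ x ∈ Set.Ioo a b, HasDerivAt f (f' x) x)
    (h : ∀ x ∈ Set.Ioo a b, 0 ≤ f' x) : f a ≤ f b := by
  have : MonotoneOn f (Set.Icc a b) := by
    apply monotoneOn_of_deriv_nonneg (convex_Icc a b) hf
    · rw [interior_Icc]; exact fun x hx => (hd x hx).differentiableAt.differentiableWithinAt
    · rw [interior_Icc]; intro x hx; rw [(hd x hx).deriv]; exact h x hx
  exact this ⟨le_refl a, hab⟩ ⟨hab, le_refl b⟩ hab

theorem compare_deriv {f f' g g' : ℝ → ℝ} {a b : ℝ} (hab : a ≤ b)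
    (hf : ContinuousOn f (Set.Icc a b)) (hfd : ∀ x ∈ Set.Ioo a b, HasDerivAt f (f' x) x)
    (hg : ContinuousOn g (Set.Icc a b)) (hgd : ∀ x ∈ Set.Ioo a b, HasDerivAt g (g' x) x)
    (h : ∀ x ∈ Set.Ioo a b, |f' x| ≤ g' x) : |f b - f a| ≤ g b - g a := by
  have h1 := mono_of_deriv (f := fun x => g x - f x) (f' := fun x => g' x - f' x) hab (hg.sub hf)
    (fun x hx => (hgd x hx).sub (hfd x hx)) (fun x hx => by linarith [(abs_le.1 (h x hx)).2])
  have h2 := mono_of_deriv (f := fun x => g x + f x) (f' := fun x => g' x + f' x) hab (hg.add hf)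
    (fun x hx => (hgd x hx).add (hfd x hx)) (fun x hx => by linarith [(abs_le.1 (h x hx)).1])
  rw [abs_le]; constructor <;> linarith

theorem cot_hasDeriv {θ : ℝ} (h : 0 < sin θ) :
    HasDerivAt (fun x => cos x / sin x) (-(1 / sin θ ^ 2)) θ := by
  have := (hasDerivAt_cos θ).div (hasDerivAt_sin θ) h.ne'
  refine this.congr_deriv ?_
  rw [← neg_div]; congr 1
  linear_combination -sin_sq_add_cos_sq θ

section ode
variable {u u1 : ℝ → ℝ} {N A : ℝ}

theorem ode_R_bound (hN : 0 < N)
    (hu : ∀ θ ∈ Set.Ioo 0 π, HasDerivAt u (u1 θ) θ)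
    (hu1 : ∀ θ ∈ Set.Ioo 0 π, HasDerivAt u1 (-(N ^ 2 + A / sin θ ^ 2) * u θ) θ)
    {θ : ℝ} (h0 : 0 < θ) (h1 : θ ≤ π / 2) :
    u θ ^ 2 + (u1 θ / N) ^ 2 ≤
      (u (π / 2) ^ 2 + (u1 (π / 2) / N) ^ 2) * exp (|A| / N * (cos θ / sin θ)) := by
  have hsub : ∀ x ∈ Set.Icc θ (π / 2), x ∈ Set.Ioo 0 π := fun x hx =>
    ⟨lt_of_lt_of_le h0 hx.1, lt_of_le_of_lt hx.2 (by linarith [pi_pos])⟩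
  have hd : ∀ x ∈ Set.Icc θ (π / 2), HasDerivAt
      (fun x => (u x ^ 2 + (u1 x / N) ^ 2) * exp (-(|A| / N * (cos x / sin x))))
      ((-2 * A * u x * u1 x / (N ^ 2 * sin x ^ 2) +
        (u x ^ 2 + (u1 x / N) ^ 2) * (|A| / N / sin x ^ 2)) *
          exp (-(|A| / N * (cos x / sin x)))) x := by
    intro x hx
    have hs := sin_pos_Ioo (hsub x hx)
    have := (((hu x (hsub x hx)).pow 2).add (((hu1 x (hsub x hx)).div_const N).pow 2)).mul
      (((cot_hasDeriv hs).const_mul (|A| / N)).neg.exp)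
    refine this.congr_deriv ?_
    simp only [Pi.add_apply, Pi.pow_apply, Pi.neg_apply, Nat.cast_ofNat, Nat.add_one_sub_one,
      pow_one]
    have hN' := hN.ne'
    field_simp
    ring
  have := mono_of_deriv h1 (fun x hx => (hd x hx).continuousAt.continuousWithinAt)
    (fun x hx => hd x ⟨hx.1.le, hx.2.le⟩) (fun x hx => by
      have hs := sin_pos_Ioo (hsub x ⟨hx.1.le, hx.2.le⟩)
      apply mul_nonneg _ (exp_pos _).le
      have e : -2 * A * u x * u1 x / (N ^ 2 * sin x ^ 2) +
        (u x ^ 2 + (u1 x / N) ^ 2) * (|A| / N / sin x ^ 2) =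
        ((u x ^ 2 + (u1 x / N) ^ 2) * |A| - 2 * A * (u x * (u1 x / N))) / (N * sin x ^ 2) := by
        field_simp
        ring
      rw [e]
      apply div_nonneg _ (by positivity)
      generalize u1 x / N = b
      have h1 := two_mul_le_add_sq (u x) b
      have h2 := two_mul_le_add_sq (-u x) b
      rcases le_total 0 A with hA | hA
      · rw [abs_of_nonneg hA]; nlinarith
      · rw [abs_of_nonpos hA]; nlinarith)
  simp only [cos_pi_div_two, zero_div, mul_zero, neg_zero, exp_zero, mul_one] at this
  rw [exp_neg] at this
  have he := exp_pos (|A| / N * (cos θ / sin θ))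
  rw [← div_eq_mul_inv, div_le_iff₀ he] at this
  exact this

/-- free comparison function -/
noncomputable def ufree (a b N θ : ℝ) : ℝ := a * cos (N * (θ - π / 2)) + b * sin (N * (θ - π / 2))

theorem ufree_sq_le (a b N θ : ℝ) : ufree a b N θ ^ 2 ≤ a ^ 2 + b ^ 2 := by
  unfold ufree
  have := sin_sq_add_cos_sq (N * (θ - π / 2))
  nlinarith [sq_nonneg (a * sin (N * (θ - π / 2)) - b * cos (N * (θ - π / 2)))]

theorem ode_approx (hN : 0 < N)
    (hu : ∀ θ ∈ Set.Ioo 0 π, HasDerivAt u (u1 θ) θ)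
    (hu1 : ∀ θ ∈ Set.Ioo 0 π, HasDerivAt u1 (-(N ^ 2 + A / sin θ ^ 2) * u θ) θ)
    {θ : ℝ} (h0 : 0 < θ) (h1 : θ ≤ π / 2) :
    |u θ ^ 2 - ufree (u (π / 2)) (u1 (π / 2) / N) N θ ^ 2| ≤
      4 * (|A| / N * (cos θ / sin θ)) * exp (|A| / N * (cos θ / sin θ)) *
      (u (π / 2) ^ 2 + (u1 (π / 2) / N) ^ 2) := by
  have hsub : ∀ x ∈ Set.Icc θ (π / 2), x ∈ Set.Ioo 0 π := fun x hx =>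
    ⟨lt_of_lt_of_le h0 hx.1, lt_of_le_of_lt hx.2 (by linarith [pi_pos])⟩
  set a := u (π / 2) with ha
  set b := u1 (π / 2) / N with hb
  set ct := cos θ / sin θ with hct
  set E := exp (|A| / N * ct) with hE
  have hsθ := sin_pos_Ioo (hsub θ ⟨le_refl _, h1⟩)
  have hct0 : 0 ≤ ct := div_nonneg (cos_nonneg_of_mem_Icc ⟨by linarith [pi_pos], h1⟩) hsθ.le
  have hE1 : 1 ≤ E := one_le_exp (by positivity)
  set S := √((a ^ 2 + b ^ 2) * E) with hS
  have hSsq : S ^ 2 = (a ^ 2 + b ^ 2) * E := sq_sqrt (by positivity)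
  have hS0 : 0 ≤ S := sqrt_nonneg _
  -- monotonicity of cot
  have hcot : ∀ x ∈ Set.Icc θ (π / 2), cos x / sin x ≤ ct := by
    intro x hx
    have hs := sin_pos_Ioo (hsub x hx)
    apply div_le_div₀
    · exact cos_nonneg_of_mem_Icc ⟨by linarith, h1⟩
    · exact cos_le_cos_of_nonneg_of_le_pi h0.le (by linarith [hx.2, pi_pos]) hx.1
    · exact hsθ
    · exact sin_le_sin_of_le_of_le_pi_div_two (by linarith) hx.2 hx.1
  have huS : ∀ x ∈ Set.Icc θ (π / 2), |u x| ≤ S := by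
    intro x hx
    refine abs_le_of_sq_le_sq ?_ hS0
    have h := ode_R_bound hN hu hu1 (hsub x hx).1 hx.2
    rw [hSsq]
    have h3 : exp (|A| / N * (cos x / sin x)) ≤ E :=
      exp_le_exp.2 (mul_le_mul_of_nonneg_left (hcot x hx) (by positivity))
    have h4 : (a ^ 2 + b ^ 2) * exp (|A| / N * (cos x / sin x)) ≤ (a ^ 2 + b ^ 2) * E :=
      mul_le_mul_of_nonneg_left h3 (by positivity)
    nlinarith [sq_nonneg (u1 x / N)]
  have hτ : ∀ x : ℝ, HasDerivAt (fun x => N * (x - π / 2)) N x := fun x => by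
    simpa using ((hasDerivAt_id x).sub_const (π / 2)).const_mul N
  have dα : ∀ x ∈ Set.Icc θ (π / 2), HasDerivAt
      (fun x => u x * cos (N * (x - π / 2)) - u1 x / N * sin (N * (x - π / 2)))
      (A / (N * sin x ^ 2) * (u x * sin (N * (x - π / 2)))) x := by
    intro x hx
    have hs := sin_pos_Ioo (hsub x hx)
    have := ((hu x (hsub x hx)).mul (hτ x).cos).sub
      (((hu1 x (hsub x hx)).div_const N).mul (hτ x).sin)
    refine this.congr_deriv ?_
    field_simp
    ring
  have dβ : ∀ x ∈ Set.Icc θ (π / 2), HasDerivAt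
      (fun x => u x * sin (N * (x - π / 2)) + u1 x / N * cos (N * (x - π / 2)))
      (-(A / (N * sin x ^ 2) * (u x * cos (N * (x - π / 2))))) x := by
    intro x hx
    have hs := sin_pos_Ioo (hsub x hx)
    have := ((hu x (hsub x hx)).mul (hτ x).sin).add
      (((hu1 x (hsub x hx)).div_const N).mul (hτ x).cos)
    refine this.congr_deriv ?_
    field_simp
    ring
  have dg : ∀ x ∈ Set.Icc θ (π / 2), HasDerivAt (fun x => -(|A| / N * S) * (cos x / sin x))
      (|A| / N * S / sin x ^ 2) x := by
    intro x hx
    have hs := sin_pos_Ioo (hsub x hx)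
    refine ((cot_hasDeriv hs).const_mul (-(|A| / N * S))).congr_deriv ?_
    field_simp
  have bd : ∀ x ∈ Set.Icc θ (π / 2), ∀ t : ℝ, |t| ≤ 1 →
      |A / (N * sin x ^ 2) * (u x * t)| ≤ |A| / N * S / sin x ^ 2 := by
    intro x hx t ht
    have hs := sin_pos_Ioo (hsub x hx)
    rw [abs_mul, abs_div, abs_of_pos (show 0 < N * sin x ^ 2 by positivity), abs_mul]
    have : |u x| * |t| ≤ S * 1 := mul_le_mul (huS x hx) ht (abs_nonneg _) hS0
    calc |A| / (N * sin x ^ 2) * (|u x| * |t|) ≤ |A| / (N * sin x ^ 2) * (S * 1) :=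
          mul_le_mul_of_nonneg_left this (by positivity)
      _ = _ := by field_simp
  have cα := compare_deriv h1 (fun x hx => (dα x hx).continuousAt.continuousWithinAt)
    (fun x hx => dα x ⟨hx.1.le, hx.2.le⟩) (fun x hx => (dg x hx).continuousAt.continuousWithinAt)
    (fun x hx => dg x ⟨hx.1.le, hx.2.le⟩) (fun x hx => bd x ⟨hx.1.le, hx.2.le⟩ _ (abs_sin_le_one _))
  have cβ := compare_deriv h1 (fun x hx => (dβ x hx).continuousAt.continuousWithinAt)
    (fun x hx => dβ x ⟨hx.1.le, hx.2.le⟩) (fun x hx => (dg x hx).continuousAt.continuousWithinAt)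
    (fun x hx => dg x ⟨hx.1.le, hx.2.le⟩)
    (fun x hx => by rw [abs_neg]; exact bd x ⟨hx.1.le, hx.2.le⟩ _ (abs_cos_le_one _))
  simp only [sub_self, mul_zero, cos_zero, sin_zero, mul_one, sub_zero, zero_add, cos_pi_div_two,
    zero_div, zero_sub, ← ha, ← hb, ← hct, neg_mul, neg_neg] at cα cβ
  set c := cos (N * (θ - π / 2))
  set s := sin (N * (θ - π / 2))
  have hcs : s ^ 2 + c ^ 2 = 1 := sin_sq_add_cos_sq _
  have hdiff : |u θ - ufree a b N θ| ≤ 2 * (|A| / N * S * ct) := by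
    have e : u θ - ufree a b N θ =
        -((a - (u θ * c - u1 θ / N * s)) * c + (b - (u θ * s + u1 θ / N * c)) * s) := by
      simp only [ufree]
      linear_combination (-u θ) * hcs
    rw [e, abs_neg]
    refine (abs_add_le _ _).trans ?_
    rw [abs_mul, abs_mul]
    have t1 := mul_le_mul cα (abs_cos_le_one (N * (θ - π / 2))) (abs_nonneg _)
      (by positivity : 0 ≤ |A| / N * S * ct)
    have t2 := mul_le_mul cβ (abs_sin_le_one (N * (θ - π / 2))) (abs_nonneg _)
      (by positivity : 0 ≤ |A| / N * S * ct)
    linarith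
  have hfree : |ufree a b N θ| ≤ S := by
    refine abs_le_of_sq_le_sq ?_ hS0
    rw [hSsq]
    have := ufree_sq_le a b N θ
    nlinarith [sq_nonneg a, sq_nonneg b]
  have hsum : |u θ + ufree a b N θ| ≤ 2 * S := by
    have := abs_add_le (u θ) (ufree a b N θ)
    linarith [huS θ ⟨le_refl _, h1⟩]
  have e2 : u θ ^ 2 - ufree a b N θ ^ 2 = (u θ - ufree a b N θ) * (u θ + ufree a b N θ) := by ring
  rw [e2, abs_mul]
  calc _ ≤ 2 * (|A| / N * S * ct) * (2 * S) :=
        mul_le_mul hdiff hsum (abs_nonneg _) (by positivity)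
    _ = 4 * (|A| / N * ct) * S ^ 2 := by ring
    _ = _ := by rw [hSsq]; ring

end ode

theorem geg_edge (lam : ℝ) (hlam : -(1 / 2) < lam) (n : ℕ) (hn : 1 ≤ n) (θ0 : ℝ) (h0 : 0 < θ0)
    (h1 : θ0 ≤ π / 3) (hs : 2 * (n * (n + 2 * lam)) / (2 * lam + 1) * sin θ0 ^ 2 ≤ 1 / 2)
    (θ : ℝ) (hθ : θ ∈ Set.Icc 0 θ0) :
    |Geg lam n (cos θ)| ≤ 2 * |Geg lam n (cos θ0)| := by
  have hpi := pi_pos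
  obtain ⟨t, ht, hmax⟩ := isCompact_Icc.exists_isMaxOn (s := Set.Icc 0 θ0) ⟨0, le_refl 0, h0.le⟩
    (gegc_cont lam n).abs.continuousOn
  set B := |Geg lam n (cos t)| with hB
  have hB' : ∀ x ∈ Set.Icc 0 θ0, |Geg lam n (cos x)| ≤ B := fun x hx => hmax hx
  have hn' : (1 : ℝ) ≤ n := by exact_mod_cast hn
  set M := (n : ℝ) * (n + 2 * lam) with hM
  have hM0 : 0 ≤ M := mul_nonneg (by linarith) (by linarith)
  have hl : 0 < 2 * lam + 1 := by linarith
  set K := 2 * M / (2 * lam + 1) with hK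
  have hK0 : 0 ≤ K := by positivity
  have hsub : ∀ x ∈ Set.Ioc 0 θ0, x ∈ Set.Ioo 0 π := fun x hx =>
    ⟨hx.1, lt_of_le_of_lt hx.2 (by linarith)⟩
  have hcos : ∀ x ∈ Set.Ioc 0 θ0, 1 / 2 ≤ cos x := fun x hx => by
    rw [← cos_pi_div_three]
    exact cos_le_cos_of_nonneg_of_le_pi hx.1.le (by linarith) (hx.2.trans h1)
  have hD : ∀ x ∈ Set.Ioc 0 θ0, |GegD lam n (cos x)| ≤ K * B := by
    intro x hx
    have hcf : Continuous (fun x : ℝ => sin x ^ (2 * lam + 1)) :=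
      continuous_sin.rpow_const fun x => Or.inr (by linarith)
    have key := compare_deriv (f := fun x => sin x ^ (2 * lam + 1) * GegD lam n (cos x))
      (f' := fun x => M * sin x ^ (2 * lam) * Geg lam n (cos x))
      (g := fun x => K * B * sin x ^ (2 * lam + 1))
      (g' := fun x => K * B * (cos x * (2 * lam + 1) * sin x ^ (2 * lam)))
      hx.1.le (hcf.mul (gegDc_cont lam n)).continuousOn ?_ (hcf.const_mul _).continuousOn ?_ ?_
    · have hsx := sin_pos_Ioo (hsub x hx)
      have hp : 0 < sin x ^ (2 * lam + 1) := rpow_pos_of_pos hsx _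
      simp only [sin_zero, zero_rpow hl.ne', zero_mul, sub_zero, mul_zero] at key
      rw [abs_mul, abs_of_pos hp, mul_comm] at key
      exact le_of_mul_le_mul_right key hp
    · intro y hy
      have hy' : y ∈ Set.Ioc 0 θ0 := ⟨hy.1, hy.2.le.trans hx.2⟩
      have hsy := sin_pos_Ioo (hsub y hy')
      refine ((sinpow_hasDeriv hsy (2 * lam + 1)).mul (gegDc_hasDeriv lam n y)).congr_deriv ?_
      have hx : 1 - cos y ^ 2 ≠ 0 := by rw [one_sub_cos_sq]; positivity
      have o1 := Geg_ode lam n (cos y) hx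
      rw [one_sub_cos_sq] at o1
      have e1 : sin y ^ (2 * lam + 1) = sin y * sin y ^ (2 * lam) := by
        rw [rpow_add hsy, rpow_one]; ring
      have e2 : sin y ^ (2 * lam + 1 - 1) = sin y ^ (2 * lam) := by congr 1; ring
      rw [e1, e2]
      linear_combination (-sin y ^ (2 * lam)) * o1
    · intro y hy
      have hy' : y ∈ Set.Ioc 0 θ0 := ⟨hy.1, hy.2.le.trans hx.2⟩
      have hsy := sin_pos_Ioo (hsub y hy')
      refine ((sinpow_hasDeriv hsy (2 * lam + 1)).const_mul (K * B)).congr_deriv ?_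
      have e2 : sin y ^ (2 * lam + 1 - 1) = sin y ^ (2 * lam) := by congr 1; ring
      rw [e2]
    · intro y hy
      have hy' : y ∈ Set.Ioc 0 θ0 := ⟨hy.1, hy.2.le.trans hx.2⟩
      have hsy := sin_pos_Ioo (hsub y hy')
      have hp : 0 < sin y ^ (2 * lam) := rpow_pos_of_pos hsy _
      rw [abs_mul, abs_of_nonneg (mul_nonneg hM0 hp.le)]
      have hc := hcos y hy'
      have e : K * B * (cos y * (2 * lam + 1) * sin y ^ (2 * lam)) =
          (2 * cos y) * (M * sin y ^ (2 * lam) * B) := by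
        rw [hK]; field_simp
      rw [e]
      have t1 := mul_le_mul_of_nonneg_left (hB' y ⟨hy.1.le, hy.2.le.trans hx.2⟩)
        (mul_nonneg hM0 hp.le)
      have t2 : 0 ≤ M * sin y ^ (2 * lam) * B := mul_nonneg (mul_nonneg hM0 hp.le) (abs_nonneg _)
      nlinarith
  have key2 := compare_deriv (f := fun x => Geg lam n (cos x))
      (f' := fun x => GegD lam n (cos x) * -sin x)
      (g := fun x => -(K * B) * cos x) (g' := fun x => K * B * sin x) ht.2
      (gegc_cont lam n).continuousOn (fun x _ => gegc_hasDeriv lam n x)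
      (continuous_cos.const_mul _).continuousOn
      (fun x _ => ((hasDerivAt_cos x).const_mul (-(K * B))).congr_deriv (by ring))
      (fun x hx => by
        have hx' : x ∈ Set.Ioc 0 θ0 := ⟨lt_of_le_of_lt ht.1 hx.1, hx.2.le⟩
        have hsx := sin_pos_Ioo (hsub x hx')
        rw [abs_mul, abs_neg, abs_of_pos hsx]
        exact mul_le_mul_of_nonneg_right (hD x hx') hsx.le)
  have hc0 := hcos θ0 ⟨h0, le_refl _⟩
  have hct : cos t - cos θ0 ≤ sin θ0 ^ 2 := by
    rw [sin_sq]; nlinarith [cos_le_one t, cos_le_one θ0]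
  have hB0 : 0 ≤ B := abs_nonneg _
  have h5 : |Geg lam n (cos θ0) - Geg lam n (cos t)| ≤ B / 2 := by
    have : K * B * (cos t - cos θ0) ≤ K * B * sin θ0 ^ 2 :=
      mul_le_mul_of_nonneg_left hct (by positivity)
    nlinarith
  have h6 : B ≤ |Geg lam n (cos θ0)| + |Geg lam n (cos θ0) - Geg lam n (cos t)| := by
    have := abs_sub_abs_le_abs_sub (Geg lam n (cos t)) (Geg lam n (cos θ0))
    rw [abs_sub_comm] at this
    linarith
  linarith [hB' θ hθ]

noncomputable def uF (lam : ℝ) (n : ℕ) (θ : ℝ) : ℝ :=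
  √(kap lam) * gamG lam n * (sin θ ^ lam * Geg lam n (cos θ))

noncomputable def uF1 (lam : ℝ) (n : ℕ) (θ : ℝ) : ℝ :=
  √(kap lam) * gamG lam n * (cos θ * lam * sin θ ^ (lam - 1) * Geg lam n (cos θ) +
    sin θ ^ lam * (GegD lam n (cos θ) * -sin θ))

theorem uF_sq (lam : ℝ) (hlam : -(1 / 2) < lam) (n : ℕ) {θ : ℝ} (h : 0 < sin θ) :
    uF lam n θ ^ 2 = U lam n θ := by
  unfold uF U
  have : sin θ ^ (2 * lam) = (sin θ ^ lam) ^ 2 := by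
    rw [← rpow_natCast, ← rpow_mul h.le]; congr 1; push_cast; ring
  rw [this, mul_pow, mul_pow, sq_sqrt (kap_pos lam hlam).le]; ring

theorem uF_hasDeriv (lam : ℝ) (n : ℕ) {θ : ℝ} (h : 0 < sin θ) :
    HasDerivAt (uF lam n) (uF1 lam n θ) θ :=
  ((sinpow_hasDeriv h lam).mul (gegc_hasDeriv lam n θ)).const_mul _

theorem uF1_hasDeriv (lam : ℝ) (n : ℕ) {θ : ℝ} (h : 0 < sin θ) :
    HasDerivAt (uF1 lam n)
      (-(((n : ℝ) + lam) ^ 2 + lam * (1 - lam) / sin θ ^ 2) * uF lam n θ) θ := by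
  have d1 := (((hasDerivAt_cos θ).mul_const lam).mul (sinpow_hasDeriv h (lam - 1))).mul
    (gegc_hasDeriv lam n θ)
  have d2 := (sinpow_hasDeriv h lam).mul ((gegDc_hasDeriv lam n θ).mul (hasDerivAt_sin θ).neg)
  refine ((d1.add d2).const_mul (√(kap lam) * gamG lam n)).congr_deriv ?_
  have hx : 1 - cos θ ^ 2 ≠ 0 := by rw [one_sub_cos_sq]; positivity
  have o1 := Geg_ode lam n (cos θ) hx
  rw [one_sub_cos_sq] at o1
  have e1 : sin θ ^ (lam - 1) = sin θ ^ lam / sin θ := rpow_sub_one h.ne' _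
  have e2 : sin θ ^ (lam - 1 - 1) = sin θ ^ lam / sin θ / sin θ := by
    rw [rpow_sub_one h.ne', e1]
  unfold uF
  simp only [e1, e2, Pi.mul_apply, Pi.neg_apply]
  have hc : cos θ ^ 2 = 1 - sin θ ^ 2 := by linarith [sin_sq_add_cos_sq θ]
  generalize sin θ ^ lam = p at *
  generalize √(kap lam) * gamG lam n = k at *
  generalize Geg lam n (cos θ) = g at *
  generalize GegD lam n (cos θ) = g1 at *
  generalize GegDD lam n (cos θ) = g2 at *
  generalize cos θ = c at *
  generalize sin θ = s at *
  field_simp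
  linear_combination (k * p * s ^ 2) * o1 + k * p * g * lam * (lam - 1) * hc

noncomputable def R0 (lam : ℝ) (n : ℕ) : ℝ :=
  uF lam n (π / 2) ^ 2 + (uF1 lam n (π / 2) / ((n : ℝ) + lam)) ^ 2

theorem R0_nonneg (lam : ℝ) (n : ℕ) : 0 ≤ R0 lam n := by unfold R0; positivity

noncomputable def Fr (lam : ℝ) (n : ℕ) (θ : ℝ) : ℝ :=
  1 + cos (2 * n * θ + 2 * lam * (θ - π / 2))

theorem ufree_parity (lam : ℝ) (n : ℕ) (θ : ℝ) :
    ufree (uF lam n (π / 2)) (uF1 lam n (π / 2) / ((n : ℝ) + lam)) ((n : ℝ) + lam) θ ^ 2 =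
      R0 lam n / 2 * Fr lam n θ := by
  have key : cos (2 * n * θ + 2 * lam * (θ - π / 2)) =
      (-1) ^ n * cos (2 * (((n : ℝ) + lam) * (θ - π / 2))) := by
    rw [← cos_add_nat_mul_pi]; congr 1; ring
  unfold Fr ufree R0
  rw [key, cos_two_mul]
  have hcs := sin_sq_add_cos_sq (((n : ℝ) + lam) * (θ - π / 2))
  rcases Nat.even_or_odd n with h | h
  · have : uF1 lam n (π / 2) = 0 := by simp [uF1, GegD_even_zero lam n h]
    rw [this, h.neg_one_pow]; simp; ring
  · have : uF lam n (π / 2) = 0 := by simp [uF, Geg_odd_zero lam n h]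
    rw [this, h.neg_one_pow]; simp
    linear_combination (uF1 lam n (π / 2) / (↑n + lam)) ^ 2 * hcs

theorem Fr_symm (lam : ℝ) (n : ℕ) (θ : ℝ) : Fr lam n (π - θ) = Fr lam n θ := by
  unfold Fr
  have : 2 * (n : ℝ) * (π - θ) + 2 * lam * (π - θ - π / 2) =
    n * (2 * π) - (2 * n * θ + 2 * lam * (θ - π / 2)) := by ring
  rw [this, cos_nat_mul_two_pi_sub]

set_option maxHeartbeats 1000000 in
theorem near_half (lam : ℝ) (hlam : -(1 / 2) < lam) (s : ℝ) (hs0 : 0 < s)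
    (hs1 : s < 1) (hsl : -(2 * lam) ≤ s) :
    ∃ C : ℝ, 0 ≤ C ∧ ∀ n : ℕ, 1 ≤ n → ∀ θ : ℝ, 0 < θ → θ ≤ π / 2 →
      |U lam n θ - R0 lam n / 2 * Fr lam n θ| ≤ C * R0 lam n * ((n : ℝ) * sin θ) ^ (-s) := by
  have hpi := pi_pos
  set A := lam * (1 - lam) with hA
  set c := (2 * lam + 1) / (4 * (1 + 2 * |lam|)) with hc
  have hal : 0 ≤ |lam| := abs_nonneg _
  have hc0 : 0 < c := div_pos (by linarith) (by positivity)
  have hc1 : c ≤ 1 / 4 := by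
    rw [hc, div_le_iff₀ (by positivity)]; linarith [le_abs_self lam]
  set Y := 2 * |A| / c with hY
  have hY0 : 0 ≤ Y := by positivity
  refine ⟨(4 * exp Y + 1) + 8 * |A| * exp Y * c ^ (s - 1), by positivity, ?_⟩
  intro n hn θ h0 h1
  have hn' : (1 : ℝ) ≤ n := by exact_mod_cast hn
  have hn0 : (0 : ℝ) < n := by linarith
  set N := (n : ℝ) + lam with hN
  have hN2 : (n : ℝ) / 2 ≤ N := by rw [hN]; linarith
  have hNp : 0 < N := by linarith
  have hu : ∀ θ ∈ Set.Ioo 0 π, HasDerivAt (uF lam n) (uF1 lam n θ) θ := fun θ hθ =>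
    uF_hasDeriv lam n (sin_pos_Ioo hθ)
  have hu1 : ∀ θ ∈ Set.Ioo 0 π, HasDerivAt (uF1 lam n)
    (-(N ^ 2 + A / sin θ ^ 2) * uF lam n θ) θ := fun θ hθ => uF1_hasDeriv lam n (sin_pos_Ioo hθ)
  have hR := R0_nonneg lam n
  have hR' : R0 lam n = uF lam n (π / 2) ^ 2 + (uF1 lam n (π / 2) / N) ^ 2 := rfl
  have hsθ : 0 < sin θ := sin_pos_of_pos_of_lt_pi h0 (by linarith)
  -- exponent bound
  have hy : ∀ φ : ℝ, 0 < sin φ → cos φ / sin φ ≤ 1 / sin φ := fun φ h =>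
    div_le_div_of_nonneg_right (cos_le_one φ) h.le
  have hy2 : ∀ φ : ℝ, 0 < sin φ →
      |A| / N * (cos φ / sin φ) ≤ 2 * |A| * ((n : ℝ) * sin φ)⁻¹ := by
    intro φ h
    calc |A| / N * (cos φ / sin φ) ≤ |A| / N * (1 / sin φ) :=
          mul_le_mul_of_nonneg_left (hy φ h) (by positivity)
      _ ≤ |A| / (n / 2) * (1 / sin φ) := by gcongr
      _ = _ := by field_simp
  have hy3 : ∀ φ : ℝ, 0 < sin φ → c ≤ n * sin φ → |A| / N * (cos φ / sin φ) ≤ Y := by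
    intro φ h hcφ
    refine (hy2 φ h).trans ?_
    rw [hY, div_eq_mul_inv]; gcongr
  set t := (n : ℝ) * sin θ with ht
  have ht0 : 0 < t := by positivity
  have htp : 0 < t ^ (-s) := rpow_pos_of_pos ht0 _
  rcases le_or_gt c t with hct | hct
  · have h := ode_approx hNp hu hu1 h0 h1
    rw [ufree_parity, uF_sq lam hlam n hsθ, ← hR'] at h
    refine h.trans ?_
    have e1 : exp (|A| / N * (cos θ / sin θ)) ≤ exp Y := exp_le_exp.2 (hy3 θ hsθ hct)
    have e2 := hy2 θ hsθ
    have e3 : t⁻¹ ≤ c ^ (s - 1) * t ^ (-s) := by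
      have : t⁻¹ = t ^ (s - 1) * t ^ (-s) := by
        rw [← rpow_add ht0, ← rpow_neg_one]; congr 1; ring
      rw [this]
      exact mul_le_mul_of_nonneg_right (rpow_le_rpow_of_nonpos hc0 hct (by linarith)) htp.le
    have e4 : |A| / N * (cos θ / sin θ) ≤ 2 * |A| * (c ^ (s - 1) * t ^ (-s)) :=
      e2.trans (mul_le_mul_of_nonneg_left e3 (by positivity))
    calc _ ≤ 4 * (2 * |A| * (c ^ (s - 1) * t ^ (-s))) * exp Y * R0 lam n := by gcongr
      _ = (8 * |A| * exp Y * c ^ (s - 1)) * R0 lam n * t ^ (-s) := by ring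
      _ ≤ _ := by
        gcongr
        linarith [exp_pos Y]
  · -- edge zone
    have hcn : c / n ≤ 1 / 4 := (div_le_self hc0.le hn').trans hc1
    have hcn0 : 0 < c / n := by positivity
    set θ0 := arcsin (c / n) with hθ0
    have hs0' : sin θ0 = c / n := sin_arcsin (by linarith) (by linarith)
    have hθ00 : 0 < θ0 := arcsin_pos.2 hcn0
    have hθ03 : θ0 ≤ π / 3 := by
      have : θ0 ≤ π / 6 := by
        rw [← arcsin_sin (x := π / 6) (by linarith) (by linarith), sin_pi_div_six]
        exact monotone_arcsin (by linarith)
      linarith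
    have hθle : θ ≤ θ0 := by
      rw [hθ0, le_arcsin_iff_sin_le ⟨by linarith, h1⟩ ⟨by linarith, by linarith⟩, le_div_iff₀ hn0]
      rw [ht] at hct; linarith
    have hedge := geg_edge lam hlam n hn θ0 hθ00 hθ03 (by
      rw [hs0']
      have hb : (n : ℝ) * (n + 2 * lam) ≤ n ^ 2 * (1 + 2 * |lam|) := by
        have : 2 * lam ≤ n * (2 * |lam|) := by nlinarith [le_abs_self lam]
        nlinarith
      have : c ^ 2 ≤ c / 4 := by nlinarith
      have hl : 0 < 2 * lam + 1 := by linarith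
      calc 2 * ((n : ℝ) * (n + 2 * lam)) / (2 * lam + 1) * (c / n) ^ 2
          ≤ 2 * (n ^ 2 * (1 + 2 * |lam|)) / (2 * lam + 1) * (c / n) ^ 2 := by gcongr
        _ = 2 * (1 + 2 * |lam|) / (2 * lam + 1) * c ^ 2 := by field_simp
        _ ≤ 2 * (1 + 2 * |lam|) / (2 * lam + 1) * (c / 4) := by gcongr
        _ ≤ 1 / 2 := by
          rw [hc]
          have : (1 + 2 * |lam|) ≠ 0 := by positivity
          field_simp
          norm_num) θ ⟨h0.le, hθle⟩
    have hr0 : 0 < t / c := by positivity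
    have hr1 : t / c ≤ 1 := (div_le_one hc0).2 hct.le
    have hsin : sin θ = (t / c) * sin θ0 := by rw [hs0', ht]; field_simp
    have hsp : 0 < sin θ0 := by rw [hs0']; exact hcn0
    have hU : U lam n θ ≤ 4 * U lam n θ0 * (t / c) ^ (-s) := by
      have hk := kap_pos lam hlam
      unfold U
      rw [hsin, mul_rpow hr0.le hsp.le]
      have g2 : Geg lam n (cos θ) ^ 2 ≤ 4 * Geg lam n (cos θ0) ^ 2 := by
        have := pow_le_pow_left₀ (abs_nonneg _) hedge 2
        rw [mul_pow, sq_abs, sq_abs] at this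
        linarith
      have g3 : (t / c) ^ (2 * lam) ≤ (t / c) ^ (-s) :=
        rpow_le_rpow_of_exponent_ge hr0 hr1 (by linarith)
      calc _ ≤ kap lam * gamG lam n ^ 2 * (4 * Geg lam n (cos θ0) ^ 2) *
            ((t / c) ^ (-s) * sin θ0 ^ (2 * lam)) := by gcongr
        _ = _ := by ring
    have hU0 : U lam n θ0 ≤ R0 lam n * exp Y := by
      have h := ode_R_bound hNp hu hu1 hθ00 (by linarith)
      rw [uF_sq lam hlam n hsp, ← hR'] at h
      have e1 : exp (|A| / N * (cos θ0 / sin θ0)) ≤ exp Y := exp_le_exp.2 (hy3 θ0 hsp (by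
        rw [hs0']; field_simp; exact le_refl _))
      have := mul_le_mul_of_nonneg_left e1 hR
      linarith [sq_nonneg (uF1 lam n θ0 / N)]
    have htc : (t / c) ^ (-s) ≤ t ^ (-s) := by
      apply rpow_le_rpow_of_nonpos ht0 _ (by linarith)
      rw [le_div_iff₀ hc0]; nlinarith
    have hone : 1 ≤ t ^ (-s) := one_le_rpow_of_pos_of_le_one_of_nonpos ht0 (by linarith)
      (by linarith)
    have hF : R0 lam n / 2 * Fr lam n θ ≤ R0 lam n := by
      rw [← ufree_parity]; exact ufree_sq_le _ _ _ _
    have hF0 : 0 ≤ R0 lam n / 2 * Fr lam n θ := by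
      rw [← ufree_parity]; positivity
    have hU00 : 0 ≤ U lam n θ := by rw [← uF_sq lam hlam n hsθ]; positivity
    have hU1 : U lam n θ ≤ 4 * (R0 lam n * exp Y) * t ^ (-s) :=
      hU.trans (by gcongr)
    have hz : 0 ≤ 8 * |A| * exp Y * c ^ (s - 1) * R0 lam n * t ^ (-s) := by positivity
    have hRt : R0 lam n ≤ R0 lam n * t ^ (-s) := le_mul_of_one_le_right hR hone
    have h4 : 0 ≤ 4 * (R0 lam n * exp Y) * t ^ (-s) := by positivity
    rw [abs_le]
    constructor <;> linarith

theorem near_full (lam : ℝ) (hlam : -(1 / 2) < lam) (s : ℝ) (hs0 : 0 < s)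
    (hs1 : s < 1) (hsl : -(2 * lam) ≤ s) :
    ∃ C : ℝ, 0 ≤ C ∧ ∀ n : ℕ, 1 ≤ n → ∀ θ ∈ Set.Ioo 0 π,
      |U lam n θ - R0 lam n / 2 * Fr lam n θ| ≤ C * R0 lam n * ((n : ℝ) * sin θ) ^ (-s) := by
  obtain ⟨C, hC, h⟩ := near_half lam hlam s hs0 hs1 hsl
  refine ⟨C, hC, fun n hn θ hθ => ?_⟩
  rcases le_total θ (π / 2) with h1 | h1
  · exact h n hn θ hθ.1 h1
  · have := h n hn (π - θ) (by linarith [hθ.2]) (by linarith)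
    rwa [U_symm, Fr_symm, sin_pi_sub] at this

theorem Fr_cont (lam : ℝ) (n : ℕ) : Continuous (Fr lam n) := by
  unfold Fr; fun_prop

theorem Fr_integral (lam : ℝ) (hlam : -(1 / 2) < lam) (n : ℕ) (hn : 1 ≤ n) :
    |(∫ θ in Set.Ioo 0 π, Fr lam n θ) - π| ≤ 2 / n := by
  have hn' : (1 : ℝ) ≤ n := by exact_mod_cast hn
  have hN : 0 < (n : ℝ) + lam := by linarith
  have h1 : ∫ θ in Set.Ioo 0 π, Fr lam n θ = ∫ θ in (0 : ℝ)..π, Fr lam n θ := by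
    rw [intervalIntegral.integral_of_le pi_pos.le, integral_Ioc_eq_integral_Ioo]
  have h2 : ∫ θ in (0 : ℝ)..π, Fr lam n θ =
      (π + sin (2 * n * π + 2 * lam * (π - π / 2)) / (2 * (n + lam))) -
      (0 + sin (2 * n * 0 + 2 * lam * (0 - π / 2)) / (2 * (n + lam))) := by
    apply intervalIntegral.integral_eq_sub_of_hasDerivAt
      (f := fun θ => θ + sin (2 * n * θ + 2 * lam * (θ - π / 2)) / (2 * (n + lam)))
    · intro θ _
      have hd : HasDerivAt (fun θ : ℝ => 2 * (n : ℝ) * θ + 2 * lam * (θ - π / 2))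
          (2 * n + 2 * lam) θ := by
        have := ((hasDerivAt_id θ).const_mul (2 * (n : ℝ))).add
          (((hasDerivAt_id θ).sub_const (π / 2)).const_mul (2 * lam))
        exact this.congr_deriv (by simp)
      refine ((hasDerivAt_id θ).add (hd.sin.div_const (2 * (n + lam)))).congr_deriv ?_
      unfold Fr
      field_simp
    · exact (Fr_cont lam n).intervalIntegrable _ _
  rw [h1, h2]
  set a := sin (2 * n * π + 2 * lam * (π - π / 2))
  set b := sin (2 * n * 0 + 2 * lam * (0 - π / 2))
  have ha : |a| ≤ 1 := abs_sin_le_one _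
  have hb : |b| ≤ 1 := abs_sin_le_one _
  have e : π + a / (2 * (n + lam)) - (0 + b / (2 * (n + lam))) - π = (a - b) / (2 * (n + lam)) := by
    ring
  rw [e, abs_div, abs_of_pos (by positivity : 0 < 2 * ((n : ℝ) + lam)), div_le_div_iff₀ (by positivity) (by positivity)]
  have : |a - b| ≤ 2 := (abs_sub _ _).trans (by linarith)
  nlinarith

theorem norm_bound (lam : ℝ) (hlam : -(1 / 2) < lam) (hl0 : lam ≠ 0) (s : ℝ) (hs0 : 0 < s)
    (hs1 : s < 1) (hsl : -(2 * lam) ≤ s) :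
    ∃ C : ℝ, 0 ≤ C ∧ ∀ n : ℕ, 1 ≤ n → |1 - R0 lam n / 2 * π| ≤ C * R0 lam n * (n : ℝ) ^ (-s) := by
  obtain ⟨C, hC, h⟩ := near_full lam hlam s hs0 hs1 hsl
  set I := ∫ θ in Set.Ioo 0 π, sin θ ^ (-s) with hI
  have hI0 : 0 ≤ I := setIntegral_nonneg measurableSet_Ioo
    fun θ hθ => (rpow_pos_of_pos (sin_pos_Ioo hθ) _).le
  refine ⟨1 + C * I, by positivity, fun n hn => ?_⟩
  have hn' : (1 : ℝ) ≤ n := by exact_mod_cast hn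
  have hR := R0_nonneg lam n
  have hiF : IntegrableOn (Fr lam n) (Set.Ioo 0 π) :=
    ((Fr_cont lam n).integrableOn_Icc).mono_set Set.Ioo_subset_Icc_self
  have hs := sin_rpow_integrable (-s) (by linarith)
  have h1 : |∫ θ in Set.Ioo 0 π, (U lam n θ - R0 lam n / 2 * Fr lam n θ)| ≤
      C * R0 lam n * (n : ℝ) ^ (-s) * I := by
    rw [hI, ← integral_const_mul, ← Real.norm_eq_abs]
    refine norm_integral_le_of_norm_le (hs.const_mul _) ?_
    refine (ae_restrict_iff' measurableSet_Ioo).2 (Filter.Eventually.of_forall fun θ hθ => ?_)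
    have := h n hn θ hθ
    rw [mul_rpow (by linarith) (sin_pos_Ioo hθ).le] at this
    rw [Real.norm_eq_abs]; linarith
  rw [integral_sub (U_integrable lam hlam n) (hiF.const_mul _), U_integral lam hlam hl0,
    integral_const_mul] at h1
  have h2 := Fr_integral lam hlam n hn
  have h3 : (2 : ℝ) / n ≤ 2 * (n : ℝ) ^ (-s) := by
    rw [div_eq_mul_inv, ← rpow_neg_one]
    exact mul_le_mul_of_nonneg_left (rpow_le_rpow_of_exponent_le hn' (by linarith)) (by norm_num)
  have h4 : |R0 lam n / 2 * ((∫ θ in Set.Ioo 0 π, Fr lam n θ) - π)| ≤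
      R0 lam n * (n : ℝ) ^ (-s) := by
    rw [abs_mul, abs_of_nonneg (by positivity : 0 ≤ R0 lam n / 2)]
    have := mul_le_mul_of_nonneg_left (h2.trans h3) (by positivity : 0 ≤ R0 lam n / 2)
    linarith
  have e : 1 - R0 lam n / 2 * π = (1 - R0 lam n / 2 * ∫ θ in Set.Ioo 0 π, Fr lam n θ) +
    R0 lam n / 2 * ((∫ θ in Set.Ioo 0 π, Fr lam n θ) - π) := by ring
  rw [e]
  refine (abs_add_le _ _).trans ?_
  linarith

theorem R0_bdd (lam : ℝ) (hlam : -(1 / 2) < lam) (hl0 : lam ≠ 0) (s : ℝ) (hs0 : 0 < s)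
    (hs1 : s < 1) (hsl : -(2 * lam) ≤ s) :
    ∃ C : ℝ, 0 ≤ C ∧ ∀ n : ℕ, 1 ≤ n → R0 lam n ≤ C := by
  obtain ⟨C, hC, h⟩ := norm_bound lam hlam hl0 s hs0 hs1 hsl
  have ht : Filter.Tendsto (fun n : ℕ => C * (n : ℝ) ^ (-s)) Filter.atTop (nhds (C * 0)) :=
    ((tendsto_rpow_neg_atTop hs0).comp tendsto_natCast_atTop_atTop).const_mul C
  rw [mul_zero] at ht
  obtain ⟨J, hJ⟩ := Filter.eventually_atTop.1 (ht.eventually_lt_const (show (0 : ℝ) < 1 by norm_num))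
  refine ⟨∑ j ∈ range J, R0 lam j + 2,
    add_nonneg (Finset.sum_nonneg fun j _ => R0_nonneg lam j) (by norm_num), fun n hn => ?_⟩
  have hsum : 0 ≤ ∑ j ∈ range J, R0 lam j := Finset.sum_nonneg fun j _ => R0_nonneg lam j
  rcases lt_or_ge n J with h1 | h1
  · have := Finset.single_le_sum (f := fun j => R0 lam j) (fun j _ => R0_nonneg lam j)
      (Finset.mem_range.2 h1)
    linarith
  · have h2 := hJ n h1
    have h3 := (abs_le.1 (h n hn)).1
    have hp := pi_gt_three
    have hR := R0_nonneg lam n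
    nlinarith

theorem U_approx (lam : ℝ) (hlam : -(1 / 2) < lam) (hl0 : lam ≠ 0) (s : ℝ) (hs0 : 0 < s)
    (hs1 : s < 1) (hsl : -(2 * lam) ≤ s) :
    ∃ C : ℝ, 0 ≤ C ∧ ∀ n : ℕ, 1 ≤ n → ∀ θ ∈ Set.Ioo 0 π,
      |U lam n θ - 1 / π * Fr lam n θ| ≤ C * ((n : ℝ) ^ (-s) * sin θ ^ (-s)) := by
  obtain ⟨C, hC, h⟩ := near_full lam hlam s hs0 hs1 hsl
  obtain ⟨C1, hC1, h1⟩ := norm_bound lam hlam hl0 s hs0 hs1 hsl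
  obtain ⟨B, hB, h2⟩ := R0_bdd lam hlam hl0 s hs0 hs1 hsl
  refine ⟨C * B + C1 * B, by positivity, fun n hn θ hθ => ?_⟩
  have hsin := sin_pos_Ioo hθ
  have a1 := h n hn θ hθ
  have a2 := h1 n hn
  have a3 := h2 n hn
  rw [mul_rpow (Nat.cast_nonneg n) hsin.le] at a1
  have hp : 0 ≤ (n : ℝ) ^ (-s) := by positivity
  have hq : 1 ≤ sin θ ^ (-s) :=
    one_le_rpow_of_pos_of_le_one_of_nonpos hsin (sin_le_one θ) (by linarith)
  have hF : |Fr lam n θ| ≤ 2 := by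
    unfold Fr
    refine (abs_add_le _ _).trans ?_
    have := abs_cos_le_one (2 * n * θ + 2 * lam * (θ - π / 2))
    rw [abs_one]; linarith
  have hpi := pi_gt_three
  have b1 : |(R0 lam n / 2 - 1 / π) * Fr lam n θ| ≤ C1 * B * ((n : ℝ) ^ (-s) * sin θ ^ (-s)) := by
    have e : R0 lam n / 2 - 1 / π = -((1 - R0 lam n / 2 * π) / π) := by field_simp; ring
    rw [e, abs_mul, abs_neg, abs_div, abs_of_pos pi_pos]
    have c1 : |1 - R0 lam n / 2 * π| / π ≤ (C1 * R0 lam n * (n : ℝ) ^ (-s)) / 2 := by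
      have := a2
      rw [div_le_div_iff₀ (by positivity) (by norm_num)]
      nlinarith [abs_nonneg (1 - R0 lam n / 2 * π)]
    calc _ ≤ (C1 * R0 lam n * (n : ℝ) ^ (-s)) / 2 * 2 := by
          have := R0_nonneg lam n
          gcongr
      _ = C1 * R0 lam n * ((n : ℝ) ^ (-s) * 1) := by ring
      _ ≤ _ := by gcongr
  have b2 : C * R0 lam n * ((n : ℝ) ^ (-s) * sin θ ^ (-s)) ≤
      C * B * ((n : ℝ) ^ (-s) * sin θ ^ (-s)) := by gcongr
  have e : U lam n θ - 1 / π * Fr lam n θ = (U lam n θ - R0 lam n / 2 * Fr lam n θ) +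
    (R0 lam n / 2 - 1 / π) * Fr lam n θ := by ring
  rw [e]
  refine (abs_add_le _ _).trans ?_
  linarith

theorem sum_pow_le (s : ℝ) (hs0 : 0 < s) (hs1 : s < 1) (n : ℕ) :
    (1 - s) * ∑ j ∈ range n, ((j : ℝ) + 1) ^ (-s) ≤ (n : ℝ) ^ (1 - s) := by
  induction n with
  | zero => simp; positivity
  | succ n ih =>
    rw [Finset.sum_range_succ, mul_add]
    have hn : (0 : ℝ) < (n : ℝ) + 1 := by positivity
    have key := rpow_one_add_le_one_add_mul_self (s := -(1 / ((n : ℝ) + 1))) (p := 1 - s)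
      (by rw [neg_le_neg_iff, div_le_one hn]; linarith [n.cast_nonneg (α := ℝ)])
      (by linarith) (by linarith)
    have e1 : (1 + -(1 / ((n : ℝ) + 1))) = n / (n + 1) := by field_simp; ring
    rw [e1, div_rpow n.cast_nonneg hn.le, div_le_iff₀ (by positivity)] at key
    have e2 : ((n : ℝ) + 1) ^ (-s) = ((n : ℝ) + 1) ^ (1 - s) / (n + 1) := by
      rw [show -s = 1 - s - 1 by ring, rpow_sub_one hn.ne']
    push_cast
    rw [e2]
    calc _ ≤ (1 + (1 - s) * -(1 / ((n : ℝ) + 1))) * ((n : ℝ) + 1) ^ (1 - s) +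
          (1 - s) * (((n : ℝ) + 1) ^ (1 - s) / (n + 1)) := by linarith
      _ = _ := by ring

theorem dirichlet_tel (θ β : ℝ) (n : ℕ) :
    2 * sin θ * ∑ j ∈ range n, cos (2 * ((j : ℝ) + 1) * θ + β) =
      sin ((2 * n + 1) * θ + β) - sin (θ + β) := by
  induction n with
  | zero => simp
  | succ n ih =>
    rw [Finset.sum_range_succ, mul_add, ih]
    push_cast
    have e1 : (2 * ((n : ℝ) + 1) + 1) * θ + β = (2 * ((n : ℝ) + 1) * θ + β) + θ := by ring
    have e2 : (2 * (n : ℝ) + 1) * θ + β = (2 * ((n : ℝ) + 1) * θ + β) - θ := by ring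
    rw [e1, e2]
    generalize 2 * ((n : ℝ) + 1) * θ + β = x
    rw [sin_add x, sin_sub x]
    ring

theorem dirichlet_bd (s : ℝ) (hs0 : 0 < s) (hs1 : s < 1) {θ : ℝ} (h : 0 < sin θ) (β : ℝ) (n : ℕ)
    (hn : 1 ≤ n) :
    |∑ j ∈ range n, cos (2 * ((j : ℝ) + 1) * θ + β)| ≤ (n : ℝ) ^ (1 - s) * sin θ ^ (-s) := by
  have hn' : (1 : ℝ) ≤ n := by exact_mod_cast hn
  have hn0 : (0 : ℝ) < n := by linarith
  set S := ∑ j ∈ range n, cos (2 * ((j : ℝ) + 1) * θ + β) with hS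
  have h1 : |S| ≤ n := by
    refine (Finset.abs_sum_le_sum_abs _ _).trans ?_
    refine (Finset.sum_le_sum fun j _ => abs_cos_le_one _).trans ?_
    simp
  have h2 : |S| ≤ (sin θ)⁻¹ := by
    have := dirichlet_tel θ β n
    rw [← hS] at this
    have e : |2 * sin θ * S| ≤ 2 := by
      rw [this]
      have a1 := abs_sin_le_one ((2 * n + 1) * θ + β)
      have a2 := abs_sin_le_one (θ + β)
      exact (abs_sub _ _).trans (by linarith)
    rw [abs_mul, abs_of_pos (by positivity : 0 < 2 * sin θ)] at e
    rw [← one_div, le_div_iff₀ h]; linarith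
  have e : |S| = |S| ^ (1 - s) * |S| ^ s := by
    rcases (abs_nonneg S).eq_or_lt with h0 | h0
    · rw [← h0, zero_rpow hs0.ne', mul_zero]
    · rw [← rpow_add h0]; simp
  rw [e]
  have g1 : |S| ^ (1 - s) ≤ (n : ℝ) ^ (1 - s) := rpow_le_rpow (abs_nonneg _) h1 (by linarith)
  have g2 : |S| ^ s ≤ sin θ ^ (-s) := by
    rw [rpow_neg h.le, ← inv_rpow h.le]
    exact rpow_le_rpow (abs_nonneg _) h2 hs0.le
  exact mul_le_mul g1 g2 (by positivity) (by positivity)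

noncomputable def mU (lam : ℝ) (n : ℕ) (θ : ℝ) : ℝ := ∑ j ∈ range (n + 1), U lam j θ

theorem mU_approx (lam : ℝ) (hlam : -(1 / 2) < lam) (hl0 : lam ≠ 0) (s : ℝ) (hs0 : 0 < s)
    (hs1 : s < 1) (hsl : -(2 * lam) ≤ s) :
    ∃ C : ℝ, 0 ≤ C ∧ ∀ n : ℕ, 1 ≤ n → ∀ θ ∈ Set.Ioo 0 π,
      |mU lam n θ - ((n : ℝ) + 1) / π| ≤ C * (n : ℝ) ^ (1 - s) * sin θ ^ (-s) := by
  obtain ⟨C, hC, h⟩ := U_approx lam hlam hl0 s hs0 hs1 hsl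
  have hk := kap_pos lam hlam
  refine ⟨kap lam * gamG lam 0 ^ 2 + 1 + C / (1 - s) + 1,
    by have : 0 < 1 - s := by linarith
       positivity, fun n hn θ hθ => ?_⟩
  have hs2 : 0 < 1 - s := by linarith
  have hsin := sin_pos_Ioo hθ
  have hn' : (1 : ℝ) ≤ n := by exact_mod_cast hn
  have hnp : 1 ≤ (n : ℝ) ^ (1 - s) := one_le_rpow hn' hs2.le
  have hq : 1 ≤ sin θ ^ (-s) :=
    one_le_rpow_of_pos_of_le_one_of_nonpos hsin (sin_le_one θ) (by linarith)
  have hpi := pi_gt_three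
  set β := 2 * lam * (θ - π / 2) with hβ
  set D := ∑ j ∈ range n, cos (2 * ((j : ℝ) + 1) * θ + β) with hD
  have e : mU lam n θ - ((n : ℝ) + 1) / π = (U lam 0 θ - 1 / π) +
      ∑ j ∈ range n, (U lam (j + 1) θ - 1 / π * Fr lam (j + 1) θ) + 1 / π * D := by
    unfold mU
    rw [Finset.sum_range_succ', Finset.sum_sub_distrib, ← Finset.mul_sum]
    have : ∑ j ∈ range n, Fr lam (j + 1) θ = n + D := by
      unfold Fr
      rw [Finset.sum_add_distrib, hD]
      simp [hβ]
    rw [this]; ring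
  set Q := (n : ℝ) ^ (1 - s) * sin θ ^ (-s) with hQ
  have hQ1 : sin θ ^ (-s) ≤ Q := le_mul_of_one_le_left (by positivity) hnp
  have t1 : |U lam 0 θ - 1 / π| ≤ (kap lam * gamG lam 0 ^ 2 + 1) * Q := by
    have u0 : U lam 0 θ = kap lam * gamG lam 0 ^ 2 * sin θ ^ (2 * lam) := by
      unfold U; rw [Geg_zero]; ring
    have u1 : sin θ ^ (2 * lam) ≤ sin θ ^ (-s) :=
      rpow_le_rpow_of_exponent_ge hsin (sin_le_one θ) (by linarith)
    have u2 : U lam 0 θ ≤ kap lam * gamG lam 0 ^ 2 * Q := by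
      rw [u0]; exact mul_le_mul_of_nonneg_left (u1.trans hQ1) (by positivity)
    have u3 : 0 ≤ U lam 0 θ := by rw [u0]; positivity
    have u4 : 1 / π ≤ 1 := by rw [div_le_one pi_pos]; linarith
    have u5 : 0 < 1 / π := by positivity
    have u6 : 0 ≤ kap lam * gamG lam 0 ^ 2 * Q := by positivity
    rw [abs_le]; constructor <;> linarith
  have t2 : |∑ j ∈ range n, (U lam (j + 1) θ - 1 / π * Fr lam (j + 1) θ)| ≤ C / (1 - s) * Q := by
    refine (Finset.abs_sum_le_sum_abs _ _).trans ?_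
    refine (Finset.sum_le_sum fun j _ => h (j + 1) (by omega) θ hθ).trans ?_
    rw [← Finset.mul_sum, ← Finset.sum_mul]
    have := sum_pow_le s hs0 hs1 n
    push_cast
    have h3 : ∑ j ∈ range n, ((j : ℝ) + 1) ^ (-s) ≤ (n : ℝ) ^ (1 - s) / (1 - s) := by
      rw [le_div_iff₀ hs2]; linarith
    calc _ ≤ C * ((n : ℝ) ^ (1 - s) / (1 - s) * sin θ ^ (-s)) := by gcongr
      _ = _ := by rw [hQ]; ring
  have t3 : |1 / π * D| ≤ Q := by
    have := dirichlet_bd s hs0 hs1 hsin β n hn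
    rw [← hD, ← hQ] at this
    rw [abs_mul, abs_of_pos (by positivity : 0 < 1 / π)]
    have u4 : 1 / π ≤ 1 := by rw [div_le_one pi_pos]; linarith
    nlinarith [abs_nonneg D]
  rw [e]
  refine (abs_add_le _ _).trans ((add_le_add_left (abs_add_le _ _) _).trans ?_)
  rw [mul_assoc, ← hQ]
  linarith

noncomputable def mu0 : Measure ℝ := volume.restrict (Set.Ioo 0 π)

instance mu0_finite : IsFiniteMeasure mu0 := by
  unfold mu0; infer_instance

noncomputable def Pk (r α : ℝ) : ℝ := -(1 / 2) * log (1 - 2 * r * cos α + r ^ 2)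

noncomputable def Lk (r θ φ : ℝ) : ℝ := Pk r (θ - φ) + Pk r (θ + φ)

theorem Pk_hasSum {r : ℝ} (h0 : 0 ≤ r) (h1 : r < 1) (α : ℝ) :
    HasSum (fun k : ℕ => r ^ k * cos (k * α) / k) (Pk r α) := by
  set z : ℂ := r * Complex.exp (α * Complex.I) with hz
  have hn : ‖z‖ < 1 := by
    rw [hz, norm_mul, Complex.norm_exp_ofReal_mul_I, mul_one, Complex.norm_real, Real.norm_eq_abs,
      abs_of_nonneg h0]
    exact h1
  have h := Complex.hasSum_re (Complex.hasSum_taylorSeries_neg_log hn)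
  have e1 : (-Complex.log (1 - z)).re = Pk r α := by
    rw [Complex.neg_re, Complex.log_re, Pk]
    have : ‖1 - z‖ ^ 2 = 1 - 2 * r * cos α + r ^ 2 := by
      rw [← Complex.normSq_eq_norm_sq, Complex.normSq_apply, hz]
      simp only [Complex.sub_re, Complex.one_re, Complex.re_ofReal_mul, Complex.exp_ofReal_mul_I_re,
        Complex.sub_im, Complex.one_im, Complex.im_ofReal_mul, Complex.exp_ofReal_mul_I_im]
      linear_combination r ^ 2 * sin_sq_add_cos_sq α
    rw [← this, log_pow]; push_cast; ring
  rw [e1] at h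
  convert h using 1
  funext k
  have : z ^ k = ((r ^ k : ℝ) : ℂ) * Complex.exp (((k * α : ℝ) : ℂ) * Complex.I) := by
    rw [hz, mul_pow, ← Complex.exp_nat_mul]; push_cast; ring_nf
  rw [this, show (k : ℂ) = ((k : ℝ) : ℂ) by push_cast; rfl, Complex.div_ofReal_re,
    Complex.re_ofReal_mul, Complex.exp_ofReal_mul_I_re]

theorem Lk_hasSum {r : ℝ} (h0 : 0 ≤ r) (h1 : r < 1) (θ φ : ℝ) :
    HasSum (fun k : ℕ => 2 * r ^ k / k * (cos (k * θ) * cos (k * φ))) (Lk r θ φ) := by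
  have h := (Pk_hasSum h0 h1 (θ - φ)).add (Pk_hasSum h0 h1 (θ + φ))
  have e : (fun k : ℕ => 2 * r ^ k / k * (cos (k * θ) * cos (k * φ))) = fun k : ℕ =>
      r ^ k * cos (k * (θ - φ)) / k + r ^ k * cos (k * (θ + φ)) / k := by
    funext k
    rw [mul_sub, mul_add, cos_sub, cos_add]; ring
  rw [e]
  exact h

theorem ae_good : ∀ᵐ p : ℝ × ℝ ∂(mu0.prod mu0),
    p.1 ∈ Set.Ioo 0 π ∧ p.2 ∈ Set.Ioo 0 π ∧ p.1 ≠ p.2 := by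
  have h1 : ∀ᵐ p : ℝ × ℝ ∂(mu0.prod mu0), p ∈ Set.Ioo 0 π ×ˢ Set.Ioo 0 π := by
    unfold mu0
    rw [Measure.prod_restrict]
    exact ae_restrict_mem (measurableSet_Ioo.prod measurableSet_Ioo)
  have h2 : ∀ᵐ p : ℝ × ℝ ∂(mu0.prod mu0), p.1 ≠ p.2 := by
    have hm : MeasurableSet {p : ℝ × ℝ | p.1 = p.2} :=
      measurableSet_eq_fun measurable_fst measurable_snd
    rw [ae_iff]
    have : {a : ℝ × ℝ | ¬a.1 ≠ a.2} = {p : ℝ × ℝ | p.1 = p.2} := by ext; simp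
    rw [this, Measure.measure_prod_null hm]
    refine Filter.Eventually.of_forall fun x => ?_
    have : Prod.mk x ⁻¹' {p : ℝ × ℝ | p.1 = p.2} = {x} := by ext y; simp [eq_comm]
    simp only [this, mu0]
    exact measure_singleton x
  filter_upwards [h1, h2] with p hp1 hp2
  exact ⟨hp1.1, hp1.2, hp2⟩

theorem y_lower {r θ φ : ℝ} (hr : 1 / 2 ≤ r) (hθ : θ ∈ Set.Ioo 0 π)
    (hφ : φ ∈ Set.Ioo 0 π) (α : ℝ) (hα : α = θ - φ ∨ α = θ + φ) :
    2 / π ^ 2 * (θ - φ) ^ 2 ≤ 1 - 2 * r * cos α + r ^ 2 := by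
  have h1 : cos (θ - φ) ≤ 1 - 2 / π ^ 2 * (θ - φ) ^ 2 :=
    cos_le_one_sub_mul_cos_sq (abs_le.2 ⟨by linarith [hθ.1, hφ.2], by linarith [hθ.2, hφ.1]⟩)
  have h2 : cos α ≤ cos (θ - φ) := by
    rcases hα with rfl | rfl
    · exact le_refl _
    · rw [cos_add, cos_sub]
      have := mul_pos (sin_pos_Ioo hθ) (sin_pos_Ioo hφ)
      linarith
  nlinarith [sq_nonneg (1 - r), cos_le_one α]

theorem log_bd {ε : ℝ} (he : 0 < ε) {y d : ℝ} (hd : 0 < d) (hy : 2 / π ^ 2 * d ^ 2 ≤ y)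
    (hy4 : y ≤ 4) :
    |log y| ≤ 2 * log 4 + (2 * π ^ 2) ^ (ε / 2) / (ε / 2) * d ^ (-ε) := by
  have hpi := pi_pos
  have hy0 : 0 < y := lt_of_lt_of_le (by positivity) hy
  have hl4 : 0 ≤ log 4 := log_nonneg (by norm_num)
  have h1 : log y ≤ log 4 := log_le_log hy0 hy4
  have h2 : log (4 / y) ≤ (4 / y) ^ (ε / 2) / (ε / 2) := log_le_rpow_div (by positivity) (by positivity)
  have h3 : 4 / y ≤ 2 * π ^ 2 * (d ^ 2)⁻¹ := by
    rw [div_le_iff₀ hy0]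
    have : 2 * π ^ 2 * (d ^ 2)⁻¹ * (2 / π ^ 2 * d ^ 2) = 4 := by field_simp; norm_num
    calc (4 : ℝ) = 2 * π ^ 2 * (d ^ 2)⁻¹ * (2 / π ^ 2 * d ^ 2) := this.symm
      _ ≤ _ := by gcongr
  have h4 : (4 / y) ^ (ε / 2) ≤ (2 * π ^ 2) ^ (ε / 2) * d ^ (-ε) := by
    refine (rpow_le_rpow (by positivity) h3 (by positivity)).trans (le_of_eq ?_)
    rw [mul_rpow (by positivity) (by positivity), inv_rpow (by positivity), ← rpow_natCast d 2,
      ← rpow_mul hd.le, ← rpow_neg hd.le]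
    congr 2; push_cast; ring
  have h5 : log (4 / y) ≤ (2 * π ^ 2) ^ (ε / 2) / (ε / 2) * d ^ (-ε) := by
    refine h2.trans ?_
    rw [div_mul_eq_mul_div]
    gcongr
  rw [log_div (by norm_num) hy0.ne'] at h5
  have h6 : 0 ≤ (2 * π ^ 2) ^ (ε / 2) / (ε / 2) * d ^ (-ε) := by positivity
  rw [abs_le]; constructor <;> linarith

theorem Lk_bd {ε : ℝ} (he : 0 < ε) : ∃ C : ℝ, 0 ≤ C ∧ ∀ r θ φ : ℝ, 1 / 2 ≤ r → r ≤ 1 →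
    θ ∈ Set.Ioo 0 π → φ ∈ Set.Ioo 0 π → θ ≠ φ → |Lk r θ φ| ≤ C * (1 + |θ - φ| ^ (-ε)) := by
  have hl4 : 0 ≤ log 4 := log_nonneg (by norm_num)
  set K := (2 * π ^ 2) ^ (ε / 2) / (ε / 2) with hK
  have hK0 : 0 ≤ K := by positivity
  refine ⟨2 * log 4 + K, by positivity, fun r θ φ hr hr1 hθ hφ hne => ?_⟩
  have hd : 0 < |θ - φ| := abs_pos.2 (sub_ne_zero.2 hne)
  have key : ∀ α, (α = θ - φ ∨ α = θ + φ) →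
      |Pk r α| ≤ (1 / 2) * (2 * log 4 + K * |θ - φ| ^ (-ε)) := by
    intro α hα
    have h1 := y_lower hr hθ hφ α hα
    rw [← sq_abs (θ - φ)] at h1
    have h2 : 1 - 2 * r * cos α + r ^ 2 ≤ 4 := by nlinarith [neg_one_le_cos α]
    have := log_bd he hd h1 h2
    rw [← hK] at this
    rw [Pk, abs_mul, abs_neg, abs_of_pos (by norm_num : (0 : ℝ) < 1 / 2)]
    linarith
  have a1 := key _ (Or.inl rfl)
  have a2 := key _ (Or.inr rfl)
  have hp : 0 ≤ |θ - φ| ^ (-ε) := by positivity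
  have := abs_add_le (Pk r (θ - φ)) (Pk r (θ + φ))
  unfold Lk
  nlinarith [mul_nonneg hl4 hp]

theorem pow_split {a b s ε : ℝ} (ha : 0 < a) (hb : 0 < b) (hs : 0 ≤ s) (he : 0 ≤ ε) :
    a ^ (-ε) * b ^ (-s) ≤ a ^ (-(s + ε)) + b ^ (-(s + ε)) := by
  have pa : 0 < a ^ (-(s + ε)) := rpow_pos_of_pos ha _
  have pb : 0 < b ^ (-(s + ε)) := rpow_pos_of_pos hb _
  rcases le_total a b with h | h
  · have h1 : b ^ (-s) ≤ a ^ (-s) := rpow_le_rpow_of_nonpos ha h (by linarith)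
    have h2 : a ^ (-ε) * a ^ (-s) = a ^ (-(s + ε)) := by rw [← rpow_add ha]; congr 1; ring
    have := mul_le_mul_of_nonneg_left h1 (rpow_pos_of_pos ha (-ε)).le
    linarith
  · have h1 : a ^ (-ε) ≤ b ^ (-ε) := rpow_le_rpow_of_nonpos hb h (by linarith)
    have h2 : b ^ (-ε) * b ^ (-s) = b ^ (-(s + ε)) := by rw [← rpow_add hb]; congr 1; ring
    have := mul_le_mul_of_nonneg_right h1 (rpow_pos_of_pos hb (-s)).le
    linarith

noncomputable def Gm (s ε : ℝ) (p : ℝ × ℝ) : ℝ :=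
  (1 + |p.1 - p.2| ^ (-ε)) * (sin p.1 ^ (-s) * sin p.2 ^ (-s))

theorem sin_int_mu0 {s : ℝ} (hs : s < 1) : Integrable (fun θ => sin θ ^ (-s)) mu0 :=
  sin_rpow_integrable (-s) (by linarith)

theorem conv_int {s t : ℝ} (hs : s < 1) (ht : t < 1) :
    Integrable (fun p : ℝ × ℝ => sin p.2 ^ (-s) * |p.1 - p.2| ^ (-t)) (mu0.prod mu0) := by
  set g : ℝ → ℝ := Set.indicator (Set.Ioc 0 π) (fun x => x ^ (-t)) with hg
  have ig : Integrable g volume := by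
    rw [hg, integrable_indicator_iff measurableSet_Ioc]
    have := intervalIntegral.intervalIntegrable_rpow' (a := 0) (b := π) (r := -t) (by linarith)
    exact (intervalIntegrable_iff_integrableOn_Ioc_of_le pi_pos.le).1 this
  set gg : ℝ → ℝ := fun x => g x + g (-x) with hgg
  have igg : Integrable gg volume := ig.add ig.comp_neg
  have h := Integrable.convolution_integrand (ContinuousLinearMap.mul ℝ ℝ)
    (sin_int_mu0 hs) igg (μ := volume)
  have h2 : Integrable (fun p : ℝ × ℝ => sin p.2 ^ (-s) * gg (p.1 - p.2)) (mu0.prod mu0) := by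
    have hle : mu0.prod mu0 ≤ (volume : Measure ℝ).prod mu0 := by
      have : mu0.prod mu0 = ((volume : Measure ℝ).prod mu0).restrict (Set.Ioo 0 π ×ˢ Set.univ) := by
        rw [← Measure.prod_restrict, Measure.restrict_univ]; rfl
      rw [this]; exact Measure.restrict_le_self
    exact h.mono_measure hle
  refine h2.congr ?_
  filter_upwards [ae_good] with p hp
  obtain ⟨h1, h3, h4⟩ := hp
  congr 1
  simp only [hgg, hg]
  rcases lt_or_gt_of_ne h4 with h5 | h5
  · rw [Set.indicator_of_notMem (by simp; intro h; linarith),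
      Set.indicator_of_mem (by constructor <;> linarith [h1.1, h3.2]), zero_add,
      abs_of_neg (by linarith)]
  · rw [Set.indicator_of_mem (by constructor <;> linarith [h1.2, h3.1]),
      Set.indicator_of_notMem (by simp; intro h; linarith), add_zero,
      abs_of_pos (by linarith)]

theorem Gm_int {s ε : ℝ} (hs0 : 0 ≤ s) (he : 0 ≤ ε) (hs : s + ε < 1) :
    Integrable (Gm s ε) (mu0.prod mu0) := by
  have h1 := (sin_int_mu0 (s := s) (by linarith)).mul_prod (sin_int_mu0 (s := s) (by linarith))
  have h2 := conv_int (s := s) (t := s + ε) (by linarith) hs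
  have h3 := (sin_int_mu0 hs).mul_prod (sin_int_mu0 (s := s) (by linarith))
  refine Integrable.mono' (h1.add (h2.add h3)) ?_ ?_
  · apply Measurable.aestronglyMeasurable
    unfold Gm
    exact (measurable_const.add (((measurable_fst.sub measurable_snd).abs).pow_const _)).mul
      (((measurable_sin.comp measurable_fst).pow_const _).mul
        ((measurable_sin.comp measurable_snd).pow_const _))
  · filter_upwards [ae_good] with p hp
    obtain ⟨h4, h5, h6⟩ := hp
    have hd : 0 < |p.1 - p.2| := abs_pos.2 (sub_ne_zero.2 h6)
    have s1 := sin_pos_Ioo h4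
    have s2 := sin_pos_Ioo h5
    have := mul_le_mul_of_nonneg_right (pow_split hd s1 hs0 he) (rpow_pos_of_pos s2 (-s)).le
    rw [Real.norm_eq_abs, abs_of_nonneg (by unfold Gm; positivity)]
    simp only [Gm, Pi.add_apply]
    linarith

noncomputable def En (r : ℝ) (f : ℝ → ℝ) : ℝ :=
  ∫ p : ℝ × ℝ, Lk r p.1 p.2 * (f p.1 * f p.2) ∂(mu0.prod mu0)

theorem Lk_meas (r : ℝ) : Measurable (fun p : ℝ × ℝ => Lk r p.1 p.2) := by
  unfold Lk Pk
  fun_prop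

theorem En_dom {s ε : ℝ} (he : 0 < ε) : ∃ C : ℝ, 0 ≤ C ∧
    ∀ (f : ℝ → ℝ) (D : ℝ), 0 ≤ D → (∀ θ ∈ Set.Ioo 0 π, |f θ| ≤ D * sin θ ^ (-s)) →
    ∀ r : ℝ, 1 / 2 ≤ r → r ≤ 1 → ∀ᵐ p : ℝ × ℝ ∂(mu0.prod mu0),
      ‖Lk r p.1 p.2 * (f p.1 * f p.2)‖ ≤ D ^ 2 * C * Gm s ε p := by
  obtain ⟨C, hC, h⟩ := Lk_bd he
  refine ⟨C, hC, fun f D hD hf r hr hr1 => ?_⟩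
  filter_upwards [ae_good] with p hp
  obtain ⟨h4, h5, h6⟩ := hp
  have s1 := sin_pos_Ioo h4
  have s2 := sin_pos_Ioo h5
  rw [norm_mul, norm_mul, Real.norm_eq_abs, Real.norm_eq_abs, Real.norm_eq_abs]
  have a1 := h r p.1 p.2 hr hr1 h4 h5 h6
  have a2 := hf p.1 h4
  have a3 := hf p.2 h5
  calc _ ≤ C * (1 + |p.1 - p.2| ^ (-ε)) * ((D * sin p.1 ^ (-s)) * (D * sin p.2 ^ (-s))) := by
        gcongr
    _ = _ := by unfold Gm; ring

theorem En_energy {s : ℝ} (hs0 : 0 ≤ s) (hs : s < 1) : ∃ B : ℝ, 0 ≤ B ∧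
    ∀ (f : ℝ → ℝ) (D : ℝ), Measurable f → 0 ≤ D → (∀ θ ∈ Set.Ioo 0 π, |f θ| ≤ D * sin θ ^ (-s)) →
    Integrable (fun p : ℝ × ℝ => Lk 1 p.1 p.2 * (f p.1 * f p.2)) (mu0.prod mu0) ∧
    |En 1 f| ≤ D ^ 2 * B ∧
    Filter.Tendsto (fun r => En r f) (nhdsWithin 1 (Set.Iio 1)) (nhds (En 1 f)) := by
  set ε := (1 - s) / 2 with hε
  have he : 0 < ε := by rw [hε]; linarith
  have hse : s + ε < 1 := by rw [hε]; linarith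
  have hG := Gm_int hs0 he.le hse
  obtain ⟨C, hC, h⟩ := En_dom (s := s) he
  refine ⟨C * |∫ p, Gm s ε p ∂(mu0.prod mu0)|, by positivity, fun f D hf hD hfD => ?_⟩
  have hm : ∀ r, AEStronglyMeasurable (fun p : ℝ × ℝ => Lk r p.1 p.2 * (f p.1 * f p.2))
      (mu0.prod mu0) := fun r => ((Lk_meas r).mul ((hf.comp measurable_fst).mul
        (hf.comp measurable_snd))).aestronglyMeasurable
  have hdom := h f D hD hfD
  refine ⟨Integrable.mono' (hG.const_mul _) (hm 1) (hdom 1 (by norm_num) le_rfl), ?_, ?_⟩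
  · have := norm_integral_le_of_norm_le (hG.const_mul (D ^ 2 * C)) (hdom 1 (by norm_num) le_rfl)
    rw [integral_const_mul, Real.norm_eq_abs] at this
    refine this.trans ?_
    rw [mul_assoc]
    gcongr
    exact le_abs_self _
  · apply tendsto_integral_filter_of_dominated_convergence (fun p => D ^ 2 * C * Gm s ε p)
    · exact Filter.Eventually.of_forall hm
    · have : Set.Ioo (1 / 2 : ℝ) 1 ∈ nhdsWithin (1 : ℝ) (Set.Iio 1) :=
        Ioo_mem_nhdsLT (by norm_num)
      filter_upwards [this] with r hr
      exact hdom r hr.1.le hr.2.le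
    · exact hG.const_mul _
    · filter_upwards [ae_good] with p hp
      obtain ⟨h4, h5, h6⟩ := hp
      apply Filter.Tendsto.mul_const
      have hne : ∀ α, (α = p.1 - p.2 ∨ α = p.1 + p.2) →
          Filter.Tendsto (fun r => Pk r α) (nhdsWithin 1 (Set.Iio 1)) (nhds (Pk 1 α)) := by
        intro α hα
        have h1 := y_lower (r := 1) (by norm_num) h4 h5 α hα
        have h2 : 0 < 2 / π ^ 2 * (p.1 - p.2) ^ 2 := by
          have := sq_pos_of_ne_zero (sub_ne_zero.2 h6)
          have := pi_pos
          positivity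
        have hc : ContinuousAt (fun r => Pk r α) 1 := by
          unfold Pk
          apply ContinuousAt.mul continuousAt_const
          exact ContinuousAt.log (by fun_prop) (by linarith)
        exact hc.tendsto.mono_left nhdsWithin_le_nhds
      exact (hne _ (Or.inl rfl)).add (hne _ (Or.inr rfl))

theorem En_series {r : ℝ} (h0 : 0 ≤ r) (h1 : r < 1) {f : ℝ → ℝ} (hf : Integrable f mu0) :
    HasSum (fun k : ℕ => 2 * r ^ k / k * (∫ θ, cos (k * θ) * f θ ∂mu0) ^ 2) (En r f) := by
  have hk : ∀ k : ℕ, Integrable (fun θ => cos (k * θ) * f θ) mu0 := fun k =>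
    hf.bdd_mul (c := 1) (by fun_prop)
      (Filter.Eventually.of_forall fun θ => by rw [Real.norm_eq_abs]; exact abs_cos_le_one _)
  set F : ℕ → ℝ × ℝ → ℝ := fun k p =>
    2 * r ^ k / k * ((cos (k * p.1) * f p.1) * (cos (k * p.2) * f p.2)) with hF
  have hFi : ∀ k, Integrable (F k) (mu0.prod mu0) := fun k => ((hk k).mul_prod (hk k)).const_mul _
  have hsum : Summable fun k => ∫ p, ‖F k p‖ ∂(mu0.prod mu0) := by
    set M := (∫ θ, |f θ| ∂mu0) with hM
    have hM0 : 0 ≤ M := integral_nonneg fun _ => abs_nonneg _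
    have hg : Summable fun k : ℕ => r ^ k * (2 * M ^ 2) :=
      (summable_geometric_of_lt_one h0 h1).mul_right _
    refine Summable.of_nonneg_of_le (fun k => integral_nonneg fun _ => norm_nonneg _)
      (fun k => ?_) hg
    have e : ∀ p, ‖F k p‖ = 2 * r ^ k / k * (|cos (k * p.1) * f p.1| * |cos (k * p.2) * f p.2|) := by
      intro p
      rw [hF]; simp only [Real.norm_eq_abs]
      rw [abs_mul, abs_mul (cos (k * p.1) * f p.1),
        abs_of_nonneg (by positivity : 0 ≤ 2 * r ^ k / (k : ℝ))]
    simp only [e]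
    rw [integral_const_mul, integral_prod_mul (fun θ => |cos (k * θ) * f θ|)
      (fun θ => |cos (k * θ) * f θ|)]
    have hle : ∫ θ, |cos (k * θ) * f θ| ∂mu0 ≤ M := by
      apply integral_mono (hk k).abs hf.abs
      intro θ
      simp only
      rw [abs_mul]
      exact mul_le_of_le_one_left (abs_nonneg _) (abs_cos_le_one _)
    have hge : 0 ≤ ∫ θ, |cos (k * θ) * f θ| ∂mu0 := integral_nonneg fun _ => abs_nonneg _
    have hkk : 2 * r ^ k / (k : ℝ) ≤ 2 * r ^ k := by
      rcases Nat.eq_zero_or_pos k with rfl | hkp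
      · simp
      · exact div_le_self (by positivity) (by exact_mod_cast hkp)
    calc _ ≤ 2 * r ^ k * (M * M) := by gcongr
      _ = _ := by ring
  have := hasSum_integral_of_summable_integral_norm hFi hsum
  have e1 : ∀ k : ℕ, ∫ p, F k p ∂(mu0.prod mu0) =
      2 * r ^ k / k * (∫ θ, cos (k * θ) * f θ ∂mu0) ^ 2 := by
    intro k
    rw [hF]
    simp only
    rw [integral_const_mul, integral_prod_mul (fun θ => cos (k * θ) * f θ)
      (fun θ => cos (k * θ) * f θ), sq]
  have e2 : ∫ p, ∑' k, F k p ∂(mu0.prod mu0) = En r f := by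
    unfold En
    congr 1
    funext p
    have h := (Lk_hasSum h0 h1 p.1 p.2).mul_right (f p.1 * f p.2)
    rw [← h.tsum_eq]
    congr 1
    funext k
    rw [hF]; simp only; ring
  rw [e2] at this
  simp only [e1] at this
  exact this

theorem En_nonneg {f : ℝ → ℝ} (hf : Integrable f mu0)
    (ht : Filter.Tendsto (fun r => En r f) (nhdsWithin 1 (Set.Iio 1)) (nhds (En 1 f))) :
    0 ≤ En 1 f := by
  apply ge_of_tendsto ht
  have : Set.Ioo (0 : ℝ) 1 ∈ nhdsWithin (1 : ℝ) (Set.Iio 1) := Ioo_mem_nhdsLT (by norm_num)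
  filter_upwards [this] with r hr
  have h := En_series hr.1.le hr.2 hf
  have h0 := hr.1
  exact h.nonneg fun k => by positivity

theorem En_congr {f g : ℝ → ℝ} (hf : Integrable f mu0) (hg : Integrable g mu0)
    (hfg : ∀ k : ℕ, 1 ≤ k → ∫ θ, cos (k * θ) * f θ ∂mu0 = ∫ θ, cos (k * θ) * g θ ∂mu0)
    (h1 : Filter.Tendsto (fun r => En r f) (nhdsWithin 1 (Set.Iio 1)) (nhds (En 1 f)))
    (h2 : Filter.Tendsto (fun r => En r g) (nhdsWithin 1 (Set.Iio 1)) (nhds (En 1 g))) :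
    En 1 f = En 1 g := by
  refine tendsto_nhds_unique h1 (h2.congr' ?_)
  have : Set.Ioo (0 : ℝ) 1 ∈ nhdsWithin (1 : ℝ) (Set.Iio 1) := Ioo_mem_nhdsLT (by norm_num)
  filter_upwards [this] with r hr
  refine (En_series hr.1.le hr.2 hg).unique ?_
  convert En_series hr.1.le hr.2 hf using 1
  funext k
  rcases Nat.eq_zero_or_pos k with rfl | hkp
  · simp
  · rw [hfg k hkp]

theorem mU_eq (lam : ℝ) (n : ℕ) {θ : ℝ} (h : 0 < sin θ) :
    sin θ * (KG lam n (cos θ) (cos θ) * wG lam (cos θ)) = mU lam n θ := by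
  unfold KG wG mU U GegHat
  have := sin_weight h lam
  rw [Finset.sum_mul, Finset.mul_sum]
  refine Finset.sum_congr rfl fun j _ => ?_
  rw [← this]
  unfold kap
  ring

theorem mU_meas (lam : ℝ) (n : ℕ) : Measurable (mU lam n) := by
  unfold mU
  exact Finset.measurable_fun_sum _ fun j _ => U_measurable lam j

theorem mU_int (lam : ℝ) (hlam : -(1 / 2) < lam) (n : ℕ) : Integrable (mU lam n) mu0 := by
  unfold mU
  exact integrable_finsetSum _ fun j _ => U_integrable lam hlam j

theorem mU_integral (lam : ℝ) (hlam : -(1 / 2) < lam) (hl0 : lam ≠ 0) (n : ℕ) :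
    ∫ θ, mU lam n θ ∂mu0 = (n : ℝ) + 1 := by
  unfold mU
  rw [integral_finsetSum (μ := mu0) _ fun j _ => U_integrable lam hlam j]
  have : ∀ j ∈ range (n + 1), ∫ θ, U lam j θ ∂mu0 = 1 := fun j _ => U_integral lam hlam hl0 j
  rw [Finset.sum_congr rfl this]; simp

theorem Lk_one {θ φ : ℝ} (hθ : θ ∈ Set.Ioo 0 π) (hφ : φ ∈ Set.Ioo 0 π) (hne : θ ≠ φ) :
    log (1 / |cos θ - cos φ|) = log 2 + Lk 1 θ φ := by
  have h2 : 0 < 2 / π ^ 2 * (θ - φ) ^ 2 := by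
    have := sq_pos_of_ne_zero (sub_ne_zero.2 hne)
    have := pi_pos
    positivity
  have y1 := y_lower (r := 1) (by norm_num) hθ hφ _ (Or.inl rfl)
  have y2 := y_lower (r := 1) (by norm_num) hθ hφ _ (Or.inr rfl)
  have e : (1 - 2 * 1 * cos (θ - φ) + 1 ^ 2) * (1 - 2 * 1 * cos (θ + φ) + 1 ^ 2) =
      (2 * |cos θ - cos φ|) ^ 2 := by
    rw [mul_pow, sq_abs, cos_sub, cos_add]
    have s1 := sin_sq_add_cos_sq θ
    have s2 := sin_sq_add_cos_sq φ
    have s1' : sin θ ^ 2 = 1 - cos θ ^ 2 := by linarith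
    have s2' : sin φ ^ 2 = 1 - cos φ ^ 2 := by linarith
    have : sin θ ^ 2 * sin φ ^ 2 = (1 - cos θ ^ 2) * (1 - cos φ ^ 2) := by rw [s1', s2']
    linear_combination (-4) * this
  have hc : |cos θ - cos φ| ≠ 0 := by
    intro h0
    rw [h0] at e
    have := mul_pos (lt_of_lt_of_le h2 y1) (lt_of_lt_of_le h2 y2)
    rw [e] at this
    simp at this
  have hl : Lk 1 θ φ = -(log 2 + log |cos θ - cos φ|) := by
    rw [Lk, Pk, Pk, ← mul_add, ← log_mul (lt_of_lt_of_le h2 y1).ne' (lt_of_lt_of_le h2 y2).ne', e,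
      log_pow, log_mul (by norm_num) hc]
    push_cast; ring
  rw [hl, one_div, log_inv]; ring

theorem L1_eq (lam : ℝ) (hlam : -(1 / 2) < lam) (hl0 : lam ≠ 0) (n : ℕ)
    (hi : Integrable (fun p : ℝ × ℝ => Lk 1 p.1 p.2 * (mU lam n p.1 * mU lam n p.2))
      (mu0.prod mu0)) :
    L1 lam n = ((n : ℝ) + 1) ^ 2 * log 2 + En 1 (mU lam n) := by
  have h1 : L1 lam n = ∫ θ, ∫ φ, log (1 / |cos θ - cos φ|) * (mU lam n θ * mU lam n φ) ∂mu0 ∂mu0 := by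
    unfold L1
    rw [integral_cos_subst]
    unfold mu0
    refine setIntegral_congr_fun measurableSet_Ioo fun θ hθ => ?_
    rw [integral_cos_subst, ← integral_const_mul]
    refine setIntegral_congr_fun measurableSet_Ioo fun φ hφ => ?_
    rw [← mU_eq lam n (sin_pos_Ioo hθ), ← mU_eq lam n (sin_pos_Ioo hφ)]
    ring
  have hm := (mU_int lam hlam n).mul_prod (mU_int lam hlam n)
  have hae : (fun p : ℝ × ℝ => log (1 / |cos p.1 - cos p.2|) * (mU lam n p.1 * mU lam n p.2))
      =ᵐ[mu0.prod mu0] fun p => log 2 * (mU lam n p.1 * mU lam n p.2) +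
        Lk 1 p.1 p.2 * (mU lam n p.1 * mU lam n p.2) := by
    filter_upwards [ae_good] with p hp
    rw [Lk_one hp.1 hp.2.1 hp.2.2]; ring
  have hIntg := ((hm.const_mul (log 2)).add hi).congr hae.symm
  rw [h1, ← integral_prod _ hIntg, integral_congr_ae hae,
    integral_add (hm.const_mul (log 2)) hi, integral_const_mul,
    integral_prod_mul (mU lam n) (mU lam n), mU_integral lam hlam hl0, En]
  ring

theorem cos_int_zero (k : ℕ) (hk : 1 ≤ k) : ∫ θ, cos (k * θ) ∂mu0 = 0 := by
  have hk0 : (k : ℝ) ≠ 0 := by positivity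
  unfold mu0
  rw [← integral_Ioc_eq_integral_Ioo, ← intervalIntegral.integral_of_le pi_pos.le,
    intervalIntegral.integral_comp_mul_left (fun x => cos x) hk0, integral_cos]
  simp

theorem L1_main (lam : ℝ) (hlam : -(1 / 2) < lam) (hl0 : lam ≠ 0) (s : ℝ) (hs0 : 0 < s)
    (hs1 : s < 1) (hsl : -(2 * lam) ≤ s) :
    ∃ C : ℝ, 0 ≤ C ∧ ∀ n : ℕ, 1 ≤ n → 0 ≤ L1 lam n - ((n : ℝ) + 1) ^ 2 * log 2 ∧
      L1 lam n - ((n : ℝ) + 1) ^ 2 * log 2 ≤ C * ((n : ℝ) ^ (1 - s)) ^ 2 := by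
  obtain ⟨C, hC, h⟩ := mU_approx lam hlam hl0 s hs0 hs1 hsl
  obtain ⟨B, hB, hE⟩ := En_energy hs0.le hs1
  refine ⟨C ^ 2 * B, by positivity, fun n hn => ?_⟩
  have hpi := pi_pos
  have hq : ∀ θ ∈ Set.Ioo 0 π, 1 ≤ sin θ ^ (-s) := fun θ hθ =>
    one_le_rpow_of_pos_of_le_one_of_nonpos (sin_pos_Ioo hθ) (sin_le_one θ) (by linarith)
  have hm := mU_int lam hlam n
  obtain ⟨i1, -, t1⟩ := hE (mU lam n) (C * (n : ℝ) ^ (1 - s) + (n + 1) / π) (mU_meas lam n)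
    (by positivity) (fun θ hθ => by
      have a1 := h n hn θ hθ
      have a2 : ((n : ℝ) + 1) / π ≤ (n + 1) / π * sin θ ^ (-s) :=
        le_mul_of_one_le_right (by positivity) (hq θ hθ)
      have a3 : |mU lam n θ| ≤ |mU lam n θ - (n + 1) / π| + (n + 1) / π := by
        have := abs_add_le (mU lam n θ - (n + 1) / π) ((n + 1) / π)
        rw [sub_add_cancel, abs_of_nonneg (by positivity : 0 ≤ ((n : ℝ) + 1) / π)] at this
        exact this
      rw [add_mul]
      linarith)
  obtain ⟨-, b2, t2⟩ := hE (fun θ => mU lam n θ - (n + 1) / π) (C * (n : ℝ) ^ (1 - s))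
    ((mU_meas lam n).sub_const _) (by positivity) (h n hn)
  have hv : Integrable (fun θ => mU lam n θ - ((n : ℝ) + 1) / π) mu0 :=
    hm.sub (integrable_const _)
  have hcongr : En 1 (mU lam n) = En 1 (fun θ => mU lam n θ - (n + 1) / π) := by
    refine En_congr hm hv (fun k hk => ?_) t1 t2
    have hkc : Integrable (fun θ => cos (k * θ) * mU lam n θ) mu0 :=
      hm.bdd_mul (c := 1) (by fun_prop)
        (Filter.Eventually.of_forall fun θ => by rw [Real.norm_eq_abs]; exact abs_cos_le_one _)
    have hc : Integrable (fun θ : ℝ => cos (k * θ) * (((n : ℝ) + 1) / π)) mu0 :=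
      (integrable_const (((n : ℝ) + 1) / π)).bdd_mul (c := 1) (by fun_prop)
        (Filter.Eventually.of_forall fun θ => by rw [Real.norm_eq_abs]; exact abs_cos_le_one _)
    simp only [mul_sub]
    rw [integral_sub hkc hc, integral_mul_const, cos_int_zero k hk]
    ring
  have hL := L1_eq lam hlam hl0 n i1
  have e : L1 lam n - ((n : ℝ) + 1) ^ 2 * log 2 = En 1 (mU lam n) := by rw [hL]; ring
  rw [e]
  refine ⟨En_nonneg hm t1, ?_⟩
  rw [hcongr]
  refine (le_abs_self _).trans (b2.trans (le_of_eq ?_))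
  ring

theorem gegenbauer_L1_asymptotics
    (lam : ℝ) (hlam : -(1 / 2) < lam) (hlam0 : lam ≠ 0) :
    (∀ n : ℕ, 2 ≤ n → ((n : ℝ) + 1) ^ 2 * Real.log 2 ≤ L1 lam n) ∧
    Filter.Tendsto
      (fun n : ℕ => (L1 lam n - ((n : ℝ) + 1) ^ 2 * Real.log 2) / (n : ℝ))
      Filter.atTop (nhds 0) := by
  set s := max (-(2 * lam)) (3 / 4) with hs
  have hs34 : 3 / 4 ≤ s := le_max_right _ _
  have hs1 : s < 1 := max_lt (by linarith) (by norm_num)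
  obtain ⟨C, hC, h⟩ := L1_main lam hlam hlam0 s (by linarith) hs1 (le_max_left _ _)
  refine ⟨fun n hn => by linarith [(h n (by omega)).1], ?_⟩
  have ht : Filter.Tendsto (fun n : ℕ => C * (n : ℝ) ^ (-(1 / 2 : ℝ))) Filter.atTop
      (nhds (C * 0)) :=
    ((tendsto_rpow_neg_atTop (by norm_num)).comp tendsto_natCast_atTop_atTop).const_mul C
  rw [mul_zero] at ht
  refine tendsto_of_tendsto_of_tendsto_of_le_of_le' tendsto_const_nhds ht ?_ ?_
  · filter_upwards [Filter.eventually_ge_atTop 1] with n hn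
    exact div_nonneg (h n hn).1 n.cast_nonneg
  · filter_upwards [Filter.eventually_ge_atTop 1] with n hn
    have hn' : (1 : ℝ) ≤ n := by exact_mod_cast hn
    have hn0 : (0 : ℝ) < n := by linarith
    rw [div_le_iff₀ hn0]
    refine (h n hn).2.trans ?_
    have e1 : ((n : ℝ) ^ (1 - s)) ^ 2 = (n : ℝ) ^ ((1 - s) * 2) := by
      rw [rpow_mul hn0.le]; norm_cast
    have e2 : (n : ℝ) ^ (-(1 / 2 : ℝ)) * n = (n : ℝ) ^ (1 / 2 : ℝ) := by
      rw [← rpow_add_one hn0.ne']; congr 1; norm_num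
    rw [mul_assoc, e2, e1]
    exact mul_le_mul_of_nonneg_left (rpow_le_rpow_of_exponent_le hn' (by linarith)) hC
end

section
/- Fix λ ∈ (-1/2, ∞), λ ≠ 0. There exists a constant Q(λ) > 0, depending only on λ, such that for every integer n ≥ 2 and every x ∈ (-1,1): | K_n^λ(x,x)·w^λ(x) - (n+1)/(π·√(1-x²)) | ≤ Q(λ)·log(n) / (1-x²). -/
open Real MeasureTheory Finset

namespace GegAux

noncomputable def dG (lam : ℝ) : ℕ → ℝ → ℝ
  | 0, _ => 0
  | 1, _ => 2 * lam
  | (n + 2), x =>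
      (2 * ((n : ℝ) + 1 + lam) * (Geg lam (n + 1) x + x * dG lam (n + 1) x)
        - ((n : ℝ) + 2 * lam) * dG lam n x) / ((n : ℝ) + 2)

lemma geg_rec (lam : ℝ) (n : ℕ) (x : ℝ) :
    ((n : ℝ) + 2) * Geg lam (n + 2) x = 2 * ((n : ℝ) + 1 + lam) * x * Geg lam (n + 1) x
        - ((n : ℝ) + 2 * lam) * Geg lam n x := by
  have : ((n : ℝ) + 2) ≠ 0 := by positivity
  rw [Geg]; field_simp

lemma dG_rec (lam : ℝ) (n : ℕ) (x : ℝ) :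
    ((n : ℝ) + 2) * dG lam (n + 2) x =
      2 * ((n : ℝ) + 1 + lam) * (Geg lam (n + 1) x + x * dG lam (n + 1) x)
        - ((n : ℝ) + 2 * lam) * dG lam n x := by
  have : ((n : ℝ) + 2) ≠ 0 := by positivity
  rw [dG]; field_simp

lemma hasDeriv_pair (lam : ℝ) (n : ℕ) (x : ℝ) :
    HasDerivAt (Geg lam n) (dG lam n x) x ∧
    HasDerivAt (Geg lam (n + 1)) (dG lam (n + 1) x) x := by
  induction n with
  | zero =>
    constructor
    · have h : Geg lam 0 = fun _ => 1 := by funext y; simp [Geg]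
      rw [h, dG]; exact hasDerivAt_const _ _
    · have h : Geg lam (0 + 1) = fun y => 2 * lam * y := by funext y; simp [Geg]
      rw [h, zero_add, dG]; simpa using (hasDerivAt_id x).const_mul (2 * lam)
  | succ n ih =>
    refine ⟨ih.2, ?_⟩
    have h : Geg lam (n + 1 + 1) = fun y => (2 * ((n : ℝ) + 1 + lam) * y * Geg lam (n + 1) y
        - ((n : ℝ) + 2 * lam) * Geg lam n y) / ((n : ℝ) + 2) := by
      funext y; rw [Geg]
    rw [h, dG]
    have h1 := ((((hasDerivAt_id x).const_mul (2 * ((n : ℝ) + 1 + lam))).mul ih.2).sub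
      (ih.1.const_mul ((n : ℝ) + 2 * lam))).div_const ((n : ℝ) + 2)
    refine h1.congr_deriv ?_
    simp only [id]
    ring

lemma hasDeriv (lam : ℝ) (n : ℕ) (x : ℝ) : HasDerivAt (Geg lam n) (dG lam n x) x :=
  (hasDeriv_pair lam n x).1

lemma rel_pair (lam : ℝ) (n : ℕ) (x : ℝ) :
    (1 - x ^ 2) * dG lam n x = ((n : ℝ) + 2 * lam) * x * Geg lam n x
      - ((n : ℝ) + 1) * Geg lam (n + 1) x ∧
    (1 - x ^ 2) * dG lam (n + 1) x = - ((n : ℝ) + 1) * x * Geg lam (n + 1) x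
      + ((n : ℝ) + 2 * lam) * Geg lam n x := by
  induction n with
  | zero => simp [dG, Geg]; ring
  | succ n ih =>
    have hn : ((n : ℝ) + 2) ≠ 0 := by positivity
    have r := geg_rec lam n x
    have d := dG_rec lam n x
    obtain ⟨h1, h2⟩ := ih
    have hA : (1 - x ^ 2) * dG lam (n + 1) x = ((n : ℝ) + 1 + 2 * lam) * x * Geg lam (n + 1) x
      - ((n : ℝ) + 2) * Geg lam (n + 2) x := by
      rw [h2, r]; ring
    constructor
    · push_cast; rw [show n + 1 + 1 = n + 2 from rfl, hA]; ring
    · push_cast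
      rw [show n + 1 + 1 = n + 2 from rfl]
      apply mul_left_cancel₀ hn
      linear_combination (1 - x ^ 2) * d + 2 * ((n : ℝ) + 1 + lam) * x * h2
        - ((n : ℝ) + 2 * lam) * h1 + ((n:ℝ)+2) * x * r

/-- `q = s P' - λ x P`. -/
noncomputable def qG (lam : ℝ) (n : ℕ) (x : ℝ) : ℝ :=
  ((n : ℝ) + lam) * (x * Geg lam n x) - ((n : ℝ) + 1) * Geg lam (n + 1) x

lemma dG_q (lam : ℝ) (n : ℕ) (x : ℝ) :
    (1 - x ^ 2) * dG lam n x = qG lam n x + lam * x * Geg lam n x := by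
  rw [(rel_pair lam n x).1, qG]; ring

lemma q_deriv (lam : ℝ) (n : ℕ) (x : ℝ) (hs : 0 < 1 - x ^ 2) :
    HasDerivAt (qG lam n) (((lam - 1) * x * qG lam n x
      - ((n : ℝ) + lam) ^ 2 * (1 - x ^ 2) * Geg lam n x
      - lam * (1 - lam) * Geg lam n x) / (1 - x ^ 2)) x := by
  have h := (((hasDerivAt_id x).mul (hasDeriv lam n x)).const_mul ((n : ℝ) + lam)).sub
    ((hasDeriv lam (n + 1) x).const_mul ((n : ℝ) + 1))
  refine h.congr_deriv ?_
  rw [eq_div_iff hs.ne']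
  obtain ⟨h1, h2⟩ := rel_pair lam n x
  simp only [id, qG]
  linear_combination ((n : ℝ) + lam) * x * h1 - ((n : ℝ) + 1) * h2

lemma poch_pos (lam : ℝ) (hlam : -(1 / 2) < lam) (hlam0 : lam ≠ 0) (n : ℕ) :
    0 < (ascPochhammer ℝ (n + 1)).eval (2 * lam) / lam := by
  induction n with
  | zero => simp [ascPochhammer_one]; rw [mul_div_cancel_right₀ _ hlam0]; norm_num
  | succ n ih =>
    rw [ascPochhammer_succ_eval, mul_div_right_comm]
    apply mul_pos ih
    push_cast; have : (0:ℝ) ≤ n := by positivity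
    linarith

noncomputable def TG (lam : ℝ) (n : ℕ) : ℝ :=
  (n.factorial : ℝ) / (lam * (ascPochhammer ℝ n).eval (2 * lam))

lemma poch_ne (lam : ℝ) (hlam : -(1 / 2) < lam) (hlam0 : lam ≠ 0) (n : ℕ) :
    (ascPochhammer ℝ n).eval (2 * lam) ≠ 0 := by
  cases n with
  | zero => simp
  | succ n =>
    intro h
    have := poch_pos lam hlam hlam0 n
    rw [h] at this; simp at this

lemma nl_ne (lam : ℝ) (hlam : -(1 / 2) < lam) (hlam0 : lam ≠ 0) (n : ℕ) :
    (n : ℝ) + 2 * lam ≠ 0 := by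
  cases n with
  | zero => simpa using hlam0
  | succ n =>
    push_cast; have : (0:ℝ) ≤ n := by positivity
    intro h; linarith

lemma T_succ (lam : ℝ) (hlam : -(1 / 2) < lam) (hlam0 : lam ≠ 0) (n : ℕ) :
    TG lam (n + 1) * ((n : ℝ) + 2 * lam) = TG lam n * ((n : ℝ) + 1) := by
  have h1 := poch_ne lam hlam hlam0 n
  have h2 := nl_ne lam hlam hlam0 n
  have h3 : 2 * lam + (n:ℝ) ≠ 0 := by rwa [add_comm]
  simp only [TG]
  rw [ascPochhammer_succ_eval, Nat.factorial_succ]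
  push_cast
  generalize (ascPochhammer ℝ n).eval (2 * lam) = p at *
  rw [div_mul_eq_mul_div, div_mul_eq_mul_div, div_eq_div_iff (by positivity) (by positivity)]
  ring

lemma T_pos (lam : ℝ) (hlam : -(1 / 2) < lam) (hlam0 : lam ≠ 0) (n : ℕ) :
    0 < TG lam (n + 1) := by
  have h1 := poch_pos lam hlam hlam0 n
  have : TG lam (n+1) = ((n+1).factorial : ℝ) /
     (lam ^ 2 * ((ascPochhammer ℝ (n + 1)).eval (2 * lam) / lam)) := by
    rw [TG]; congr 1; field_simp
  rw [this]; positivity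

lemma gam_sq (lam : ℝ) (hlam : -(1 / 2) < lam) (hlam0 : lam ≠ 0) (n : ℕ) :
    gamG lam n * gamG lam n = TG lam n * ((n : ℝ) + lam) := by
  have e : (n.factorial : ℝ) * ((n : ℝ) + lam) /
    (lam * (ascPochhammer ℝ n).eval (2 * lam)) = TG lam n * ((n : ℝ) + lam) := by
    rw [TG]; ring
  rw [gamG, e, Real.mul_self_sqrt]
  cases n with
  | zero => simp [TG, hlam0]
  | succ n =>
    have := T_pos lam hlam hlam0 n
    have h0 : (0:ℝ) ≤ n := by positivity
    apply mul_nonneg this.le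
    push_cast; linarith

lemma K_form (lam : ℝ) (hlam : -(1 / 2) < lam) (hlam0 : lam ≠ 0) (n : ℕ) (x : ℝ)
    (hs : 0 < 1 - x ^ 2) :
    KG lam n x x = TG lam n / 2 * (((n : ℝ) + 1) * ((n : ℝ) + 2 * lam) * Geg lam n x ^ 2
      + (1 - 2 * lam) * x * Geg lam n x * dG lam n x + (1 - x ^ 2) * dG lam n x ^ 2) := by
  induction n with
  | zero =>
    have h := gam_sq lam hlam hlam0 0
    simp [KG, GegHat, Geg, dG, h]
    simp [TG]; field_simp
  | succ n ih =>
    have hK : KG lam (n + 1) x x = KG lam n x x + GegHat lam (n + 1) x * GegHat lam (n + 1) x := by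
      rw [KG, Finset.sum_range_succ, KG]
    have hg := gam_sq lam hlam hlam0 (n + 1)
    have hG : GegHat lam (n + 1) x * GegHat lam (n + 1) x =
      TG lam (n + 1) * ((n : ℝ) + 1 + lam) * Geg lam (n + 1) x ^ 2 := by
      rw [GegHat]; push_cast at hg; linear_combination (Geg lam (n + 1) x) ^ 2 * hg
    have hT := T_succ lam hlam hlam0 n
    have hn : ((n:ℝ) + 1) ≠ 0 := by positivity
    have hT' : TG lam n = TG lam (n + 1) * ((n : ℝ) + 2 * lam) / ((n : ℝ) + 1) := by
      rw [hT]; field_simp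
    rw [hK, ih, hG, hT']
    obtain ⟨h1, h2⟩ := rel_pair lam n x
    have h1' : dG lam n x = (((n : ℝ) + 2 * lam) * x * Geg lam n x
      - ((n : ℝ) + 1) * Geg lam (n + 1) x) / (1 - x ^ 2) := by
      rw [← h1]; field_simp
    have h2' : dG lam (n + 1) x = (- ((n : ℝ) + 1) * x * Geg lam (n + 1) x
      + ((n : ℝ) + 2 * lam) * Geg lam n x) / (1 - x ^ 2) := by
      rw [← h2]; field_simp
    rw [h1', h2']
    push_cast
    have hs' := hs.ne'
    field_simp
    ring

lemma K_mono (lam : ℝ) {m n : ℕ} (h : m ≤ n) (x : ℝ) : KG lam m x x ≤ KG lam n x x := by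
  apply Finset.sum_le_sum_of_subset_of_nonneg
  · intro i; simp; omega
  · intro i _ _; exact mul_self_nonneg _

lemma K_nonneg (lam : ℝ) (n : ℕ) (x : ℝ) : 0 ≤ KG lam n x x :=
  Finset.sum_nonneg fun _ _ => mul_self_nonneg _

/-- reduced energy -/
noncomputable def eG (lam : ℝ) (n : ℕ) (x : ℝ) : ℝ :=
  qG lam n x ^ 2 / (1 - x ^ 2) + ((n : ℝ) + lam) ^ 2 * Geg lam n x ^ 2

noncomputable def EG (lam : ℝ) (n : ℕ) (x : ℝ) : ℝ :=
  (1 - x ^ 2) ^ lam * eG lam n x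

lemma s_deriv (x : ℝ) : HasDerivAt (fun y : ℝ => 1 - y ^ 2) (-(2 * x)) x := by
  simpa using ((hasDerivAt_id x).pow 2).const_sub 1

lemma E_deriv (lam : ℝ) (n : ℕ) (x : ℝ) (hs : 0 < 1 - x ^ 2) :
    HasDerivAt (EG lam n) ((1 - x ^ 2) ^ lam *
      (-(2 * lam * (1 - lam) * Geg lam n x * qG lam n x) / (1 - x ^ 2) ^ 2)) x := by
  have h1 := (s_deriv x).rpow_const (p := lam) (Or.inl hs.ne')
  have hq := q_deriv lam n x hs
  have hg := hasDeriv lam n x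
  have h := h1.mul (((hq.pow 2).div (s_deriv x) hs.ne').add
    ((hg.pow 2).const_mul (((n : ℝ) + lam) ^ 2)))
  refine h.congr_deriv ?_
  have hd : dG lam n x = (qG lam n x + lam * x * Geg lam n x) / (1 - x ^ 2) := by
    rw [← dG_q]; field_simp
  rw [Real.rpow_sub_one hs.ne', hd]
  have hs' := hs.ne'
  simp only [Pi.add_apply, Pi.div_apply, Pi.pow_apply]
  generalize (1 - x ^ 2) ^ lam = R
  field_simp
  ring

lemma t_deriv (x : ℝ) (hs : 0 < 1 - x ^ 2) :
    HasDerivAt (fun y : ℝ => y / √(1 - y ^ 2)) (1 / ((1 - x ^ 2) * √(1 - x ^ 2))) x := by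
  have hq := Real.sqrt_pos.2 hs
  have h := (hasDerivAt_id x).div ((s_deriv x).sqrt hs.ne') hq.ne'
  refine h.congr_deriv ?_
  have e := Real.sq_sqrt hs.le
  simp only [id]
  rw [e]
  field_simp
  rw [e]; ring

lemma e_bounds (lam : ℝ) (n : ℕ) (x : ℝ) (hs : 0 < 1 - x ^ 2) (hN : 0 < (n : ℝ) + lam) :
    2 * ((n : ℝ) + lam) * |Geg lam n x * qG lam n x| ≤ √(1 - x ^ 2) * eG lam n x ∧
    ((n : ℝ) + lam) ^ 2 * Geg lam n x ^ 2 ≤ eG lam n x := by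
  have e := Real.sq_sqrt hs.le
  have hq := Real.sqrt_pos.2 hs
  rw [eG]
  constructor
  · set r := √(1 - x ^ 2)
    rw [← e]
    have : r * (qG lam n x ^ 2 / r ^ 2 + ((n : ℝ) + lam) ^ 2 * Geg lam n x ^ 2)
      = (qG lam n x ^ 2 + (((n : ℝ) + lam) * Geg lam n x * r) ^ 2) / r := by
      field_simp
    rw [this, le_div_iff₀ hq, abs_mul]
    have h := sq_nonneg (|qG lam n x| - ((n : ℝ) + lam) * |Geg lam n x| * r)
    have h1 := sq_abs (qG lam n x)
    have h2 := sq_abs (Geg lam n x)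
    rw [mul_pow, mul_pow, ← h1, ← h2]
    nlinarith
  · have : 0 ≤ qG lam n x ^ 2 / (1 - x ^ 2) := by positivity
    linarith

lemma s_pos {x : ℝ} (hx : x ∈ Set.Ioo (-1 : ℝ) 1) : 0 < 1 - x ^ 2 := by
  nlinarith [hx.1, hx.2]

lemma E_deriv_bound (lam : ℝ) (n : ℕ) (x : ℝ) (hs : 0 < 1 - x ^ 2) (hN : 0 < (n : ℝ) + lam) :
    |(1 - x ^ 2) ^ lam * (-(2 * lam * (1 - lam) * Geg lam n x * qG lam n x) / (1 - x ^ 2) ^ 2)|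
      ≤ |lam * (1 - lam)| / ((n : ℝ) + lam) * (1 / ((1 - x ^ 2) * √(1 - x ^ 2))) * EG lam n x := by
  have hR : 0 < (1 - x ^ 2) ^ lam := Real.rpow_pos_of_pos hs _
  obtain ⟨h, -⟩ := e_bounds lam n x hs hN
  have e := Real.sq_sqrt hs.le
  have hq := Real.sqrt_pos.2 hs
  rw [EG]
  have e1 : |(1 - x ^ 2) ^ lam * (-(2 * lam * (1 - lam) * Geg lam n x * qG lam n x) / (1 - x ^ 2) ^ 2)|
    = (1 - x ^ 2) ^ lam * |lam * (1 - lam)| / ((1 - x ^ 2) ^ 2 * ((n : ℝ) + lam)) *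
      (2 * ((n : ℝ) + lam) * |Geg lam n x * qG lam n x|) := by
    rw [show (1 - x ^ 2) ^ lam * (-(2 * lam * (1 - lam) * Geg lam n x * qG lam n x) / (1 - x ^ 2) ^ 2)
      = -((1 - x ^ 2) ^ lam * 2 / (1 - x ^ 2) ^ 2 * ((lam * (1 - lam)) * (Geg lam n x * qG lam n x))) by ring,
      abs_neg, abs_mul, abs_mul (lam * (1 - lam)), abs_of_pos (a := (1 - x ^ 2) ^ lam * 2 / (1 - x ^ 2) ^ 2) (by positivity)]
    field_simp
  rw [e1]
  refine (mul_le_mul_of_nonneg_left h (by positivity)).trans (le_of_eq ?_)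
  generalize (1 - x ^ 2) ^ lam = R
  generalize |lam * (1 - lam)| = c
  set r := √(1 - x ^ 2)
  rw [← e]
  field_simp

lemma E_nonneg (lam : ℝ) (n : ℕ) (x : ℝ) (hs : 0 < 1 - x ^ 2) : 0 ≤ EG lam n x := by
  rw [EG, eG]; positivity

lemma mono_aux (lam : ℝ) (n : ℕ) (hN : 0 < (n : ℝ) + lam) :
    MonotoneOn (fun x => EG lam n x *
      Real.exp (|lam * (1 - lam)| / ((n : ℝ) + lam) * (x / √(1 - x ^ 2)))) (Set.Ioo (-1 : ℝ) 1) := by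
  have hd : ∀ x ∈ Set.Ioo (-1 : ℝ) 1, HasDerivAt (fun x => EG lam n x *
      Real.exp (|lam * (1 - lam)| / ((n : ℝ) + lam) * (x / √(1 - x ^ 2)))) _ x := fun x hx =>
    (E_deriv lam n x (s_pos hx)).mul (((t_deriv x (s_pos hx)).const_mul _).exp)
  apply monotoneOn_of_deriv_nonneg (convex_Ioo _ _)
  · exact fun x hx => (hd x hx).continuousAt.continuousWithinAt
  · rw [interior_Ioo]; exact fun x hx => (hd x hx).differentiableAt.differentiableWithinAt
  · rw [interior_Ioo]; intro x hx
    rw [(hd x hx).deriv]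
    have h := (abs_le.1 (E_deriv_bound lam n x (s_pos hx) hN)).1
    have he := Real.exp_pos (|lam * (1 - lam)| / ((n : ℝ) + lam) * (x / √(1 - x ^ 2)))
    nlinarith

lemma anti_aux (lam : ℝ) (n : ℕ) (hN : 0 < (n : ℝ) + lam) :
    AntitoneOn (fun x => EG lam n x *
      Real.exp (-(|lam * (1 - lam)| / ((n : ℝ) + lam)) * (x / √(1 - x ^ 2)))) (Set.Ioo (-1 : ℝ) 1) := by
  have hd : ∀ x ∈ Set.Ioo (-1 : ℝ) 1, HasDerivAt (fun x => EG lam n x *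
      Real.exp (-(|lam * (1 - lam)| / ((n : ℝ) + lam)) * (x / √(1 - x ^ 2)))) _ x := fun x hx =>
    (E_deriv lam n x (s_pos hx)).mul (((t_deriv x (s_pos hx)).const_mul _).exp)
  apply antitoneOn_of_deriv_nonpos (convex_Ioo _ _)
  · exact fun x hx => (hd x hx).continuousAt.continuousWithinAt
  · rw [interior_Ioo]; exact fun x hx => (hd x hx).differentiableAt.differentiableWithinAt
  · rw [interior_Ioo]; intro x hx
    rw [(hd x hx).deriv]
    have h := (abs_le.1 (E_deriv_bound lam n x (s_pos hx) hN)).2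
    have he := Real.exp_pos (-(|lam * (1 - lam)| / ((n : ℝ) + lam)) * (x / √(1 - x ^ 2)))
    nlinarith

lemma E_compare (lam : ℝ) (n : ℕ) (hN : 0 < (n : ℝ) + lam) (x : ℝ) (hx : x ∈ Set.Ioo (-1 : ℝ) 1) :
    EG lam n x ≤ EG lam n 0 * Real.exp (|lam * (1 - lam)| / ((n : ℝ) + lam) * (|x| / √(1 - x ^ 2))) ∧
    EG lam n 0 ≤ EG lam n x * Real.exp (|lam * (1 - lam)| / ((n : ℝ) + lam) * (|x| / √(1 - x ^ 2))) := by
  have h0 : (0 : ℝ) ∈ Set.Ioo (-1 : ℝ) 1 := by constructor <;> norm_num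
  set k := |lam * (1 - lam)| / ((n : ℝ) + lam) with hk
  have key : ∀ a b z : ℝ, a * Real.exp (-k * z) ≤ b → a ≤ b * Real.exp (k * z) := by
    intro a b z h
    have := mul_le_mul_of_nonneg_right h (Real.exp_pos (k * z)).le
    rwa [mul_assoc, ← Real.exp_add, show -k * z + k * z = 0 by ring, Real.exp_zero, mul_one] at this
  rcases le_total 0 x with hx0 | hx0
  · have h1 := mono_aux lam n hN h0 hx hx0
    have h2 := anti_aux lam n hN h0 hx hx0
    simp only [← hk, zero_div, mul_zero, Real.exp_zero, mul_one] at h1 h2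
    rw [abs_of_nonneg hx0]
    exact ⟨key _ _ _ h2, h1⟩
  · have h1 := mono_aux lam n hN hx h0 hx0
    have h2 := anti_aux lam n hN hx h0 hx0
    simp only [← hk, zero_div, mul_zero, Real.exp_zero, mul_one] at h1 h2
    rw [abs_of_nonpos hx0]
    constructor
    · apply key
      rwa [show -k * (-x / √(1 - x ^ 2)) = k * (x / √(1 - x ^ 2)) by ring]
    · rwa [show k * (-x / √(1 - x ^ 2)) = -k * (x / √(1 - x ^ 2)) by ring]

lemma E_close (lam : ℝ) (n : ℕ) (hN : 0 < (n : ℝ) + lam) (x : ℝ) (hx : x ∈ Set.Ioo (-1 : ℝ) 1)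
    (hy : 1 ≤ ((n : ℝ) + lam) * √(1 - x ^ 2)) :
    EG lam n x ≤ EG lam n 0 * Real.exp |lam * (1 - lam)| ∧
    |EG lam n x - EG lam n 0| ≤ |lam * (1 - lam)| * Real.exp |lam * (1 - lam)| *
      EG lam n 0 * (1 / (((n : ℝ) + lam) * √(1 - x ^ 2))) := by
  obtain ⟨h1, h2⟩ := E_compare lam n hN x hx
  have hs := s_pos hx
  have hr := Real.sqrt_pos.2 hs
  have hE0 := E_nonneg lam n 0 (by norm_num)
  have hEx := E_nonneg lam n x hs
  set c := |lam * (1 - lam)| with hc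
  have hc0 : 0 ≤ c := abs_nonneg _
  set y := 1 / (((n : ℝ) + lam) * √(1 - x ^ 2)) with hydef
  have hy0 : 0 < y := by positivity
  have hy1 : y ≤ 1 := by rw [hydef, div_le_one (by positivity)]; exact hy
  have hz : c / ((n : ℝ) + lam) * (|x| / √(1 - x ^ 2)) ≤ c * y := by
    have : c / ((n : ℝ) + lam) * (|x| / √(1 - x ^ 2)) = c * y * |x| := by
      rw [hydef]; field_simp
    rw [this]
    have : |x| ≤ 1 := (abs_lt.2 hx).le
    exact mul_le_of_le_one_right (by positivity) this
  have hexp := Real.exp_le_exp.2 hz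
  have h1' := h1.trans (mul_le_mul_of_nonneg_left hexp hE0)
  have h2' := h2.trans (mul_le_mul_of_nonneg_left hexp hEx)
  have hcy : c * y ≤ c := mul_le_of_le_one_right hc0 hy1
  have hexp2 := Real.exp_le_exp.2 hcy
  have hA : Real.exp (c * y) - 1 ≤ c * y * Real.exp (c * y) := by
    have := Real.add_one_le_exp (-(c * y))
    rw [Real.exp_neg] at this
    have hp := Real.exp_pos (c * y)
    have h3 := mul_le_mul_of_nonneg_right this hp.le
    rw [inv_mul_cancel₀ hp.ne'] at h3
    linarith
  have hB : c * y * Real.exp (c * y) ≤ c * y * Real.exp c :=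
    mul_le_mul_of_nonneg_left hexp2 (by positivity)
  have hC : Real.exp (c * y) - 1 ≤ c * y * Real.exp c := hA.trans hB
  refine ⟨h1'.trans (mul_le_mul_of_nonneg_left hexp2 hE0), ?_⟩
  have hD := mul_le_mul_of_nonneg_left hC hE0
  rw [abs_le]
  constructor
  · -- lower bound
    by_cases hle : EG lam n 0 ≤ EG lam n x
    · have : 0 ≤ c * Real.exp c * EG lam n 0 * y := by positivity
      linarith
    · push Not at hle
      have hone : 1 ≤ Real.exp (c * y) := Real.one_le_exp (by positivity)
      nlinarith
  · nlinarith

lemma geg_odd_zero (lam : ℝ) (m : ℕ) : Geg lam (2 * m + 1) 0 = 0 := by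
  induction m with
  | zero => simp [Geg]
  | succ m ih =>
    rw [show 2 * (m + 1) + 1 = (2 * m + 1) + 2 by ring, Geg, ih]; simp

noncomputable def w0 (lam : ℝ) : ℝ :=
  Real.Gamma (lam + 1) / (Real.sqrt Real.pi * Real.Gamma (lam + 1 / 2))

noncomputable def bG (lam : ℝ) (m : ℕ) : ℝ := w0 lam * TG lam (2 * m) * Geg lam (2 * m) 0 ^ 2

lemma b_form (lam : ℝ) (hlam : -(1 / 2) < lam) (hlam0 : lam ≠ 0) (m : ℕ) :
    bG lam m = Real.Gamma (lam + m) * Real.Gamma (m + 1 / 2) /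
      (Real.pi * Real.Gamma (m + 1) * Real.Gamma (lam + m + 1 / 2)) := by
  induction m with
  | zero =>
    have hp := Real.sq_sqrt Real.pi_pos.le
    have hp0 := Real.sqrt_pos.2 Real.pi_pos
    have hG : 0 < Real.Gamma (lam + 1 / 2) := Real.Gamma_pos_of_pos (by linarith)
    simp only [bG, w0, TG, Geg, Real.Gamma_add_one hlam0, Nat.cast_zero, mul_zero, add_zero,
      zero_add, Real.Gamma_one, Real.Gamma_one_half_eq, Nat.factorial_zero, ascPochhammer_zero,
      Polynomial.eval_one, Nat.cast_one, mul_one, one_pow]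
    set r := √Real.pi
    rw [← hp]
    field_simp
  | succ m ih =>
    have hm : (0 : ℝ) ≤ m := by positivity
    have h1 := T_succ lam hlam hlam0 (2 * m)
    have h2 := T_succ lam hlam hlam0 (2 * m + 1)
    have n1 := nl_ne lam hlam hlam0 (2 * m)
    have n2 := nl_ne lam hlam hlam0 (2 * m + 1)
    push_cast at h1 h2 n1 n2
    have hT : TG lam (2 * m + 2) = TG lam (2 * m) * (2 * m + 1) * (2 * m + 2) /
        ((2 * m + 2 * lam) * (2 * m + 1 + 2 * lam)) := by
      rw [eq_div_iff (mul_ne_zero n1 n2)]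
      linear_combination (2 * (m : ℝ) + 2 * lam) * h2 + (2 * (m : ℝ) + 2) * h1
    have n3 : lam + (m : ℝ) ≠ 0 := fun h => n1 (by linarith)
    have n4 : lam + (m : ℝ) + 1 / 2 ≠ 0 := by linarith
    have g1 : Real.Gamma (lam + (m + 1 : ℕ)) = (lam + m) * Real.Gamma (lam + m) := by
      rw [← Real.Gamma_add_one n3]; push_cast; ring_nf
    have g2 : Real.Gamma ((m + 1 : ℕ) + 1 / 2) = (m + 1 / 2) * Real.Gamma (m + 1 / 2) := by
      rw [← Real.Gamma_add_one (by positivity)]; push_cast; ring_nf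
    have g3 : Real.Gamma ((m + 1 : ℕ) + 1) = (m + 1) * Real.Gamma (m + 1) := by
      rw [← Real.Gamma_add_one (by positivity)]; push_cast; ring_nf
    have g4 : Real.Gamma (lam + (m + 1 : ℕ) + 1 / 2) =
        (lam + m + 1 / 2) * Real.Gamma (lam + m + 1 / 2) := by
      rw [← Real.Gamma_add_one n4]; push_cast; ring_nf
    have hC : Geg lam (2 * m + 2) 0 = -((2 * m + 2 * lam) / (2 * m + 2)) * Geg lam (2 * m) 0 := by
      rw [Geg]; push_cast; ring
    have hb : bG lam (m + 1) = bG lam m * ((m + 1 / 2) * (lam + m)) /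
        ((m + 1) * (lam + m + 1 / 2)) := by
      simp only [bG]
      rw [show 2 * (m + 1) = 2 * m + 2 by ring, hT, hC]
      have n5 : (m : ℝ) + 1 ≠ 0 := by positivity
      have n6 : 2 * (m : ℝ) + 2 ≠ 0 := by positivity
      have n7 : (m : ℝ) + lam ≠ 0 := by rwa [add_comm]
      rw [show 2 * (m : ℝ) + 2 * lam = 2 * (lam + m) by ring,
        show 2 * (m : ℝ) + 1 + 2 * lam = 2 * (lam + m + 1 / 2) by ring,
        show 2 * (m : ℝ) + 2 = 2 * (m + 1) by ring,
        show 2 * (m : ℝ) + 1 = 2 * (m + 1 / 2) by ring]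
      generalize lam + (m : ℝ) + 1 / 2 = A at *
      generalize lam + (m : ℝ) = B at *
      generalize (m : ℝ) + 1 / 2 = D at *
      field_simp
    rw [hb, ih, g1, g2, g3, g4]
    have p1 : Real.Gamma ((m : ℝ) + 1) ≠ 0 := (Real.Gamma_pos_of_pos (by positivity)).ne'
    have p2 : Real.Gamma (lam + (m : ℝ) + 1 / 2) ≠ 0 := (Real.Gamma_pos_of_pos (by linarith)).ne'
    rw [div_mul_eq_mul_div, div_div]
    congr 1 <;> ring

lemma gamma_half_upper (x : ℝ) (hx : 0 < x) :
    Real.Gamma (x + 1 / 2) ^ 2 ≤ x * Real.Gamma x ^ 2 := by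
  have h := Real.Gamma_mul_add_mul_le_rpow_Gamma_mul_rpow_Gamma hx (show 0 < x + 1 by linarith)
    (show (0:ℝ) < 1 / 2 by norm_num) (show (0:ℝ) < 1 / 2 by norm_num) (by norm_num)
  have p0 := Real.Gamma_pos_of_pos hx
  rw [show 1 / 2 * x + 1 / 2 * (x + 1) = x + 1 / 2 by ring, Real.Gamma_add_one hx.ne',
    ← Real.sqrt_eq_rpow, ← Real.sqrt_eq_rpow] at h
  have p := Real.Gamma_pos_of_pos (show 0 < x + 1 / 2 by linarith)
  calc Real.Gamma (x + 1 / 2) ^ 2 ≤ (√(Real.Gamma x) * √(x * Real.Gamma x)) ^ 2 := by gcongr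
    _ = _ := by
      rw [mul_pow, Real.sq_sqrt p0.le, Real.sq_sqrt (by positivity)]; ring

lemma gamma_half_lower (x : ℝ) (hx : 1 / 2 < x) :
    (x - 1 / 2) * Real.Gamma x ^ 2 ≤ Real.Gamma (x + 1 / 2) ^ 2 := by
  have h := gamma_half_upper (x - 1 / 2) (by linarith)
  have e := Real.Gamma_add_one (show x - 1 / 2 ≠ 0 by linarith)
  rw [show x - 1 / 2 + 1 = x + 1 / 2 by ring] at e
  rw [show x - 1 / 2 + 1 / 2 = x by ring] at h
  rw [e]
  nlinarith

lemma b_pos (lam : ℝ) (hlam : -(1 / 2) < lam) (hlam0 : lam ≠ 0) (m : ℕ) (hm : 1 ≤ m) :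
    0 < bG lam m := by
  have hm' : (1 : ℝ) ≤ m := by exact_mod_cast hm
  rw [b_form lam hlam hlam0]
  have := Real.Gamma_pos_of_pos (show 0 < lam + m by linarith)
  have := Real.Gamma_pos_of_pos (show 0 < lam + m + 1 / 2 by linarith)
  have := Real.Gamma_pos_of_pos (show 0 < (m:ℝ) + 1 / 2 by linarith)
  have := Real.Gamma_pos_of_pos (show 0 < (m:ℝ) + 1 by linarith)
  have := Real.pi_pos
  positivity

lemma b_sq (lam : ℝ) (hlam : -(1 / 2) < lam) (hlam0 : lam ≠ 0) (m : ℕ) (hm : 1 ≤ m) :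
    1 ≤ (Real.pi * bG lam m) ^ 2 * ((lam + m) * (m + 1 / 2)) ∧
    (Real.pi * bG lam m) ^ 2 * ((lam + m - 1 / 2) * m) ≤ 1 := by
  have hm' : (1 : ℝ) ≤ m := by exact_mod_cast hm
  rw [b_form lam hlam hlam0]
  have p1 := Real.Gamma_pos_of_pos (show 0 < lam + m by linarith)
  have p2 := Real.Gamma_pos_of_pos (show 0 < lam + m + 1 / 2 by linarith)
  have p3 := Real.Gamma_pos_of_pos (show 0 < (m:ℝ) + 1 / 2 by linarith)
  have p4 := Real.Gamma_pos_of_pos (show 0 < (m:ℝ) + 1 by linarith)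
  have pp := Real.pi_pos
  have u1 := gamma_half_upper (lam + m) (by linarith)
  have l1 := gamma_half_lower (lam + m) (by linarith)
  have u2 := gamma_half_upper (m + 1 / 2) (by linarith)
  have l2 := gamma_half_lower (m + 1 / 2) (by linarith)
  rw [show (m : ℝ) + 1 / 2 + 1 / 2 = m + 1 by ring] at u2 l2
  rw [show (m : ℝ) + 1 / 2 - 1 / 2 = m by ring] at l2
  set X := Real.Gamma (lam + m)
  set X' := Real.Gamma (lam + m + 1 / 2)
  set Y := Real.Gamma ((m:ℝ) + 1 / 2)
  set Y' := Real.Gamma ((m:ℝ) + 1)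
  have e : Real.pi * (X * Y / (Real.pi * Y' * X')) = X * Y / (X' * Y') := by
    field_simp
  rw [e, div_pow, div_mul_eq_mul_div]
  constructor
  · rw [le_div_iff₀ (by positivity)]
    have := mul_le_mul u1 u2 (by positivity) (mul_nonneg (by linarith) (by positivity))
    nlinarith
  · rw [div_mul_eq_mul_div, div_le_iff₀ (by positivity)]
    have := mul_le_mul l1 l2 (by positivity) (by positivity)
    nlinarith

lemma g_close (lam : ℝ) (hlam : -(1 / 2) < lam) (hlam0 : lam ≠ 0) :
    ∃ C > (0 : ℝ), ∀ m : ℕ, 1 ≤ m →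
      (2 * (m : ℝ) + lam) * |Real.pi * (2 * (m : ℝ) + lam) * bG lam m - 2| ≤ C := by
  set d := min 1 (lam + 1 / 2) with hd
  have hd0 : 0 < d := lt_min one_pos (by linarith)
  have hd1 : d ≤ 1 := min_le_left _ _
  have hd2 : d ≤ lam + 1 / 2 := min_le_right _ _
  refine ⟨(2 + lam ^ 2 + 2 * |lam|) * (2 + |lam|) / d, by positivity, ?_⟩
  intro m hm
  have hm' : (1 : ℝ) ≤ m := by exact_mod_cast hm
  obtain ⟨h1, h2⟩ := b_sq lam hlam hlam0 m hm
  have hb := b_pos lam hlam hlam0 m hm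
  have pp := Real.pi_pos
  set N := 2 * (m : ℝ) + lam with hN
  have hN0 : 0 < N := by rw [hN]; linarith
  set v := (Real.pi * bG lam m) ^ 2 with hv
  set g := Real.pi * N * bG lam m with hg
  have hg0 : 0 < g := by positivity
  have hg2 : g ^ 2 = N ^ 2 * v := by rw [hg, hv]; ring
  have hv0 : 0 ≤ v := by positivity
  have hx : d * m ≤ lam + m - 1 / 2 := by nlinarith
  have hdm : 0 < d * m := by positivity
  -- v ≤ 1/(d m^2)
  have hvm : v * (d * m ^ 2) ≤ 1 := by
    have : v * (d * m * m) ≤ v * ((lam + m - 1 / 2) * m) := by gcongr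
    nlinarith
  have hla := neg_abs_le lam
  have hlb := le_abs_self lam
  have hup : g ^ 2 - 4 ≤ v * (2 * m + lam ^ 2) := by
    have : N ^ 2 = 4 * ((lam + m - 1 / 2) * m) + (2 * m + lam ^ 2) := by rw [hN]; ring
    rw [hg2, this]; nlinarith
  have hlo : -(v * (2 * m + 2 * |lam|)) ≤ g ^ 2 - 4 := by
    have : N ^ 2 = 4 * ((lam + m) * (m + 1 / 2)) - (2 * m + 2 * lam - lam ^ 2) := by rw [hN]; ring
    rw [hg2, this]
    have : v * (2 * m + 2 * lam - lam ^ 2) ≤ v * (2 * m + 2 * |lam|) := by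
      apply mul_le_mul_of_nonneg_left _ hv0; nlinarith [sq_nonneg lam]
    nlinarith
  have hM : |g ^ 2 - 4| ≤ v * ((2 + lam ^ 2 + 2 * |lam|) * m) := by
    have hla0 := abs_nonneg lam
    rw [abs_le]; constructor
    · have : v * (2 * m + 2 * |lam|) ≤ v * ((2 + lam ^ 2 + 2 * |lam|) * m) := by
        apply mul_le_mul_of_nonneg_left _ hv0; nlinarith [sq_nonneg lam, mul_nonneg (sq_nonneg lam) (by linarith : (0:ℝ) ≤ m)]
      linarith
    · have : v * (2 * m + lam ^ 2) ≤ v * ((2 + lam ^ 2 + 2 * |lam|) * m) := by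
        apply mul_le_mul_of_nonneg_left _ hv0; nlinarith [sq_nonneg lam]
      linarith
  have hg4 : |g - 2| ≤ |g ^ 2 - 4| := by
    rw [show g ^ 2 - 4 = (g - 2) * (g + 2) by ring, abs_mul, abs_of_pos (by linarith : 0 < g + 2)]
    nlinarith [abs_nonneg (g - 2)]
  have hNm : N ≤ (2 + |lam|) * m := by
    have hla0 := abs_nonneg lam
    rw [hN]; nlinarith
  rw [le_div_iff₀ hd0]
  calc N * |g - 2| * d ≤ ((2 + |lam|) * m) * (v * ((2 + lam ^ 2 + 2 * |lam|) * m)) * d := by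
        gcongr
        exact hg4.trans hM
    _ = (2 + lam ^ 2 + 2 * |lam|) * (2 + |lam|) * (v * (d * m ^ 2)) := by ring
    _ ≤ (2 + lam ^ 2 + 2 * |lam|) * (2 + |lam|) * 1 := by gcongr
    _ = _ := by ring

lemma E0_form (lam : ℝ) (m : ℕ) :
    EG lam (2 * m) 0 = (2 * (m : ℝ) + lam) ^ 2 * Geg lam (2 * m) 0 ^ 2 := by
  simp [EG, eG, qG, geg_odd_zero]

/-- The bracket in the closed form of the kernel is the energy plus lower-order terms. -/
lemma bracket_close (lam : ℝ) (n : ℕ) (hN : 1 ≤ (n : ℝ) + lam) (x : ℝ)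
    (hx : x ∈ Set.Ioo (-1 : ℝ) 1) (hy : 1 ≤ ((n : ℝ) + lam) * √(1 - x ^ 2)) :
    |(((n : ℝ) + 1) * ((n : ℝ) + 2 * lam) * Geg lam n x ^ 2
      + (1 - 2 * lam) * x * Geg lam n x * dG lam n x + (1 - x ^ 2) * dG lam n x ^ 2) - eG lam n x|
      ≤ (2 + 2 * |lam * (1 - lam)|) * eG lam n x * (1 / (((n : ℝ) + lam) * √(1 - x ^ 2))) := by
  have hs := s_pos hx
  have hr := Real.sqrt_pos.2 hs
  have er := Real.sq_sqrt hs.le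
  have hN0 : 0 < (n : ℝ) + lam := by linarith
  obtain ⟨h1, h2⟩ := e_bounds lam n x hs hN0
  have hd : dG lam n x = (qG lam n x + lam * x * Geg lam n x) / (1 - x ^ 2) := by
    rw [← dG_q]; field_simp
  have heq : (((n : ℝ) + 1) * ((n : ℝ) + 2 * lam) * Geg lam n x ^ 2
      + (1 - 2 * lam) * x * Geg lam n x * dG lam n x + (1 - x ^ 2) * dG lam n x ^ 2) - eG lam n x
      = (((n : ℝ) + lam) + lam * (1 - lam)) * Geg lam n x ^ 2
        + x * (Geg lam n x * qG lam n x) / (1 - x ^ 2)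
        + lam * (1 - lam) * (x ^ 2 * Geg lam n x ^ 2) / (1 - x ^ 2) := by
    rw [hd, eG]
    have hs' := hs.ne'
    field_simp
    ring
  rw [heq]
  have he : 0 ≤ eG lam n x := le_trans (by positivity) h2
  have hx1 : |x| ≤ 1 := (abs_lt.2 hx).le
  have hx2 : x ^ 2 ≤ 1 := by linarith
  have hr1 : √(1 - x ^ 2) ≤ 1 := by
    exact Real.sqrt_le_iff.2 ⟨by norm_num, by nlinarith [sq_nonneg x]⟩
  set N := (n : ℝ) + lam
  set r := √(1 - x ^ 2)
  set P := Geg lam n x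
  set q := qG lam n x
  set e := eG lam n x
  set y := 1 / (N * r) with hyd
  have hy0 : 0 < y := by positivity
  have hy1 : y ≤ 1 := by rw [hyd, div_le_one (by positivity)]; exact hy
  have hP : P ^ 2 ≤ e / N ^ 2 := by rw [le_div_iff₀ (by positivity)]; linarith
  have hNy : 1 / N ≤ y := by
    rw [hyd]; apply one_div_le_one_div_of_le (by positivity); nlinarith
  have hyy : y ^ 2 ≤ y := by nlinarith
  have hPs : P ^ 2 / (1 - x ^ 2) ≤ e * y := by
    calc P ^ 2 / (1 - x ^ 2) ≤ (e / N ^ 2) / (1 - x ^ 2) := by gcongr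
      _ = e * y ^ 2 := by rw [hyd, ← er]; field_simp
      _ ≤ e * y := by gcongr
  have hPs' : P ^ 2 ≤ P ^ 2 / (1 - x ^ 2) := by
    rw [le_div_iff₀ hs]; nlinarith [sq_nonneg P, sq_nonneg x, mul_nonneg (sq_nonneg P) (sq_nonneg x)]
  have hNP : N * P ^ 2 ≤ e * y := by
    calc N * P ^ 2 ≤ N * (e / N ^ 2) := by gcongr
      _ = e * (1 / N) := by field_simp
      _ ≤ e * y := by gcongr
  have hPq : |P * q| / (1 - x ^ 2) ≤ e * y := by
    have : |P * q| ≤ r * e / N := by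
      rw [le_div_iff₀ (by positivity)]; nlinarith [abs_nonneg (P * q)]
    calc |P * q| / (1 - x ^ 2) ≤ (r * e / N) / (1 - x ^ 2) := by gcongr
      _ = e * y := by rw [hyd, ← er]; field_simp
  set c := |lam * (1 - lam)| with hc
  have hc0 : 0 ≤ c := abs_nonneg _
  have t1 : |(N + lam * (1 - lam)) * P ^ 2| ≤ e * y + c * (e * y) := by
    rw [add_mul]
    refine (abs_add_le _ _).trans (add_le_add ?_ ?_)
    · rw [abs_of_nonneg (by positivity)]; exact hNP
    · rw [abs_mul, abs_of_nonneg (sq_nonneg P)]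
      exact mul_le_mul_of_nonneg_left (hPs'.trans hPs) hc0
  have t2 : |x * (P * q) / (1 - x ^ 2)| ≤ e * y := by
    rw [abs_div, abs_mul, abs_of_pos hs]
    refine le_trans ?_ hPq
    gcongr
    exact mul_le_of_le_one_left (abs_nonneg _) hx1
  have t3 : |lam * (1 - lam) * (x ^ 2 * P ^ 2) / (1 - x ^ 2)| ≤ c * (e * y) := by
    rw [mul_div_assoc, abs_mul, ← hc]
    apply mul_le_mul_of_nonneg_left _ hc0
    rw [abs_of_nonneg (by positivity)]
    refine le_trans ?_ hPs
    gcongr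
    exact mul_le_of_le_one_left (sq_nonneg _) hx2
  calc _ ≤ _ := abs_add_three _ _ _
    _ ≤ (e * y + c * (e * y)) + e * y + c * (e * y) := by gcongr
    _ = _ := by ring

set_option maxHeartbeats 1000000 in
lemma even_bound (lam : ℝ) (hlam : -(1 / 2) < lam) (hlam0 : lam ≠ 0) :
    ∃ C > (0 : ℝ), ∀ m : ℕ, 1 ≤ m → ∀ x ∈ Set.Ioo (-1 : ℝ) 1,
      1 ≤ (2 * (m : ℝ) + lam) * √(1 - x ^ 2) →
      |KG lam (2 * m) x x * wG lam x - (2 * (m : ℝ) + 1) / (Real.pi * √(1 - x ^ 2))|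
        ≤ C / (1 - x ^ 2) := by
  obtain ⟨C4, hC4, hg⟩ := g_close lam hlam hlam0
  set c := |lam * (1 - lam)| with hc
  have hc0 : 0 ≤ c := abs_nonneg _
  set C3 := (c + (2 + 2 * c)) * Real.exp c with hC3
  have hC30 : 0 < C3 := by positivity
  refine ⟨(C4 + |lam| + 1) + (2 + C4) * C3, by positivity, ?_⟩
  intro m hm x hx hy
  have hm' : (1 : ℝ) ≤ m := by exact_mod_cast hm
  have hs := s_pos hx
  have hr := Real.sqrt_pos.2 hs
  have er := Real.sq_sqrt hs.le
  have hr1 : √(1 - x ^ 2) ≤ 1 := by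
    exact Real.sqrt_le_iff.2 ⟨by norm_num, by nlinarith [sq_nonneg x]⟩
  have hg := hg m hm
  have hb := b_pos lam hlam hlam0 m hm
  have hN1 : 1 ≤ 2 * (m : ℝ) + lam := by linarith
  have hcast : ((2 * m : ℕ) : ℝ) = 2 * (m : ℝ) := by push_cast; ring
  have hE := E_close lam (2 * m) (by rw [hcast]; linarith) x hx (by rw [hcast]; exact hy)
  have hB := bracket_close lam (2 * m) (by rw [hcast]; linarith) x hx (by rw [hcast]; exact hy)
  have hK := K_form lam hlam hlam0 (2 * m) x hs
  rw [hcast] at hE hB hK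
  set B := ((2 * (m : ℝ) + 1) * (2 * (m : ℝ) + 2 * lam) * Geg lam (2 * m) x ^ 2 +
    (1 - 2 * lam) * x * Geg lam (2 * m) x * dG lam (2 * m) x +
    (1 - x ^ 2) * dG lam (2 * m) x ^ 2) with hBdef
  have hw : wG lam x = w0 lam * ((1 - x ^ 2) ^ lam / √(1 - x ^ 2)) := by
    rw [wG, w0, Real.rpow_sub hs, Real.sqrt_eq_rpow (1 - x ^ 2)]
  have hE0 := E0_form lam m
  have hE00 := E_nonneg lam (2 * m) 0 (by norm_num)
  have hR : 0 < (1 - x ^ 2) ^ lam := Real.rpow_pos_of_pos hs _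
  have hEx : EG lam (2 * m) x = (1 - x ^ 2) ^ lam * eG lam (2 * m) x := rfl
  set E0 := EG lam (2 * m) 0
  set E := EG lam (2 * m) x
  set R := (1 - x ^ 2) ^ lam
  set N := 2 * (m : ℝ) + lam with hNdef
  set r := √(1 - x ^ 2)
  set y := 1 / (N * r) with hyd
  have hN0 : 0 < N := by linarith
  have hy0 : 0 < y := by positivity
  -- R * B close to E0
  have hRB : |R * B - E0| ≤ C3 * E0 * y := by
    have h1 : |R * B - E| ≤ (2 + 2 * c) * (E0 * Real.exp c) * y := by
      rw [hEx, ← mul_sub, abs_mul, abs_of_pos hR]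
      calc R * |B - eG lam (2 * m) x| ≤ R * ((2 + 2 * c) * eG lam (2 * m) x * y) := by gcongr
        _ = (2 + 2 * c) * E * y := by rw [hEx]; ring
        _ ≤ _ := by gcongr; exact hE.1
    calc |R * B - E0| ≤ |R * B - E| + |E - E0| := abs_sub_le _ _ _
      _ ≤ (2 + 2 * c) * (E0 * Real.exp c) * y + c * Real.exp c * E0 * y := add_le_add h1 hE.2
      _ = _ := by rw [hC3]; ring
  -- constants
  have hconst : w0 lam * TG lam (2 * m) * E0 = N ^ 2 * bG lam m := by
    rw [hE0, bG]; ring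
  have hT : 0 < TG lam (2 * m) := by
    obtain ⟨k, hk⟩ : ∃ k, 2 * m = k + 1 := ⟨2 * m - 1, by omega⟩
    rw [hk]; exact T_pos lam hlam hlam0 k
  have hw0 : 0 < w0 lam := by
    have h1 := Real.Gamma_pos_of_pos (show 0 < lam + 1 by linarith)
    have h2 := Real.Gamma_pos_of_pos (show 0 < lam + 1 / 2 by linarith)
    have h3 := Real.pi_pos
    rw [w0]; positivity
  have pp := Real.pi_pos
  have pp3 := Real.pi_gt_three
  have e1 : KG lam (2 * m) x x * wG lam x - (2 * (m : ℝ) + 1) / (Real.pi * r)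
    = ((w0 lam * TG lam (2 * m) / 2 * (R * B - E0)) +
      ((Real.pi * N * bG lam m - 2) * N / 2 + (lam - 1)) / Real.pi) / r := by
    have : ((Real.pi * N * bG lam m - 2) * N / 2 + (lam - 1)) / Real.pi
      = w0 lam * TG lam (2 * m) * E0 / 2 - (2 * (m : ℝ) + 1) / Real.pi := by
      rw [hconst, hNdef]; field_simp; ring
    rw [this, hK, hw]
    field_simp
    ring
  rw [e1, abs_div, abs_of_pos hr, ← er, div_le_div_iff₀ hr (by positivity)]
  set g := Real.pi * N * bG lam m with hgd
  have hg1 : g ≤ 2 + C4 := by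
    have := abs_nonneg (g - 2)
    have h2 : |g - 2| ≤ C4 := by nlinarith
    have := le_abs_self (g - 2)
    linarith
  have hg0 : 0 < g := by positivity
  have a1 : |w0 lam * TG lam (2 * m) / 2 * (R * B - E0)| ≤ (2 + C4) * C3 / r := by
    rw [abs_mul, abs_of_pos (by positivity)]
    calc w0 lam * TG lam (2 * m) / 2 * |R * B - E0|
        ≤ w0 lam * TG lam (2 * m) / 2 * (C3 * E0 * y) := by gcongr
      _ = (w0 lam * TG lam (2 * m) * E0) * C3 * y / 2 := by ring
      _ = g * C3 / r / (2 * Real.pi) := by rw [hconst, hyd, hgd]; field_simp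
      _ ≤ g * C3 / r := div_le_self (by positivity) (by linarith)
      _ ≤ _ := by gcongr
  have a2 : |((g - 2) * N / 2 + (lam - 1)) / Real.pi| ≤ C4 + |lam| + 1 := by
    rw [abs_div, abs_of_pos pp]
    refine (div_le_self (abs_nonneg _) (by linarith)).trans ?_
    have b1 : |(g - 2) * N / 2| ≤ C4 := by
      rw [abs_div, abs_mul, abs_of_pos hN0, abs_of_pos (by norm_num : (0:ℝ) < 2)]
      linarith
    have b2 : |lam - 1| ≤ |lam| + 1 := by simpa using abs_sub lam 1
    have := abs_add_le ((g - 2) * N / 2) (lam - 1)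
    linarith [this, b1, b2]
  clear_value B R E E0 g N y r c C3
  have a3 : C4 + |lam| + 1 ≤ (C4 + |lam| + 1) / r := by
    rw [le_div_iff₀ hr]
    exact mul_le_of_le_one_right (by positivity) hr1
  have a4 := (abs_add_le (w0 lam * TG lam (2 * m) / 2 * (R * B - E0))
    (((g - 2) * N / 2 + (lam - 1)) / Real.pi)).trans (add_le_add a1 (a2.trans a3))
  calc _ ≤ ((2 + C4) * C3 / r + (C4 + |lam| + 1) / r) * r ^ 2 := by gcongr
    _ = _ := by field_simp; ring

end GegAux

open GegAux in
theorem gegenbauer_kernel_diagonal_bound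
    (lam : ℝ) (hlam : -(1 / 2) < lam) (hlam0 : lam ≠ 0) :
    ∃ Q > (0 : ℝ), ∀ n : ℕ, 2 ≤ n → ∀ x ∈ Set.Ioo (-1 : ℝ) 1,
      |KG lam n x x * wG lam x - ((n : ℝ) + 1) / (Real.pi * Real.sqrt (1 - x ^ 2))|
        ≤ Q * Real.log n / (1 - x ^ 2) := by
  obtain ⟨C, hC, hev⟩ := even_bound lam hlam hlam0
  refine ⟨2 * (C + 16), by positivity, ?_⟩
  intro n hn x hx
  have hn' : (2 : ℝ) ≤ n := by exact_mod_cast hn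
  have hs := s_pos hx
  have hr := Real.sqrt_pos.2 hs
  have er := Real.sq_sqrt hs.le
  have hr1 : √(1 - x ^ 2) ≤ 1 := by
    exact Real.sqrt_le_iff.2 ⟨by norm_num, by nlinarith [sq_nonneg x]⟩
  have hlog : 1 / 2 ≤ Real.log n := by
    have h1 := Real.log_two_gt_d9
    have h2 := Real.log_le_log (by norm_num) hn'
    linarith
  have hw : 0 ≤ wG lam x := by
    have h1 := Real.Gamma_pos_of_pos (show 0 < lam + 1 by linarith)
    have h2 := Real.Gamma_pos_of_pos (show 0 < lam + 1 / 2 by linarith)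
    have h3 := Real.pi_pos
    rw [wG]; positivity
  suffices h : |KG lam n x x * wG lam x - ((n : ℝ) + 1) / (Real.pi * √(1 - x ^ 2))|
      ≤ (C + 16) / (1 - x ^ 2) by
    refine h.trans ?_
    gcongr
    nlinarith
  have pp := Real.pi_pos
  have pp3 := Real.pi_gt_three
  have hL : 1 / (Real.pi * √(1 - x ^ 2)) ≤ 1 / √(1 - x ^ 2) := by
    apply one_div_le_one_div_of_le hr; nlinarith
  have hrs : 1 / √(1 - x ^ 2) * (1 / √(1 - x ^ 2)) = 1 / (1 - x ^ 2) := by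
    rw [div_mul_div_comm, one_mul, Real.mul_self_sqrt hs.le]
  have hr2 : 1 ≤ 1 / √(1 - x ^ 2) := by rw [le_div_iff₀ hr]; linarith
  have hdiv : ∀ a : ℝ, a / (Real.pi * √(1 - x ^ 2)) = a * (1 / (Real.pi * √(1 - x ^ 2))) :=
    fun a => by ring
  have hdiv' : ∀ a : ℝ, a / (1 - x ^ 2) = a * (1 / (1 - x ^ 2)) := fun a => by ring
  have hL0 : 0 < 1 / (Real.pi * √(1 - x ^ 2)) := by positivity
  rcases le_or_gt 4 ((n : ℝ) * √(1 - x ^ 2)) with hc | hc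
  · -- both neighbouring even indices are in the oscillatory range
    have gen : ∀ m : ℕ, 1 ≤ m → (n : ℝ) - 1 ≤ 2 * (m : ℝ) →
        |KG lam (2 * m) x x * wG lam x - (2 * (m : ℝ) + 1) / (Real.pi * √(1 - x ^ 2))|
        ≤ C / (1 - x ^ 2) := by
      intro m hm hmn
      apply hev m hm x hx
      have : (n : ℝ) / 4 ≤ 2 * (m : ℝ) + lam := by linarith
      nlinarith
    have l1 : (n : ℝ) - 1 ≤ 2 * ((n / 2 : ℕ) : ℝ) := by
      have : n ≤ 2 * (n / 2) + 1 := by omega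
      have : (n : ℝ) ≤ 2 * ((n / 2 : ℕ) : ℝ) + 1 := by exact_mod_cast this
      linarith
    have l2 : (n : ℝ) ≤ 2 * (((n + 1) / 2 : ℕ) : ℝ) := by
      have : n ≤ 2 * ((n + 1) / 2) := by omega
      exact_mod_cast this
    have l3 : 2 * (((n + 1) / 2 : ℕ) : ℝ) ≤ n + 1 := by
      have : 2 * ((n + 1) / 2) ≤ n + 1 := by omega
      exact_mod_cast this
    have h1 := (abs_le.1 (gen (n / 2) (by omega) l1)).1
    have h2 := (abs_le.1 (gen ((n + 1) / 2) (by omega) (by linarith))).2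
    have k1 := mul_le_mul_of_nonneg_right (K_mono lam (show 2 * (n / 2) ≤ n by omega) x) hw
    have k2 := mul_le_mul_of_nonneg_right (K_mono lam (show n ≤ 2 * ((n + 1) / 2) by omega) x) hw
    rw [hdiv, hdiv'] at h1 h2
    rw [hdiv, hdiv', abs_le]
    set L := 1 / (Real.pi * √(1 - x ^ 2))
    have m1 := mul_le_mul_of_nonneg_right l1 hL0.le
    have m2 := mul_le_mul_of_nonneg_right l3 hL0.le
    have hLs : L ≤ 1 / (1 - x ^ 2) := by rw [← hrs]; nlinarith
    constructor <;> nlinarith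
  · -- compare with a larger even index
    set ρ := 1 / √(1 - x ^ 2) with hρ
    have hnρ : (n : ℝ) ≤ 4 * ρ := by
      rw [hρ, mul_one_div, le_div_iff₀ hr]; exact hc.le
    obtain ⟨m, hm1, hm2⟩ : ∃ m : ℕ, 4 * ρ ≤ m ∧ (m : ℝ) ≤ 4 * ρ + 1 :=
      ⟨⌈4 * ρ⌉₊, Nat.le_ceil _, (Nat.ceil_lt_add_one (by positivity)).le⟩
    have hm : 1 ≤ m := by
      have : (1 : ℝ) ≤ m := by linarith
      exact_mod_cast this
    have hnm : n ≤ 2 * m := by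
      have : (n : ℝ) ≤ 2 * m := by linarith
      exact_mod_cast this
    have h := hev m hm x hx (by
      have : ρ ≤ 2 * (m : ℝ) + lam := by linarith
      rw [hρ, div_le_iff₀ hr] at this; exact this)
    have h2 := (abs_le.1 h).2
    have k2 := mul_le_mul_of_nonneg_right (K_mono lam hnm x) hw
    have k0 := mul_nonneg (K_nonneg lam n x) hw
    rw [hdiv, hdiv', ← hrs] at h2
    rw [hdiv, hdiv', abs_le, ← hrs]
    set L := 1 / (Real.pi * √(1 - x ^ 2))
    have u1 : (2 * (m : ℝ) + 1) * L ≤ (11 * ρ) * ρ := by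
      apply mul_le_mul _ hL hL0.le (by positivity); linarith
    have u2 : ((n : ℝ) + 1) * L ≤ (5 * ρ) * ρ := by
      apply mul_le_mul _ hL hL0.le (by positivity); linarith
    have u3 : 0 ≤ ((n : ℝ) + 1) * L := by positivity
    have u4 : 0 ≤ C * (ρ * ρ) := by positivity
    constructor <;> nlinarith
end
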